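/- Let K = GF(q) be a finite field with q ≡ 3 (mod 4) and (V, f) a finite-dimensional nondegenerate symmetric bilinear space over K. Let φ ∈ Ω(V). Then φ is bireflectional in Ω(V) if and only if φ is bireflectional in SO(V) and at least one of the following holds: (1) φ has an elementary divisor p^d with p monic irreducible, p ≠ x − 1, p ≠ x + 1, and d odd; or (2) φ has an orthogonal summand of even dimension and discriminant −1; or (3) n₃(φ) + n₅(φ) + n₂(φ)/2 + n₆(φ)/2 ≡ (dim Bahn^∞(φ²))/4 (mod 2), where n_j(φ) denotes the number of elementary divisors of φ of the form (x − 1)^d or (x + 1)^d, counted with multiplicity, with d ≡ j (mod 8). -/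

import Mathlib

open Polynomial Module

namespace Biref

variable {K V : Type*} [Field K] [AddCommGroup V] [Module K V]

/-- The orthogonal group of a bilinear form: all linear automorphisms preserving `f`. -/
def orthGroup (f : LinearMap.BilinForm K V) : Subgroup (V ≃ₗ[K] V) where
  carrier := {φ | ∀ x y : V, f (φ x) (φ y) = f x y}
  one_mem' := fun _ _ => rfl
  mul_mem' := by
    intro a b ha hb x y
    simpa using (ha (b x) (b y)).trans (hb x y)
  inv_mem' := by
    intro a ha x y
    show f (a.symm x) (a.symm y) = f x y
    conv_rhs => rw [← a.apply_symm_apply x, ← a.apply_symm_apply y]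
    exact (ha _ _).symm

/-- The special orthogonal group: isometries of determinant 1. -/
def specialOrthGroup (f : LinearMap.BilinForm K V) : Subgroup (V ≃ₗ[K] V) where
  carrier := {φ | (∀ x y : V, f (φ x) (φ y) = f x y) ∧
      LinearMap.det (φ : V →ₗ[K] V) = 1}
  one_mem' := ⟨fun _ _ => rfl, by simp⟩
  mul_mem' := by
    rintro a b ⟨ha, ha'⟩ ⟨hb, hb'⟩
    refine ⟨fun x y => by simpa using (ha (b x) (b y)).trans (hb x y), ?_⟩
    rw [LinearEquiv.coe_toLinearMap_mul, map_mul, ha', hb', one_mul]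
  inv_mem' := by
    rintro a ⟨ha, ha'⟩
    refine ⟨fun x y => ?_, ?_⟩
    · show f (a.symm x) (a.symm y) = f x y
      conv_rhs => rw [← a.apply_symm_apply x, ← a.apply_symm_apply y]
      exact (ha _ _).symm
    · have h1 : LinearMap.det ((a⁻¹ * a : V ≃ₗ[K] V) : V →ₗ[K] V) = 1 := by
        rw [inv_mul_cancel, LinearEquiv.coe_toLinearMap_one, LinearMap.det_id]
      rw [LinearEquiv.coe_toLinearMap_mul, map_mul, ha', mul_one] at h1
      exact h1

/-- The commutator subgroup `Ω(V)` of the orthogonal group. -/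
def omegaGroup (f : LinearMap.BilinForm K V) : Subgroup (V ≃ₗ[K] V) :=
  ⁅orthGroup f, orthGroup f⁆

/-- `g` is a product of two involutions lying in the subgroup `H`. -/
def IsBireflectionalIn {G : Type*} [Group G] (H : Subgroup G) (g : G) : Prop :=
  ∃ σ τ : G, σ ∈ H ∧ τ ∈ H ∧ σ ^ 2 = 1 ∧ τ ^ 2 = 1 ∧ g = σ * τ

/-- `g` is bireflectional in the group `G`. -/
def IsBireflectional {G : Type*} [Group G] (g : G) : Prop :=
  ∃ σ τ : G, σ ^ 2 = 1 ∧ τ ^ 2 = 1 ∧ g = σ * τ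

/-- `g` is reversed by some element of `H`. -/
def IsReversibleIn {G : Type*} [Group G] (H : Subgroup G) (g : G) : Prop :=
  ∃ α : G, α ∈ H ∧ α * g * α⁻¹ = g⁻¹

/-- A subspace is invariant under an endomorphism. -/
def Invt (ψ : V →ₗ[K] V) (U : Submodule K V) : Prop :=
  ∀ x ∈ U, ψ x ∈ U

/-- The discriminant of a (finite-dimensional, nondegenerate) bilinear space is the class
of `d` in `K*/(K*)²`: some Gram determinant equals `d` times a nonzero square. -/
def HasDisc (f : LinearMap.BilinForm K V) (d : K) : Prop :=
  ∃ (b : Basis (Fin (Module.finrank K V)) K V) (c : Kˣ),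
    (Matrix.of fun i j => f (b i) (b j)).det = d * (c : K) ^ 2

/-- A nondegenerate symmetric bilinear space is hyperbolic iff its Witt index is half its
dimension, i.e. there is a totally isotropic subspace of half the dimension. -/
def IsHyperbolicSpace (f : LinearMap.BilinForm K V) : Prop :=
  ∃ W : Submodule K V, (∀ x ∈ W, ∀ y ∈ W, f x y = 0) ∧
    2 * Module.finrank K W = Module.finrank K V

/-- The multiplicity of `p ^ d` as an elementary divisor of `φ`. -/
noncomputable def edMult (φ : Module.End K V) (p : K[X]) (d : ℕ) : ℕ :=
  (2 * Module.finrank K (LinearMap.ker (Polynomial.aeval φ p ^ d))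
    - Module.finrank K (LinearMap.ker (Polynomial.aeval φ p ^ (d + 1)))
    - Module.finrank K (LinearMap.ker (Polynomial.aeval φ p ^ (d - 1)))) / p.natDegree

/-- `n_j(φ)`: the number of elementary divisors `(x ± 1) ^ d` of `φ` with `d ≡ j mod 8`,
counted with multiplicity. -/
noncomputable def nPM [FiniteDimensional K V] (φ : Module.End K V) (j : ℕ) : ℕ :=
  ∑ d ∈ Finset.range (Module.finrank K V + 1),
    if d % 8 = j % 8 then edMult φ (X - 1) d + edMult φ (X + 1) d else 0

/-- The Fitting one space `Bahn^∞(ψ) = ⋂ⱼ im (ψ - 1)^j`. -/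
noncomputable def bahnInf (ψ : Module.End K V) : Submodule K V :=
  ⨅ j : ℕ, LinearMap.range ((ψ - 1) ^ j)

/-- The `K[x]`-submodule generated by `v` (`x` acting as `ψ`). -/
def cycSub (ψ : Module.End K V) (v : V) : Submodule K V :=
  Submodule.span K (Set.range fun n : ℕ => (ψ ^ n) v)

/-- `V` is a cyclic `K[x]`-module, `x` acting as `ψ`. -/
def IsCyclicEnd (ψ : Module.End K V) : Prop :=
  ∃ v : V, cycSub ψ v = ⊤

/-- `V` is a direct sum of two cyclic `K[x]`-submodules, `x` acting as `ψ`. -/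
def IsBicyclicEnd (ψ : Module.End K V) : Prop :=
  ∃ v w : V, cycSub ψ v ⊓ cycSub ψ w = ⊥ ∧ cycSub ψ v ⊔ cycSub ψ w = ⊤

/-- `V` is an indecomposable `K[x]`-module, `x` acting as `ψ`. -/
def ModIndec (ψ : Module.End K V) : Prop :=
  (⊥ : Submodule K V) ≠ ⊤ ∧
    ¬∃ A B : Submodule K V, Invt ψ A ∧ Invt ψ B ∧ A ≠ ⊥ ∧ B ≠ ⊥ ∧ A ⊓ B = ⊥ ∧ A ⊔ B = ⊤

/-- `ψ` is orthogonally indecomposable w.r.t. `f`: `V ≠ 0` and the only nondegenerate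
invariant subspaces are `0` and `V`. -/
def OrthIndec (f : LinearMap.BilinForm K V) (ψ : Module.End K V) : Prop :=
  (⊥ : Submodule K V) ≠ ⊤ ∧
    ∀ U : Submodule K V, Invt ψ U → (f.restrict U).Nondegenerate → U = ⊥ ∨ U = ⊤

/-- The Witt index: the dimension of a maximal totally isotropic subspace. -/
noncomputable def wittIndex (f : LinearMap.BilinForm K V) : ℕ :=
  sSup {n | ∃ W : Submodule K V, (∀ x ∈ W, ∀ y ∈ W, f x y = 0) ∧ Module.finrank K W = n}


section A1

theorem sign_invol {α : Type*} [Fintype α] [DecidableEq α] (g : Equiv.Perm α) (hg : g ^ 2 = 1) :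
    Equiv.Perm.sign g = (-1) ^ (g.support.card / 2) := by
  have : Fact (Nat.Prime 2) := ⟨Nat.prime_two⟩
  have h := (Equiv.Perm.pow_prime_eq_one_iff (p := 2)).1 hg
  have hr := Multiset.eq_replicate_card.2 h
  have hs := g.sum_cycleType
  rw [Equiv.Perm.sign_of_cycleType, ← hs]
  set k := Multiset.card g.cycleType with hk
  rw [hr]
  simp only [Multiset.sum_replicate, smul_eq_mul]
  rw [show k * 2 / 2 = k by omega, pow_add, pow_mul']
  simp

theorem sign_rev (n : ℕ) : Equiv.Perm.sign (Fin.revPerm : Equiv.Perm (Fin n)) = (-1) ^ (n / 2) := by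
  rw [sign_invol]
  · have : (Fin.revPerm : Equiv.Perm (Fin n)).support.card = 2 * (n / 2) := by
      have hc : ((Fin.revPerm : Equiv.Perm (Fin n)).support)ᶜ.card = n % 2 := by
        rcases Nat.even_or_odd' n with ⟨k, rfl | rfl⟩
        · rw [Finset.card_eq_zero.2]
          · omega
          · ext i
            simp [Fin.ext_iff, Fin.rev]
            omega
        · rw [show (2 * k + 1) % 2 = 1 by omega, Finset.card_eq_one]
          refine ⟨⟨k, by omega⟩, ?_⟩
          ext i
          simp [Fin.ext_iff, Fin.rev]
          omega
      rw [Finset.card_compl, Fintype.card_fin] at hc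
      have := Finset.card_le_univ (Fin.revPerm : Equiv.Perm (Fin n)).support
      rw [Fintype.card_fin] at this
      omega
    rw [this]; congr 1; omega
  · ext i; simp [pow_two]

variable {K V : Type*} [Field K] [AddCommGroup V] [Module K V]

section Q
variable [Fintype K]

/-- quadratic character -/
noncomputable def qc (a : K) : ℤ := letI := Classical.decEq K; quadraticChar K a

theorem qc_mul (a b : K) : qc (a * b) = qc a * qc b := by
  unfold qc; exact map_mul _ a b
theorem qc_one : qc (1 : K) = 1 := by simp [qc]
theorem qc_pow (a : K) (n : ℕ) : qc (a ^ n) = qc a ^ n := by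
  unfold qc; exact map_pow _ a n
theorem qc_zero : qc (0 : K) = 0 := by simp [qc]
theorem qc_sq {a : K} (h : a ≠ 0) : qc a * qc a = 1 := by
  have := @quadraticChar_sq_one K _ _ (Classical.decEq K) a h
  rw [pow_two] at this
  exact this
theorem qc_or {a : K} (h : a ≠ 0) : qc a = 1 ∨ qc a = -1 := by
  exact mul_self_eq_one_iff.1 (qc_sq h)
theorem qc_eq_one {a : K} (h : a ≠ 0) : qc a = 1 ↔ IsSquare a := by
  classical
  rw [← quadraticChar_one_iff_isSquare (F := K) h]
  unfold qc
  convert Iff.rfl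
theorem qc_eq_neg {a : K} : qc a = -1 ↔ ¬ IsSquare a := by
  classical
  rw [← quadraticChar_neg_one_iff_not_isSquare (F := K)]
  unfold qc
  convert Iff.rfl
theorem qc_mul_sq (a : K) {b : K} (h : b ≠ 0) : qc (b * b * a) = qc a := by
  rw [qc_mul, qc_mul, qc_sq h, one_mul]
theorem qc_ne {a : K} (h : a ≠ 0) : qc a ≠ 0 := by
  rcases qc_or h with h | h <;> rw [h] <;> norm_num
variable [hK : Fact (Fintype.card K % 4 = 3)]
include hK in
theorem qc_neg_one : qc (-1 : K) = -1 := by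
  rw [qc_eq_neg, FiniteField.isSquare_neg_one_iff]
  simp [hK.out]
include hK in
theorem qc_neg (a : K) : qc (-a) = - qc a := by
  rw [show -a = (-1) * a by ring, qc_mul, qc_neg_one]; ring
include hK in
theorem two_ne : (2 : K) ≠ 0 := by
  have : ringChar K ≠ 2 := by
    intro h
    have := FiniteField.even_card_of_char_two (F := K) h
    have := hK.out
    omega
  exact Ring.two_ne_zero this
include hK in
theorem four_ne : (4 : K) ≠ 0 := by
  rw [show (4 : K) = 2 * 2 by norm_num]; exact mul_ne_zero (two_ne) (two_ne)
end Q

variable (f : LinearMap.BilinForm K V)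

def ND (X : Submodule K V) : Prop := ∀ x ∈ X, (∀ y ∈ X, f x y = 0) → x = 0

def gram {ι : Type*} (w : ι → V) : Matrix ι ι K := Matrix.of fun i j => f (w i) (w j)

theorem gram_vecMul {ι : Type*} [Fintype ι] (w : ι → V) (g : ι → K) (j : ι) :
    Matrix.vecMul g (gram f w) j = f (∑ i, g i • w i) (w j) := by
  simp [Matrix.vecMul, dotProduct, gram]

theorem li_of_gram {ι : Type*} [Fintype ι] [DecidableEq ι] (w : ι → V) (h : (gram f w).det ≠ 0) :
    LinearIndependent K w := by
  rw [Fintype.linearIndependent_iff]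
  intro g hg
  have : g = 0 := by
    apply Matrix.eq_zero_of_vecMul_eq_zero h
    ext j
    rw [gram_vecMul, hg]; simp
  intro i; rw [this]; rfl

theorem nd_of_gram {ι : Type*} [Fintype ι] [DecidableEq ι] (w : ι → V) (h : (gram f w).det ≠ 0) :
    ND f (Submodule.span K (Set.range w)) := by
  intro x hx hxy
  rw [Submodule.mem_span_range_iff_exists_fun] at hx
  obtain ⟨g, rfl⟩ := hx
  have : g = 0 := by
    apply Matrix.eq_zero_of_vecMul_eq_zero h
    ext j
    rw [gram_vecMul, hxy _ (Submodule.subset_span ⟨j, rfl⟩)]; simp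
  simp [this]

theorem gram_ne_of_nd {ι : Type*} [Fintype ι] [DecidableEq ι] (w : ι → V)
    (hl : LinearIndependent K w)
    (h : ND f (Submodule.span K (Set.range w))) : (gram f w).det ≠ 0 := by
  intro h0
  obtain ⟨g, hg, hg0⟩ := Matrix.exists_vecMul_eq_zero_iff.2 h0
  apply hg
  have := h (∑ i, g i • w i) ((Submodule.mem_span_range_iff_exists_fun K).2 ⟨g, rfl⟩) (by
    intro y hy
    induction hy using Submodule.span_induction with
    | mem y hy =>
      obtain ⟨j, rfl⟩ := hy
      rw [← gram_vecMul, hg0]; rfl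
    | zero => simp
    | add a b _ _ ha hb => rw [map_add, ha, hb, add_zero]
    | smul c a _ ha => rw [map_smul, ha, smul_zero])
  exact funext (Fintype.linearIndependent_iff.1 hl g this)

variable [Fintype K] [FiniteDimensional K V]

/-- quadratic character of discriminant -/
noncomputable def dq (X : Submodule K V) : ℤ :=
  qc (gram f (fun i => ((Module.finBasis K X i : X) : V))).det

theorem dq_basis {X : Submodule K V} {ι : Type*} [Fintype ι] [DecidableEq ι] (b : Basis ι K X) :
    dq f X = qc (gram f (fun i => ((b i : X) : V))).det := by
  have e : Fin (finrank K X) ≃ ι := (Module.finBasis K X).indexEquiv b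
  set c := Module.finBasis K X with hc
  set c' := c.reindex e
  have h2 : (gram f (fun i => ((c' i : X) : V))).det = (gram f (fun i => ((c i : X) : V))).det := by
    rw [← Matrix.det_submatrix_equiv_self e]
    congr 1; ext i j; simp [gram, c']
  have h3 := LinearMap.BilinForm.toMatrix_mul_basis_toMatrix c' b (f.restrict X)
  unfold dq
  rw [← h2]
  have h4 : gram f (fun i => ((b i : X) : V)) = LinearMap.BilinForm.toMatrix b (f.restrict X) := by
    ext i j; simp only [gram, LinearMap.BilinForm.toMatrix_apply]; rfl
  have h5 : gram f (fun i => ((c' i : X) : V)) = LinearMap.BilinForm.toMatrix c' (f.restrict X) := by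
    ext i j; simp only [gram, LinearMap.BilinForm.toMatrix_apply]; rfl
  rw [h4, ← h3, h5, Matrix.det_mul, Matrix.det_mul, Matrix.det_transpose]
  have h6 : (c'.toMatrix b).det ≠ 0 := by
    intro h
    have := congrArg Matrix.det (c'.toMatrix_mul_toMatrix_flip b)
    rw [Matrix.det_mul, h] at this
    simp at this
  rw [show ∀ a b : K, a * b * a = a * a * b by intros; ring, qc_mul_sq _ h6]

theorem dq_family {X : Submodule K V} {ι : Type*} [Fintype ι] [DecidableEq ι] (w : ι → V)
    (hl : LinearIndependent K w) (hX : Submodule.span K (Set.range w) = X) :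
    dq f X = qc (gram f w).det := by
  subst hX
  rw [dq_basis f (Basis.span hl)]
  congr 3
  ext i
  rw [Basis.span_apply]

theorem dq_bot : dq f ⊥ = 1 := by
  rw [dq_family f (X := ⊥) (fun i : Fin 0 => (0 : V)) linearIndependent_empty_type (by simp)]
  simp [qc_one]

theorem exists_family_card (X : Submodule K V) (n : ℕ) (h : finrank K X = n) :
    ∃ w : Fin n → V, LinearIndependent K w ∧ Submodule.span K (Set.range w) = X := by
  subst h
  refine ⟨fun i => (Module.finBasis K X i : V), ?_, ?_⟩
  · exact (Module.finBasis K X).linearIndependent.map' X.subtype (by simp)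
  · have := congrArg (Submodule.map X.subtype) (Module.finBasis K X).span_eq
    rw [Submodule.map_span, ← Set.range_comp, Submodule.map_top, Submodule.range_subtype] at this
    exact this

theorem exists_family (X : Submodule K V) : ∃ w : Fin (finrank K X) → V, LinearIndependent K w ∧
    Submodule.span K (Set.range w) = X := exists_family_card X _ rfl

theorem dq_nd {X : Submodule K V} (h : ND f X) : dq f X = 1 ∨ dq f X = -1 := by
  obtain ⟨w, hl, hw⟩ := exists_family X
  rw [dq_family f w hl hw]
  exact qc_or (gram_ne_of_nd f w hl (by rw [hw]; exact h))

theorem dq_nd_sq {X : Submodule K V} (h : ND f X) : dq f X * dq f X = 1 := by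
  rcases dq_nd f h with h | h <;> rw [h] <;> norm_num

theorem dq_sup {A B : Submodule K V} (hd : Disjoint A B) (ho : ∀ x ∈ A, ∀ y ∈ B, f x y = 0) 
    (ho' : ∀ x ∈ A, ∀ y ∈ B, f y x = 0) :
    dq f (A ⊔ B) = dq f A * dq f B := by
  obtain ⟨w, hl, hw⟩ := exists_family A
  obtain ⟨w', hl', hw'⟩ := exists_family B
  have hl2 := hl.sum_type hl' (by rw [hw, hw']; exact hd)
  rw [dq_family f w hl hw, dq_family f w' hl' hw', dq_family f _ hl2 (by
    rw [Set.Sum.elim_range, Submodule.span_union, hw, hw'])]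
  rw [← qc_mul, ← Matrix.det_fromBlocks_zero₂₁ _ 0]
  have m : ∀ i, w i ∈ A := fun i => hw ▸ Submodule.subset_span ⟨i, rfl⟩
  have m' : ∀ i, w' i ∈ B := fun i => hw' ▸ Submodule.subset_span ⟨i, rfl⟩
  congr 2
  ext i j
  rcases i with i | i <;> rcases j with j | j <;> simp [gram]
  · exact ho _ (m i) _ (m' j)
  · exact ho' _ (m j) _ (m' i)

theorem det_swap_blocks (m : ℕ) :
    (Matrix.fromBlocks (0 : Matrix (Fin m) (Fin m) K) (1 : Matrix (Fin m) (Fin m) K)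
      (1 : Matrix (Fin m) (Fin m) K) 0).det = (-1) ^ m := by
  have : (Matrix.fromBlocks (0 : Matrix (Fin m) (Fin m) K) (1 : Matrix (Fin m) (Fin m) K)
      (1 : Matrix (Fin m) (Fin m) K) 0) =
    Matrix.fromBlocks (1 : Matrix (Fin m) (Fin m) K) (1 : Matrix (Fin m) (Fin m) K) 0 1 * (Matrix.fromBlocks (-1) 0 1 1 * Matrix.fromBlocks 1 (-1) 0 1) := by
    simp [Matrix.fromBlocks_multiply]
  rw [this, Matrix.det_mul, Matrix.det_mul, Matrix.det_fromBlocks_zero₂₁,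
    Matrix.det_fromBlocks_zero₂₁, Matrix.det_fromBlocks_zero₁₂]
  simp [Matrix.det_neg]

variable [hK : Fact (Fintype.card K % 4 = 3)]
include hK

theorem dq_half (hs : ∀ x y, f x y = f y x) {X W : Submodule K V} (hX : ND f X) (hW : W ≤ X)
    (hi : ∀ x ∈ W, ∀ y ∈ W, f x y = 0) (hd : finrank K X = 2 * finrank K W) :
    dq f X = (-1) ^ finrank K W := by
  obtain ⟨C', hC'⟩ := exists_isCompl W
  set C := C' ⊓ X with hC
  have hdis : Disjoint W C := hC'.disjoint.mono_right inf_le_left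
  have hsup : W ⊔ C = X := by
    rw [hC, ← sup_inf_assoc_of_le _ hW, hC'.sup_eq_top, top_inf_eq]
  have hdim := Submodule.finrank_sup_add_finrank_inf_eq W C
  rw [hsup, hdis.eq_bot, finrank_bot] at hdim
  have hCd : finrank K C = finrank K W := by omega
  obtain ⟨w, hl, hw⟩ := exists_family W
  obtain ⟨w', hl', hw'⟩ := exists_family_card C _ hCd
  have hl2 := hl.sum_type hl' (by rw [hw, hw']; exact hdis)
  have hsp : Submodule.span K (Set.range (Sum.elim w w')) = X := by
    rw [Set.Sum.elim_range, Submodule.span_union, hw, hw', hsup]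
  have hne := gram_ne_of_nd f _ hl2 (by rw [hsp]; exact hX)
  rw [dq_family f _ hl2 hsp]
  have m : ∀ i, w i ∈ W := fun i => hw ▸ Submodule.subset_span ⟨i, rfl⟩
  set M : Matrix (Fin (finrank K W)) (Fin (finrank K W)) K := Matrix.of fun i j => f (w i) (w' j)
  have hG : gram f (Sum.elim w w') = Matrix.fromBlocks 0 M M.transpose (gram f w') := by
    ext i j
    rcases i with i | i <;> rcases j with j | j <;> simp [gram, M]
    · exact hi _ (m i) _ (m j)
    · exact hs _ _
  have hGJ : gram f (Sum.elim w w') * Matrix.fromBlocks 0 1 1 0 =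
      Matrix.fromBlocks M 0 (gram f w') M.transpose := by
    rw [hG, Matrix.fromBlocks_multiply]; simp
  have hdet := congrArg Matrix.det hGJ
  rw [Matrix.det_mul, det_swap_blocks, Matrix.det_fromBlocks_zero₁₂, Matrix.det_transpose] at hdet
  have hM : M.det ≠ 0 := by
    intro h0
    rw [h0, mul_zero] at hdet
    exact mul_ne_zero hne (pow_ne_zero _ (by simp)) hdet
  have h2 := congrArg qc hdet
  rw [qc_mul, qc_pow, qc_neg_one, qc_mul, qc_sq hM] at h2
  have h3 : ((-1 : ℤ) ^ finrank K W) * (-1) ^ finrank K W = 1 := by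
    rw [← mul_pow]; simp
  calc _ = qc (gram f (Sum.elim w w')).det * ((-1 : ℤ) ^ finrank K W * (-1) ^ finrank K W) := by
        rw [h3, mul_one]
    _ = _ := by rw [← mul_assoc, h2, one_mul]

omit hK [Fintype K] [FiniteDimensional K V] in
theorem at_det (n : ℕ) (w : Fin n → V) (c : K)
    (h0 : ∀ i j : Fin n, n ≤ (i : ℕ) + j → f (w i) (w j) = 0)
    (h1 : ∀ i j : Fin n, (i : ℕ) + j + 1 = n → f (w i) (w j) = c) :
    (gram f w).det = (-1) ^ (n / 2) * c ^ n := by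
  have e1 : ((gram f w).submatrix id Fin.revPerm).det = c ^ n := by
    rw [Matrix.det_of_isUpperTriangular]
    · rw [Finset.prod_congr rfl (g := fun _ => c)]
      · simp
      · intro i _
        simp only [gram, Matrix.submatrix_apply, id, Matrix.of_apply]
        apply h1
        have := i.2
        simp [Fin.revPerm_apply, Fin.val_rev]; omega
    · intro i j hij
      simp only [gram, Matrix.submatrix_apply, id, Matrix.of_apply]
      apply h0
      have := i.2
      have := j.2
      have : (j : ℕ) < i := hij
      simp [Fin.revPerm_apply, Fin.val_rev]; omega
  rw [Matrix.det_permute', sign_rev] at e1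
  have h3 : ((-1 : K) ^ (n / 2)) * (-1) ^ (n / 2) = 1 := by
    rw [← mul_pow]; simp
  rw [← e1]
  push_cast
  rw [← mul_assoc, h3, one_mul]

theorem at_lemma {n : ℕ} {w : Fin n → V} {c : K} (hc : c ≠ 0)
    (h0 : ∀ i j : Fin n, n ≤ (i : ℕ) + j → f (w i) (w j) = 0)
    (h1 : ∀ i j : Fin n, (i : ℕ) + j + 1 = n → f (w i) (w j) = c) :
    LinearIndependent K w ∧ ND f (Submodule.span K (Set.range w)) ∧
    finrank K (Submodule.span K (Set.range w)) = n ∧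
    dq f (Submodule.span K (Set.range w)) = (-1) ^ (n / 2) * qc c ^ n := by
  have hd := at_det f n w c h0 h1
  have hne : (gram f w).det ≠ 0 := by
    rw [hd]; exact mul_ne_zero (pow_ne_zero _ (by simp)) (pow_ne_zero _ hc)
  have hl := li_of_gram f w hne
  refine ⟨hl, nd_of_gram f w hne, ?_, ?_⟩
  · rw [finrank_span_eq_card hl, Fintype.card_fin]
  · rw [dq_family f w hl rfl, hd, qc_mul, qc_pow, qc_pow, qc_neg_one]

theorem hasDisc_iff (U : Submodule K V) : HasDisc (f.restrict U) (-1) ↔ dq f U = -1 := by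
  constructor
  · rintro ⟨b, c, h⟩
    rw [dq_basis f b]
    have : gram f (fun i => ((b i : U) : V)) = Matrix.of fun i j => (f.restrict U) (b i) (b j) := by
      ext i j; rfl
    rw [this, h, qc_mul, qc_neg_one, pow_two, qc_mul, qc_sq c.ne_zero, mul_one]
  · intro h
    unfold dq at h
    refine ⟨Module.finBasis K U, ?_⟩
    have : gram f (fun i => ((Module.finBasis K U i : U) : V)) =
        Matrix.of fun i j => (f.restrict U) (Module.finBasis K U i) (Module.finBasis K U j) := by
      ext i j; rfl
    rw [← this]
    set D := (gram f (fun i => ((Module.finBasis K U i : U) : V))).det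
    have hD : D ≠ 0 := by
      intro h0; rw [h0, qc_zero] at h; norm_num at h
    have : qc (-D) = 1 := by rw [qc_neg, h]; norm_num
    rw [qc_eq_one (neg_ne_zero.2 hD)] at this
    obtain ⟨c, hc⟩ := this
    refine ⟨Units.mk0 c ?_, ?_⟩
    · rintro rfl; apply hD; simpa using hc
    · simp only [Units.val_mk0]; rw [pow_two, ← hc]; ring

omit hK [Fintype K] [FiniteDimensional K V] in
theorem nd_iff (hs : ∀ x y, f x y = f y x) (U : Submodule K V) :
    (f.restrict U).Nondegenerate ↔ ND f U := by
  constructor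
  · rintro ⟨h, -⟩ x hx hy
    have := h ⟨x, hx⟩ (fun y => hy y.1 y.2)
    simpa using this
  · intro h
    refine ⟨?_, ?_⟩
    · intro x hx
      exact Subtype.ext (h x.1 x.2 (fun y hy => hx ⟨y, hy⟩))
    · intro x hx
      exact Subtype.ext (h x.1 x.2 (fun y hy => by rw [hs]; exact hx ⟨y, hy⟩))
end A1

section A2

theorem sum_quad {L : Type*} [Field L] [Fintype L] (hL : Fintype.card L % 2 = 1) {α β : L}
    (ha : α ≠ 0) (hb : β ≠ 0) (γ : L) : ∃ a b : L, α * a ^ 2 + β * b ^ 2 = γ := by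
  obtain ⟨a, b, hab⟩ := FiniteField.exists_root_sum_quadratic (R := L)
      (f := C α * X ^ 2) (g := C β * X ^ 2 - C γ) (by
        rw [degree_C_mul_X_pow 2 ha]; rfl) (by
        have : (C β * X ^ 2 - C γ) = C β * X ^ 2 + C 0 * X + C (-γ) := by simp; ring
        rw [this]
        exact degree_quadratic hb) hL
  refine ⟨a, b, ?_⟩
  simp at hab
  linear_combination hab

variable {K V : Type*} [Field K] [AddCommGroup V] [Module K V]
variable (f : LinearMap.BilinForm K V)

def perp (U : Submodule K V) : Submodule K V where
  carrier := {x | ∀ u ∈ U, f u x = 0}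
  add_mem' := by
    intro a b ha hb u hu
    rw [map_add, ha u hu, hb u hu, add_zero]
  zero_mem' := by intro u _; simp
  smul_mem' := by
    intro c a ha u hu
    rw [map_smul, ha u hu, smul_zero]

theorem mem_perp {U : Submodule K V} {x : V} : x ∈ perp f U ↔ ∀ u ∈ U, f u x = 0 := Iff.rfl

theorem perp_anti {U W : Submodule K V} (h : U ≤ W) : perp f W ≤ perp f U :=
  fun _ hx u hu => hx u (h hu)

variable [FiniteDimensional K V]

theorem nd_proj (hs : ∀ x y, f x y = f y x) {U : Submodule K V} (h : ND f U) (x : V) :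
    ∃ u ∈ U, x - u ∈ perp f U := by
  have hn := (nd_iff f hs U).2 h
  have hr : f.IsRefl := fun a b hab => by rw [hs]; exact hab
  have := LinearMap.BilinForm.isCompl_orthogonal_of_restrict_nondegenerate hr hn
  have hx : x ∈ U ⊔ f.orthogonal U := by rw [this.sup_eq_top]; trivial
  obtain ⟨u, hu, w, hw, rfl⟩ := Submodule.mem_sup.1 hx
  exact ⟨u, hu, by rw [add_sub_cancel_left]; exact hw⟩

omit [FiniteDimensional K V] in
theorem nd_disj {U : Submodule K V} (hs : ∀ x y, f x y = f y x) (h : ND f U) : Disjoint U (perp f U) := by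
  rw [Submodule.disjoint_def]
  intro x hx hp
  exact h x hx (fun y hy => by rw [hs]; exact hp y hy)

theorem nd_sup_perp (hs : ∀ x y, f x y = f y x) {U X : Submodule K V} (h : ND f U) (hU : U ≤ X) :
    U ⊔ (X ⊓ perp f U) = X := by
  apply le_antisymm (sup_le hU inf_le_left)
  intro x hx
  obtain ⟨u, hu, hp⟩ := nd_proj f hs h x
  rw [Submodule.mem_sup]
  exact ⟨u, hu, x - u, ⟨X.sub_mem hx (hU hu), hp⟩, by abel⟩

theorem nd_compl (hs : ∀ x y, f x y = f y x) {U X : Submodule K V} (h : ND f U) (hX : ND f X)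
    (hU : U ≤ X) : ND f (X ⊓ perp f U) := by
  intro x hx hy
  apply hX x hx.1
  intro y hyX
  obtain ⟨u, hu, hp⟩ := nd_proj f hs h y
  have h1 := hy (y - u) ⟨X.sub_mem hyX (hU hu), hp⟩
  have h2 : f x u = 0 := by rw [hs]; exact hx.2 u hu
  rw [map_sub, h2, sub_zero] at h1
  exact h1

omit [FiniteDimensional K V] in
theorem nd_sup (hs : ∀ x y, f x y = f y x) {A B : Submodule K V} (hA : ND f A) (hB : ND f B)
    (ho : ∀ x ∈ A, ∀ y ∈ B, f x y = 0) : ND f (A ⊔ B) := by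
  intro x hx hy
  obtain ⟨a, ha, b, hb, rfl⟩ := Submodule.mem_sup.1 hx
  have h1 : a = 0 := hA a ha (fun y hya => by
    have := hy y (Submodule.mem_sup_left hya)
    rw [map_add, LinearMap.add_apply, hs b y, ho y hya b hb, add_zero] at this
    exact this)
  have h2 : b = 0 := hB b hb (fun y hyb => by
    have := hy y (Submodule.mem_sup_right hyb)
    rw [map_add, LinearMap.add_apply, ho a ha y hyb, zero_add] at this
    exact this)
  rw [h1, h2, add_zero]

theorem finrank_sup_disj {A B : Submodule K V} (hd : Disjoint A B) :
    finrank K (A ⊔ B : Submodule K V) = finrank K A + finrank K B := by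
  have := Submodule.finrank_sup_add_finrank_inf_eq A B
  rw [hd.eq_bot, finrank_bot] at this
  simpa using this

theorem finrank_split (hs : ∀ x y, f x y = f y x) {U X : Submodule K V} (h : ND f U) (hU : U ≤ X) :
    finrank K X = finrank K U + finrank K (X ⊓ perp f U : Submodule K V) := by
  conv_lhs => rw [← nd_sup_perp f hs h hU]
  exact finrank_sup_disj ((nd_disj f hs h).mono_right inf_le_right)

section
variable [Fintype K]
theorem dq_split (hs : ∀ x y, f x y = f y x) {U X : Submodule K V} (h : ND f U) (hU : U ≤ X) :
    dq f X = dq f U * dq f (X ⊓ perp f U) := by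
  conv_lhs => rw [← nd_sup_perp f hs h hU]
  exact dq_sup f ((nd_disj f hs h).mono_right inf_le_right) (fun x hx y hy => hy.2 x hx)
    (fun x hx y hy => by rw [hs]; exact hy.2 x hx)

theorem dq_line {v : V} (hv : f v v ≠ 0) : dq f (K ∙ v) = qc (f v v) := by
  have hd : (gram f (fun _ : Fin 1 => v)).det = f v v := by simp [gram]
  have h0 : (gram f (fun _ : Fin 1 => v)).det ≠ 0 := by rw [hd]; exact hv
  rw [dq_family f (fun _ : Fin 1 => v) (li_of_gram f _ h0) (by simp), hd]
end

omit [FiniteDimensional K V] in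
theorem nd_line {v : V} (hv : f v v ≠ 0) : ND f (K ∙ v) := by
  have hd : (gram f (fun _ : Fin 1 => v)).det = f v v := by simp [gram]
  have h0 : (gram f (fun _ : Fin 1 => v)).det ≠ 0 := by rw [hd]; exact hv
  have := nd_of_gram f _ h0
  simpa using this

theorem finrank_line {v : V} (hv : f v v ≠ 0) : finrank K (K ∙ v) = 1 := by
  apply finrank_span_singleton
  rintro rfl; simp at hv

omit [FiniteDimensional K V] in
theorem exists_aniso (h2 : (2 : K) ≠ 0) (hs : ∀ x y, f x y = f y x) {X : Submodule K V} (h : ND f X)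
    (hX : X ≠ ⊥) : ∃ v ∈ X, f v v ≠ 0 := by
  by_contra hc
  push Not at hc
  obtain ⟨x, hx, hx0⟩ := Submodule.exists_mem_ne_zero_of_ne_bot hX
  apply hx0
  apply h x hx
  intro y hy
  have h3 := hc (x + y) (X.add_mem hx hy)
  simp only [map_add, LinearMap.add_apply, hc x hx, hc y hy, hs y x, add_zero, zero_add] at h3
  have : 2 * f x y = 0 := by rw [two_mul]; exact h3
  exact (mul_eq_zero.1 this).resolve_left h2

section
variable [Fintype K] [hK : Fact (Fintype.card K % 4 = 3)]
include hK

theorem exists_one (hs : ∀ x y, f x y = f y x) {X : Submodule K V} (h : ND f X)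
    (hX : 1 ≤ finrank K X) (hd : dq f X = 1) : ∃ v ∈ X, f v v = 1 := by
  obtain ⟨v, hv, hv0⟩ := exists_aniso f (two_ne) hs h (by rintro rfl; simp at hX)
  have hle : (K ∙ v) ≤ X := by simpa using hv
  have hnd := nd_line f hv0
  have hsp := dq_split f hs hnd hle
  have hc := nd_compl f hs hnd h hle
  rw [dq_line f hv0] at hsp
  by_cases h0 : (X ⊓ perp f (K ∙ v)) = ⊥
  · rw [h0, dq_bot, hd, mul_one] at hsp
    obtain ⟨c, hc⟩ := (qc_eq_one hv0).1 hsp.symm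
    have hc0 : c ≠ 0 := by rintro rfl; apply hv0; simpa using hc
    refine ⟨c⁻¹ • v, X.smul_mem _ hv, ?_⟩
    simp [hc]; field_simp
  · obtain ⟨u, hu, hu0⟩ := exists_aniso f (two_ne) hs hc h0
    have huv : f v u = 0 := hu.2 v (Submodule.mem_span_singleton_self v)
    obtain ⟨a, b, hab⟩ := sum_quad (L := K) (by have := hK.out; omega) hv0 hu0 1
    refine ⟨a • v + b • u, X.add_mem (X.smul_mem _ hv) (X.smul_mem _ hu.1), ?_⟩
    simp [huv, hs u v]
    linear_combination hab
end

end A2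

section A3
variable {K V : Type*} [Field K] [AddCommGroup V] [Module K V]
variable (f : LinearMap.BilinForm K V)

/-- minus-one eigenspace -/
def Bm (σ : V →ₗ[K] V) : Submodule K V where
  carrier := {x | σ x = -x}
  add_mem' := by
    intro a b ha hb
    simp only [Set.mem_ofPred_eq] at *
    rw [map_add, ha, hb]; abel
  zero_mem' := by simp
  smul_mem' := by
    intro c a ha
    simp only [Set.mem_ofPred_eq] at *
    rw [map_smul, ha]; simp

/-- plus-one eigenspace -/
def Fm (σ : V →ₗ[K] V) : Submodule K V where
  carrier := {x | σ x = x}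
  add_mem' := by
    intro a b ha hb
    simp only [Set.mem_ofPred_eq] at *
    rw [map_add, ha, hb]
  zero_mem' := by simp
  smul_mem' := by
    intro c a ha
    simp only [Set.mem_ofPred_eq] at *
    rw [map_smul, ha]

theorem mem_Bm {σ : V →ₗ[K] V} {x : V} : x ∈ Bm σ ↔ σ x = -x := Iff.rfl
theorem mem_Fm {σ : V →ₗ[K] V} {x : V} : x ∈ Fm σ ↔ σ x = x := Iff.rfl

/-- isometric involution -/
def IsInv (σ : V →ₗ[K] V) : Prop := (∀ x y, f (σ x) (σ y) = f x y) ∧ ∀ x, σ (σ x) = x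

variable {f}
theorem IsInv.FB {σ : V →ₗ[K] V} (h : IsInv f σ) (h2 : (2 : K) ≠ 0) {x y : V} (hx : x ∈ Fm σ) (hy : y ∈ Bm σ) :
    f x y = 0 := by
  have := h.1 x y
  rw [mem_Fm.1 hx, mem_Bm.1 hy, map_neg] at this
  have h3 : 2 * f x y = 0 := by linear_combination -this
  exact (mul_eq_zero.1 h3).resolve_left h2

theorem IsInv.decomp {σ : V →ₗ[K] V} (h : IsInv f σ) (h2 : (2 : K) ≠ 0) {U : Submodule K V}
    (hU : Invt σ U) {x : V} (hx : x ∈ U) :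
    ∃ a ∈ U ⊓ Fm σ, ∃ b ∈ U ⊓ Bm σ, a + b = x := by
  refine ⟨(2 : K)⁻¹ • (x + σ x), ⟨U.smul_mem _ (U.add_mem hx (hU x hx)), ?_⟩,
    (2 : K)⁻¹ • (x - σ x), ⟨U.smul_mem _ (U.sub_mem hx (hU x hx)), ?_⟩, ?_⟩
  · change _ ∈ Fm σ
    rw [mem_Fm, map_smul, map_add, h.2, add_comm]
  · change _ ∈ Bm σ
    rw [mem_Bm, map_smul, map_sub, h.2, ← smul_neg]; congr 1; abel
  · rw [← smul_add, show x + σ x + (x - σ x) = (2 : K) • x by rw [two_smul]; abel, smul_smul,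
      inv_mul_cancel₀ h2, one_smul]

theorem IsInv.nd_B {σ : V →ₗ[K] V} (h : IsInv f σ) (h2 : (2 : K) ≠ 0) {U : Submodule K V}
    (hU : Invt σ U) (hN : ND f U) (hs : ∀ x y, f x y = f y x) : ND f (U ⊓ Bm σ) := by
  intro x hx hy
  apply hN x hx.1
  intro y hyU
  obtain ⟨a, ha, b, hb, rfl⟩ := h.decomp h2 hU hyU
  rw [map_add, hy b hb, hs x a, h.FB h2 ha.2 hx.2, add_zero]

theorem IsInv.nd_F {σ : V →ₗ[K] V} (h : IsInv f σ) (h2 : (2 : K) ≠ 0) {U : Submodule K V}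
    (hU : Invt σ U) (hN : ND f U) : ND f (U ⊓ Fm σ) := by
  intro x hx hy
  apply hN x hx.1
  intro y hyU
  obtain ⟨a, ha, b, hb, rfl⟩ := h.decomp h2 hU hyU
  rw [map_add, hy a ha, h.FB h2 hx.2 hb.2, add_zero]

theorem FB_disj (h2 : (2 : K) ≠ 0) (σ : V →ₗ[K] V) : Disjoint (Fm σ) (Bm σ) := by
  rw [Submodule.disjoint_def]
  intro x hx hy
  rw [mem_Fm] at hx
  rw [mem_Bm, hx] at hy
  have : (2 : K) • x = 0 := by rw [two_smul]; nth_rewrite 2 [hy]; abel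
  exact (smul_eq_zero.1 this).resolve_left h2

theorem IsInv.sup_FB {σ : V →ₗ[K] V} (h : IsInv f σ) (h2 : (2 : K) ≠ 0) {U : Submodule K V}
    (hU : Invt σ U) : (U ⊓ Fm σ) ⊔ (U ⊓ Bm σ) = U := by
  apply le_antisymm (sup_le inf_le_left inf_le_left)
  intro x hx
  obtain ⟨a, ha, b, hb, rfl⟩ := h.decomp h2 hU hx
  exact Submodule.add_mem_sup ha hb

variable [FiniteDimensional K V]

theorem IsInv.finrank_FB {σ : V →ₗ[K] V} (h : IsInv f σ) (h2 : (2 : K) ≠ 0) {U : Submodule K V}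
    (hU : Invt σ U) : finrank K U = finrank K (U ⊓ Fm σ : Submodule K V) +
      finrank K (U ⊓ Bm σ : Submodule K V) := by
  conv_lhs => rw [← h.sup_FB h2 hU]
  exact finrank_sup_disj ((FB_disj h2 σ).mono inf_le_right inf_le_right)

theorem IsInv.det_eq {σ : V →ₗ[K] V} (h : IsInv f σ) (h2 : (2 : K) ≠ 0) :
    LinearMap.det σ = (-1) ^ finrank K (Bm σ) := by
  have hB : Bm σ ≤ (Bm σ).comap σ := by
    intro x hx
    rw [Submodule.mem_comap, mem_Bm.1 hx]; exact (Bm σ).neg_mem hx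
  rw [LinearMap.det_eq_det_mul_det (Bm σ) σ hB]
  have e1 : LinearMap.restrict (p := Bm σ) (q := Bm σ) σ hB = (-1 : K) • LinearMap.id := by
    ext x
    have := mem_Bm.1 x.2
    simp [LinearMap.restrict_apply, this]
  have e2 : (Bm σ).mapQ (Bm σ) σ hB = LinearMap.id := by
    apply Submodule.linearMap_qext
    ext x
    simp only [LinearMap.comp_apply, Submodule.mkQ_apply, Submodule.mapQ_apply, LinearMap.id_apply]
    rw [Submodule.Quotient.eq, mem_Bm, map_sub, h.2]; abel
  rw [e1, e2, LinearMap.det_smul]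
  simp

variable (f) in
/-- reflection, as a linear map -/
noncomputable def rfnL (v : V) : V →ₗ[K] V := LinearMap.id - (2 / f v v) • (f.flip v).smulRight v

omit [FiniteDimensional K V] in
theorem rfnL_apply (v x : V) : rfnL f v x = x - (2 / f v v * f x v) • v := by
  simp only [rfnL, LinearMap.sub_apply, LinearMap.id_apply, LinearMap.smul_apply,
    LinearMap.smulRight_apply, smul_smul]
  rfl

omit [FiniteDimensional K V] in
theorem rfnL_inv (v x : V) : rfnL f v (rfnL f v x) = x := by
  simp only [rfnL_apply, map_sub, map_smul]
  by_cases h : f v v = 0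
  · simp [h]
  · rw [show 2 / f v v * f v v = 2 by field_simp, two_smul]
    module

variable (f) in
/-- reflection -/
noncomputable def rfn (v : V) : V ≃ₗ[K] V := LinearEquiv.ofInvolutive (rfnL f v) (rfnL_inv v)

omit [FiniteDimensional K V] in
theorem rfn_apply (v x : V) : rfn f v x = x - (2 / f v v * f x v) • v := rfnL_apply v x

omit [FiniteDimensional K V] in
theorem rfn_mem (hs : ∀ x y, f x y = f y x) (v : V) : rfn f v ∈ orthGroup f := by
  intro x y
  rw [rfn_apply, rfn_apply]
  simp only [map_sub, map_smul, LinearMap.sub_apply, LinearMap.smul_apply, smul_eq_mul]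
  rw [hs v y]
  by_cases h : f v v = 0
  · simp [h]
  · field_simp; ring

omit [FiniteDimensional K V] in
theorem rfn_sq (v : V) : rfn f v * rfn f v = 1 := by
  ext x
  exact rfnL_inv v x

omit [FiniteDimensional K V] in
theorem isInv_of_mem {σ : V ≃ₗ[K] V} (h : σ ∈ orthGroup f) (h2 : σ * σ = 1) : IsInv f (σ : V →ₗ[K] V) :=
  ⟨h, fun x => congrArg (fun g : V ≃ₗ[K] V => g x) h2⟩

omit [FiniteDimensional K V] in
theorem refl_step (h2 : (2 : K) ≠ 0) (hs : ∀ x y, f x y = f y x) {σ : V ≃ₗ[K] V} (h : σ ∈ orthGroup f) (hσ : σ * σ = 1)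
    {v : V} (hv : v ∈ Bm (σ : V →ₗ[K] V)) (hv0 : f v v ≠ 0) :
    rfn f v * σ ∈ orthGroup f ∧ (rfn f v * σ) * (rfn f v * σ) = 1 ∧
    Bm ((rfn f v * σ : V ≃ₗ[K] V) : V →ₗ[K] V) = Bm (σ : V →ₗ[K] V) ⊓ perp f (K ∙ v) := by
  have hv' : σ v = -v := hv
  have hfv : ∀ x, f (σ x) v = - f x v := by
    intro x
    have := h x v
    rw [hv', map_neg] at this
    linear_combination -this
  have hc : rfn f v * σ = σ * rfn f v := by
    ext x
    simp only [LinearEquiv.mul_apply, rfn_apply, map_sub, map_smul, hv', hfv]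
    simp
  refine ⟨mul_mem (rfn_mem hs v) h, ?_, ?_⟩
  · calc _ = rfn f v * (σ * rfn f v) * σ := by group
      _ = (rfn f v * rfn f v) * (σ * σ) := by rw [← hc]; group
      _ = 1 := by rw [rfn_sq, hσ, one_mul]
  · ext x
    have hp : x ∈ perp f (K ∙ v) ↔ f x v = 0 := by
      rw [mem_perp]
      constructor
      · intro h; rw [hs]; exact h v (Submodule.mem_span_singleton_self v)
      · intro h u hu
        obtain ⟨c, rfl⟩ := Submodule.mem_span_singleton.1 hu
        rw [map_smul, LinearMap.smul_apply, hs, h, smul_zero]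
    rw [Submodule.mem_inf, hp, mem_Bm, mem_Bm]
    simp only [LinearEquiv.coe_coe, LinearEquiv.mul_apply, rfn_apply]
    constructor
    · intro he
      have h3 : f x v = 0 := by
        have := congrArg (fun y => f y v) he
        simp only [map_sub, map_neg, LinearMap.sub_apply, LinearMap.neg_apply, map_smul,
          LinearMap.smul_apply, smul_eq_mul, hfv] at this
        field_simp at this
        have h4 : 2 * f x v = 0 := by linear_combination this
        exact (mul_eq_zero.1 h4).resolve_left h2
      refine ⟨?_, h3⟩
      rw [hfv, h3] at he
      simpa using he
    · rintro ⟨h3, h4⟩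
      rw [hfv, h4, h3]; simp

end A3

section A4
open scoped commutatorElement
variable {K V : Type*} [Field K] [AddCommGroup V] [Module K V]
variable {f : LinearMap.BilinForm K V}

theorem rfn_inv (v : V) : (rfn f v)⁻¹ = rfn f v := inv_eq_of_mul_eq_one_left (rfn_sq v)

theorem rfn_conj {g : V ≃ₗ[K] V} (hg : g ∈ orthGroup f) (v : V) :
    g * rfn f v * g⁻¹ = rfn f (g v) := by
  rw [mul_inv_eq_iff_eq_mul]
  ext x
  simp only [LinearEquiv.mul_apply, rfn_apply, map_sub, map_smul]
  rw [hg, hg]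

theorem rfn_pair_mem (h2 : (2 : K) ≠ 0) (hs : ∀ x y, f x y = f y x) {x y : V} (hx : f x x = 1)
    (hy : f y y = 1) (hxy : f x y = 0) : rfn f x * rfn f y ∈ omegaGroup f := by
  have hg : rfn f (x - y) x = y := by
    rw [rfn_apply]
    have : f (x - y) (x - y) = 2 := by
      simp only [map_sub, LinearMap.sub_apply, hx, hy, hxy, hs y x]; ring
    rw [this, map_sub, hx, hxy, div_self h2]; simp
  have h3 := rfn_conj (rfn_mem (f := f) hs (x - y)) x
  rw [hg] at h3
  rw [← h3]
  have : rfn f x * (rfn f (x - y) * rfn f x * (rfn f (x - y))⁻¹) = ⁅rfn f x, rfn f (x - y)⁆ := by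
    rw [commutatorElement_def, rfn_inv x]
    simp only [mul_assoc]
  rw [this]
  exact Subgroup.commutator_mem_commutator (rfn_mem hs _) (rfn_mem hs _)

variable [FiniteDimensional K V]

theorem nd_top_of (hnd : ∀ x, (∀ y, f x y = 0) → x = 0) : ND f ⊤ :=
  fun x _ h => hnd x (fun y => h y trivial)

omit [FiniteDimensional K V] in
theorem nd_Bm (h2 : (2 : K) ≠ 0) (hs : ∀ x y, f x y = f y x) (hnd : ND f ⊤) {σ : V →ₗ[K] V}
    (h : IsInv f σ) : ND f (Bm σ) := by
  have := h.nd_B h2 (U := ⊤) (fun x _ => trivial) hnd hs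
  simpa using this

variable [Fintype K] [hK : Fact (Fintype.card K % 4 = 3)]
include hK

theorem refl_step_num (hs : ∀ x y, f x y = f y x)
    {σ : V ≃ₗ[K] V} (h : σ ∈ orthGroup f) (hσ : σ * σ = 1)
    {v : V} (hv : v ∈ Bm (σ : V →ₗ[K] V)) (hv0 : f v v ≠ 0) :
    finrank K (Bm (σ : V →ₗ[K] V)) = 1 + finrank K (Bm ((rfn f v * σ : V ≃ₗ[K] V) : V →ₗ[K] V)) ∧
    dq f (Bm (σ : V →ₗ[K] V)) = qc (f v v) * dq f (Bm ((rfn f v * σ : V ≃ₗ[K] V) : V →ₗ[K] V)) := by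
  have hle : (K ∙ v) ≤ Bm (σ : V →ₗ[K] V) := by simpa using hv
  rw [(refl_step two_ne hs h hσ hv hv0).2.2]
  constructor
  · rw [finrank_split f hs (nd_line f hv0) hle, finrank_line f hv0]
  · rw [dq_split f hs (nd_line f hv0) hle, dq_line f hv0]

theorem omega_of (hs : ∀ x y, f x y = f y x) (hnd : ND f ⊤) : ∀ (n : ℕ) (σ : V ≃ₗ[K] V),
    σ ∈ orthGroup f → σ * σ = 1 → finrank K (Bm (σ : V →ₗ[K] V)) = 2 * n →
    dq f (Bm (σ : V →ₗ[K] V)) = 1 → σ ∈ omegaGroup f := by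
  intro n
  induction n with
  | zero =>
    intro σ h hσ hr _
    have hB : Bm (σ : V →ₗ[K] V) = ⊥ := Submodule.finrank_eq_zero.1 (by simpa using hr)
    have : σ = 1 := by
      ext x
      have hx : x - σ x ∈ Bm (σ : V →ₗ[K] V) := by
        rw [mem_Bm]
        have := (isInv_of_mem h hσ).2 x
        rw [map_sub]; erw [this]; simp
      rw [hB, Submodule.mem_bot, sub_eq_zero] at hx
      exact hx.symm
    rw [this]; exact one_mem _
  | succ n ih =>
    intro σ h hσ hr hd
    obtain ⟨x, hx, hx1⟩ := exists_one f hs (nd_Bm two_ne hs hnd (isInv_of_mem h hσ)) (by omega) hd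
    have hx0 : f x x ≠ 0 := by rw [hx1]; exact one_ne_zero
    obtain ⟨h1, h2, h3⟩ := refl_step two_ne hs h hσ hx hx0
    obtain ⟨h4, h5⟩ := refl_step_num hs h hσ hx hx0
    rw [hx1, qc_one, one_mul, hd] at h5
    obtain ⟨y, hy, hy1⟩ := exists_one f hs (nd_Bm two_ne hs hnd (isInv_of_mem h1 h2)) (by omega) h5.symm
    have hy0 : f y y ≠ 0 := by rw [hy1]; exact one_ne_zero
    obtain ⟨k1, k2, k3⟩ := refl_step two_ne hs h1 h2 hy hy0
    obtain ⟨k4, k5⟩ := refl_step_num hs h1 h2 hy hy0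
    rw [hy1, qc_one, one_mul, ← h5] at k5
    have := ih _ k1 k2 (by omega) k5.symm
    have hxy : f x y = 0 := by
      rw [h3] at hy
      exact hy.2 x (Submodule.mem_span_singleton_self x)
    have h6 := mul_mem (rfn_pair_mem two_ne hs hx1 hy1 hxy) this
    have h7 : rfn f x * rfn f y * (rfn f y * (rfn f x * σ)) = σ := by
      calc _ = rfn f x * (rfn f y * rfn f y) * rfn f x * σ := by group
        _ = σ := by rw [rfn_sq, mul_one, rfn_sq, one_mul]
    rwa [h7] at h6

omit [FiniteDimensional K V] [Fintype K] hK in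
theorem omega_le_so : omegaGroup f ≤ specialOrthGroup f := by
  unfold omegaGroup
  rw [Subgroup.commutator_le]
  intro a ha b hb
  refine ⟨?_, ?_⟩
  · have : ⁅a, b⁆ ∈ orthGroup f := by
      rw [commutatorElement_def]
      exact mul_mem (mul_mem (mul_mem ha hb) (inv_mem ha)) (inv_mem hb)
    exact this
  · rw [commutatorElement_def]
    have : ∀ g : V ≃ₗ[K] V, LinearMap.det (g : V →ₗ[K] V) * LinearMap.det ((g⁻¹ : V ≃ₗ[K] V) : V →ₗ[K] V) = 1 := by
      intro g
      rw [← map_mul, ← LinearEquiv.coe_toLinearMap_mul, mul_inv_cancel, LinearEquiv.coe_toLinearMap_one, LinearMap.det_id]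
    simp only [LinearEquiv.coe_toLinearMap_mul, map_mul]
    linear_combination (LinearMap.det (b : V →ₗ[K] V) * LinearMap.det ((b⁻¹ : V ≃ₗ[K] V) : V →ₗ[K] V)) * this a + this b

omit [FiniteDimensional K V] [Fintype K] hK in
variable (f) in
/-- permutation action on vectors of norm minus one -/
def permHom : orthGroup f →* Equiv.Perm {x : V // f x x = -1} where
  toFun g := Equiv.Perm.subtypePerm g.1.toEquiv (fun x => by
    have : f (g.1 x) (g.1 x) = f x x := g.2 x x
    change f (g.1 x) (g.1 x) = -1 ↔ _
    rw [this])
  map_one' := by ext x; rfl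
  map_mul' := by intro a b; ext x; rfl

omit [FiniteDimensional K V] in
theorem sgn_rfn [Fintype V] [DecidableEq V] [DecidableEq K] (hs : ∀ x y, f x y = f y x) {v : V}
    (hv : f v v ≠ 0) :
    ((Equiv.Perm.sign (permHom f ⟨rfn f v, rfn_mem hs v⟩) : ℤˣ) : ℤ) = qc (f v v) := by
  set g := permHom f ⟨rfn f v, rfn_mem hs v⟩ with hg
  have h2 : (2 : K) ≠ 0 := two_ne
  have hga : ∀ x : {x : V // f x x = -1}, (g x : V) = rfn f v x := fun x => rfl
  have hgg : ∀ x, g (g x) = x := by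
    intro x; apply Subtype.ext; rw [hga, hga]; exact rfnL_inv v x.1
  have hg2 : g ^ 2 = 1 := by
    ext x; rw [pow_two, Equiv.Perm.mul_apply, hgg]; rfl
  have hfr : ∀ x, f (rfn f v x) v = - f x v := by
    intro x; rw [rfn_apply]; simp; field_simp; ring
  set Yp := Finset.univ.filter (fun x : {x : V // f x x = -1} => qc (f x.1 v) = 1) with hYp
  set Ym := Finset.univ.filter (fun x : {x : V // f x x = -1} => qc (f x.1 v) = -1) with hYm
  have hsup : g.support = Yp ∪ Ym := by
    ext x
    rw [Equiv.Perm.mem_support, Finset.mem_union, hYp, hYm, Finset.mem_filter, Finset.mem_filter]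
    have : g x = x ↔ f x.1 v = 0 := by
      rw [Subtype.ext_iff, hga, rfn_apply, sub_eq_self, smul_eq_zero]
      have hv' : v ≠ 0 := by rintro rfl; simp at hv
      simp [hv', h2, hv]
    rw [ne_eq, not_congr this]
    simp only [Finset.mem_univ, true_and]
    constructor
    · exact qc_or
    · rintro (h | h) h0 <;> rw [h0, qc_zero] at h <;> norm_num at h
  have hdis : Disjoint Yp Ym := by
    rw [Finset.disjoint_filter]
    intro x _ h h'; rw [h] at h'; norm_num at h'
  have hcard : Yp.card = Ym.card := by
    apply Finset.card_bij (fun x _ => g x)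
    · intro x hx
      rw [hYp, Finset.mem_filter] at hx
      rw [hYm, Finset.mem_filter, hga, hfr, qc_neg, hx.2]; simp
    · intro a _ b _ h; exact g.injective h
    · intro b hb
      refine ⟨g b, ?_, hgg b⟩
      rw [hYm, Finset.mem_filter] at hb
      rw [hYp, Finset.mem_filter, hga, hfr, qc_neg, hb.2]; simp
  rw [sign_invol g hg2, hsup, Finset.card_union_of_disjoint hdis, ← hcard,
    show (Yp.card + Yp.card) / 2 = Yp.card by omega]
  -- parity
  have hneg : ∀ x : {x : V // f x x = -1}, f (-(g x).1) (-(g x).1) = -1 := by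
    intro x; simp; exact (g x).2
  set k : {x : V // f x x = -1} → {x : V // f x x = -1} := fun x => ⟨-(g x).1, hneg x⟩ with hk
  have hkk : ∀ x, k (k x) = x := by
    intro x; apply Subtype.ext; simp only [hk, hga, map_neg, neg_neg]
    exact rfnL_inv v x.1
  have hkY : ∀ x ∈ Yp, k x ∈ Yp := by
    intro x hx
    rw [hYp, Finset.mem_filter] at *
    refine ⟨Finset.mem_univ _, ?_⟩
    simp only [hk, hga, map_neg, LinearMap.neg_apply, hfr, neg_neg]; exact hx.2
  have hev : Even (Yp.filter (fun x => ¬ k x = x)).card := by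
    have h0 : ∑ x ∈ Yp.filter (fun x => ¬ k x = x), (1 : ZMod 2) = 0 := by
      apply Finset.sum_involution (fun x _ => k x)
      · intro a _; decide
      · intro a ha _; exact (Finset.mem_filter.1 ha).2
      · intro a ha
        rw [Finset.mem_filter] at *
        refine ⟨hkY a ha.1, ?_⟩
        rw [hkk]; exact fun h => ha.2 h.symm
      · intro a _; exact hkk a
    simp only [Finset.sum_const, nsmul_eq_mul, mul_one] at h0
    exact (ZMod.natCast_eq_zero_iff_even).1 h0
  have hkf : ∀ x, k x = x ↔ (x : V) = (f x.1 v / f v v) • v := by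
    intro x
    rw [Subtype.ext_iff]
    simp only [hk, hga, rfn_apply]
    constructor
    · intro h
      have h3 : (2 : K) • x.1 = (2 : K) • ((f x.1 v / f v v) • v) := by
        rw [smul_smul, ← mul_div_assoc, ← div_mul_eq_mul_div]
        calc (2 : K) • x.1 = x.1 + x.1 := two_smul _ _
          _ = x.1 + -(x.1 - (2 / f v v * f x.1 v) • v) := by rw [h]
          _ = _ := by abel
      exact smul_right_injective V h2 h3
    · intro h
      rw [mul_comm, ← mul_div_assoc, mul_comm, mul_div_assoc, ← smul_smul, ← h, two_smul]; abel
  have hfix : (Yp.filter (fun x => k x = x)).card = if qc (f v v) = -1 then 1 else 0 := by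
    split_ifs with hq
    · rw [Finset.card_eq_one]
      have h3 : qc (-(f v v)) = 1 := by rw [qc_neg, hq]; norm_num
      obtain ⟨c, hc⟩ := (qc_eq_one (neg_ne_zero.2 hv)).1 h3
      have hc0 : c ≠ 0 := by rintro rfl; apply hv; simpa using hc
      have hcv : f v v = -(c * c) := by linear_combination -hc
      have hex : ∃ e : K, qc e = 1 ∧ e * e = c * c := by
        rcases qc_or hc0 with h | h
        · exact ⟨c, h, rfl⟩
        · exact ⟨-c, by rw [qc_neg, h]; norm_num, by ring⟩
      obtain ⟨e, he1, he2⟩ := hex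
      have he0 : e ≠ 0 := by rintro rfl; rw [qc_zero] at he1; norm_num at he1
      have hcv' : f v v = -(e * e) := by rw [he2, hcv]
      refine ⟨⟨(e / f v v) • v, ?_⟩, ?_⟩
      · simp [hcv']; field_simp
      · ext x
        rw [Finset.mem_filter, hYp, Finset.mem_filter, hkf, Finset.mem_singleton, Subtype.ext_iff]
        constructor
        · rintro ⟨⟨-, h1⟩, h4⟩
          have h5 : f x.1 v * f x.1 v = e * e := by
            have := x.2
            rw [h4] at this
            simp only [map_smul, LinearMap.smul_apply, smul_eq_mul] at this
            field_simp at this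
            rw [hcv'] at this
            linear_combination this
          have h6 : f x.1 v = e := by
            rcases mul_self_eq_mul_self_iff.1 h5 with h | h
            · exact h
            · rw [h, qc_neg, he1] at h1; norm_num at h1
          rw [h4, h6]
        · intro h4
          have h6 : f x.1 v = e := by
            rw [h4]; simp; field_simp
          refine ⟨⟨Finset.mem_univ _, by rw [h6, he1]⟩, by rw [h6]; exact h4⟩
    · rw [Finset.card_eq_zero, Finset.eq_empty_iff_forall_notMem]
      intro x hx
      rw [Finset.mem_filter, hYp, Finset.mem_filter, hkf] at hx
      obtain ⟨⟨-, h1⟩, h4⟩ := hx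
      have := x.2
      rw [h4] at this
      simp only [map_smul, LinearMap.smul_apply, smul_eq_mul] at this
      field_simp at this
      have hx0 : f x.1 v ≠ 0 := by
        intro h; rw [h, qc_zero] at h1; norm_num at h1
      apply hq
      have h5 : f v v = -(f x.1 v * f x.1 v) := by linear_combination this
      rw [h5, qc_neg, qc_mul, qc_sq hx0]
  have htot := Finset.card_filter_add_card_filter_not (s := Yp) (fun x => k x = x)
  rw [← htot, pow_add, hev.neg_one_pow, hfix]
  split_ifs with hq
  · rw [hq]; simp
  · rcases qc_or hv with h | h
    · rw [h]; simp
    · exact absurd h hq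

theorem sgn_eq [Fintype V] [DecidableEq V] [DecidableEq K] (hs : ∀ x y, f x y = f y x)
    (hnd : ND f ⊤) : ∀ (n : ℕ) (σ : V ≃ₗ[K] V) (h : σ ∈ orthGroup f), σ * σ = 1 →
    finrank K (Bm (σ : V →ₗ[K] V)) = n →
    ((Equiv.Perm.sign (permHom f ⟨σ, h⟩) : ℤˣ) : ℤ) = dq f (Bm (σ : V →ₗ[K] V)) := by
  intro n
  induction n with
  | zero =>
    intro σ h hσ hr
    have hB : Bm (σ : V →ₗ[K] V) = ⊥ := Submodule.finrank_eq_zero.1 (by simpa using hr)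
    have : σ = 1 := by
      ext x
      have hx : x - σ x ∈ Bm (σ : V →ₗ[K] V) := by
        rw [mem_Bm]
        have := (isInv_of_mem h hσ).2 x
        rw [map_sub]; erw [this]; simp
      rw [hB, Submodule.mem_bot, sub_eq_zero] at hx
      exact hx.symm
    rw [hB, dq_bot]
    have h1 : (⟨σ, h⟩ : orthGroup f) = 1 := Subtype.ext this
    rw [h1, map_one, map_one]; rfl
  | succ n ih =>
    intro σ h hσ hr
    obtain ⟨x, hx, hx0⟩ := exists_aniso f two_ne hs (nd_Bm two_ne hs hnd (isInv_of_mem h hσ)) (by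
      intro h0; rw [h0, finrank_bot] at hr; omega)
    obtain ⟨h1, h2, h3⟩ := refl_step two_ne hs h hσ hx hx0
    obtain ⟨h4, h5⟩ := refl_step_num hs h hσ hx hx0
    have h6 := ih _ h1 h2 (by omega)
    have h7 : (⟨σ, h⟩ : orthGroup f) = ⟨rfn f x, rfn_mem hs x⟩ * ⟨rfn f x * σ, h1⟩ := by
      apply Subtype.ext
      change σ = rfn f x * (rfn f x * σ)
      rw [← mul_assoc, rfn_sq, one_mul]
    rw [h7, map_mul, map_mul, Units.val_mul, h6, sgn_rfn hs hx0, h5]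

theorem omega_dq (hs : ∀ x y, f x y = f y x)
    (hnd : ND f ⊤) (σ : V ≃ₗ[K] V) (h : σ ∈ omegaGroup f) (hσ : σ * σ = 1) :
    dq f (Bm (σ : V →ₗ[K] V)) = 1 := by
  classical
  have : Finite V := Module.finite_of_finite K
  have : Fintype V := Fintype.ofFinite V
  have hle : omegaGroup f ≤ ((Equiv.Perm.sign.comp (permHom f)).ker).map (orthGroup f).subtype := by
    unfold omegaGroup
    rw [Subgroup.commutator_le]
    intro a ha b hb
    refine ⟨⁅(⟨a, ha⟩ : orthGroup f), (⟨b, hb⟩ : orthGroup f)⁆, ?_, rfl⟩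
    rw [SetLike.mem_coe, MonoidHom.mem_ker, map_commutatorElement]
    exact commutatorElement_eq_one_iff_mul_comm.2 (mul_comm _ _)
  obtain ⟨⟨s, hs1⟩, hs2, hs3⟩ := hle h
  have : s = σ := hs3
  subst this
  rw [← sgn_eq hs hnd _ s hs1 hσ rfl]
  have : Equiv.Perm.sign (permHom f ⟨s, hs1⟩) = 1 := hs2
  rw [this]; rfl

theorem omega_iff (hs : ∀ x y, f x y = f y x)
    (hnd : ND f ⊤) (σ : V ≃ₗ[K] V) (h : σ ∈ orthGroup f) (hσ : σ * σ = 1) :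
    σ ∈ omegaGroup f ↔ Even (finrank K (Bm (σ : V →ₗ[K] V))) ∧ dq f (Bm (σ : V →ₗ[K] V)) = 1 := by
  constructor
  · intro ho
    refine ⟨?_, omega_dq hs hnd σ ho hσ⟩
    have := (omega_le_so ho).2
    rw [(isInv_of_mem h hσ).det_eq two_ne] at this
    by_contra hodd
    rw [Nat.not_even_iff_odd] at hodd
    rw [hodd.neg_one_pow] at this
    have h3 : (2 : K) = 0 := by linear_combination -this
    exact two_ne h3
  · rintro ⟨⟨n, hn⟩, hd⟩
    exact omega_of hs hnd n σ h hσ (by omega) hd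

theorem so_iff (σ : V ≃ₗ[K] V) (h : σ ∈ orthGroup f) (hσ : σ * σ = 1) :
    σ ∈ specialOrthGroup f ↔ Even (finrank K (Bm (σ : V →ₗ[K] V))) := by
  have h3 : σ ∈ specialOrthGroup f ↔ LinearMap.det (σ : V →ₗ[K] V) = 1 :=
    ⟨fun h => h.2, fun h' => ⟨h, h'⟩⟩
  rw [h3, (isInv_of_mem h hσ).det_eq two_ne]
  constructor
  · intro this
    by_contra hodd
    rw [Nat.not_even_iff_odd] at hodd
    rw [hodd.neg_one_pow] at this
    have h3 : (2 : K) = 0 := by linear_combination -this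
    exact two_ne h3
  · intro h; exact h.neg_one_pow

omit [FiniteDimensional K V] [Fintype K] hK in
theorem inv_of_biref {φ σ τ : V ≃ₗ[K] V} (hσ : σ ^ 2 = 1) (hτ : τ ^ 2 = 1) (he : φ = σ * τ) :
    ∀ x, σ (φ x) = φ.symm (σ x) := by
  have h1 : σ * φ = φ⁻¹ * σ := by
    rw [pow_two] at hσ hτ
    rw [he, mul_inv_rev, inv_eq_of_mul_eq_one_left hσ, inv_eq_of_mul_eq_one_left hτ,
      ← mul_assoc, hσ, mul_assoc, hσ, one_mul, mul_one]
  intro x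
  exact congrArg (fun g : V ≃ₗ[K] V => g x) h1

theorem biref_so_inv {φ : V ≃ₗ[K] V} 
    (h : IsBireflectionalIn (specialOrthGroup f) φ) : ∃ σ : V →ₗ[K] V, IsInv f σ ∧
      (∀ x, σ (φ x) = φ.symm (σ x)) ∧ Even (finrank K (Bm σ)) := by
  obtain ⟨σ, τ, h1, h2, h3, h4, h5⟩ := h
  have h6 := inv_of_biref h3 h4 h5
  rw [pow_two] at h3
  exact ⟨σ, isInv_of_mem h1.1 h3, h6, (so_iff σ h1.1 h3).1 h1⟩

theorem biref_omega_iff (hs : ∀ x y, f x y = f y x)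
    (hnd : ND f ⊤) {φ : V ≃ₗ[K] V} (hφ : φ ∈ omegaGroup f) :
    IsBireflectionalIn (omegaGroup f) φ ↔ ∃ σ : V →ₗ[K] V, IsInv f σ ∧
      (∀ x, σ (φ x) = φ.symm (σ x)) ∧ Even (finrank K (Bm σ)) ∧ dq f (Bm σ) = 1 := by
  constructor
  · rintro ⟨σ, τ, h1, h2, h3, h4, h5⟩
    have h6 := inv_of_biref h3 h4 h5
    rw [pow_two] at h3
    have h7 := (omega_le_so h1).1
    exact ⟨σ, isInv_of_mem h7 h3, h6, (omega_iff hs hnd σ h7 h3).1 h1⟩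
  · rintro ⟨s, h1, h2, h3⟩
    set σ : V ≃ₗ[K] V := LinearEquiv.ofInvolutive s h1.2 with hσ
    have hsa : ∀ x, σ x = s x := fun x => rfl
    have hss : σ * σ = 1 := by ext x; exact h1.2 x
    have hm : σ ∈ orthGroup f := h1.1
    have ho : σ ∈ omegaGroup f := (omega_iff hs hnd σ hm hss).2 h3
    refine ⟨σ, σ * φ, ho, mul_mem ho hφ, ?_, ?_, ?_⟩
    · rw [pow_two, hss]
    · ext x
      rw [pow_two]
      change s (φ (s (φ x))) = x
      rw [h2, h1.2]; simp
    · rw [← mul_assoc, hss, one_mul]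

end A4

section A5
variable {K V : Type*} [Field K] [AddCommGroup V] [Module K V]

/-- cyclic submodule -/
noncomputable def cy (T : Module.End K V) (v : V) : Submodule K V :=
  LinearMap.range ((LinearMap.applyₗ v) ∘ₗ (aeval T : K[X] →ₐ[K] Module.End K V).toLinearMap)

theorem mem_cy {T : Module.End K V} {v x : V} : x ∈ cy T v ↔ ∃ g : K[X], aeval T g v = x := Iff.rfl

theorem ap_mul (T : Module.End K V) (g h : K[X]) (x : V) :
    aeval T (g * h) x = aeval T g (aeval T h x) := by rw [map_mul]; rfl
theorem ap_add (T : Module.End K V) (g h : K[X]) (x : V) :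
    aeval T (g + h) x = aeval T g x + aeval T h x := by rw [map_add]; rfl
theorem ap_sub (T : Module.End K V) (g h : K[X]) (x : V) :
    aeval T (g - h) x = aeval T g x - aeval T h x := by rw [map_sub]; rfl
theorem ap_one (T : Module.End K V) (x : V) :
    aeval T (1 : K[X]) x = x := by rw [map_one]; rfl
theorem ap_X (T : Module.End K V) (x : V) :
    aeval T (X : K[X]) x = T x := by rw [aeval_X]
theorem ap_C (T : Module.End K V) (c : K) (x : V) :
    aeval T (C c : K[X]) x = c • x := by rw [aeval_C]; rfl
theorem ap_comm (T : Module.End K V) (g h : K[X]) (x : V) :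
    aeval T g (aeval T h x) = aeval T h (aeval T g x) := by
  rw [← ap_mul, mul_comm, ap_mul]

theorem self_mem_cy (T : Module.End K V) (v : V) : v ∈ cy T v := ⟨1, ap_one T v⟩

theorem ap_mem {T : Module.End K V} {U : Submodule K V} (h : Invt T U) (g : K[X]) {x : V} (hx : x ∈ U) :
    aeval T g x ∈ U := by
  induction g using Polynomial.induction_on' with
  | add p q hp hq => rw [ap_add]; exact U.add_mem hp hq
  | monomial n a =>
    rw [← C_mul_X_pow_eq_monomial, ap_mul, ap_C]
    apply U.smul_mem
    induction n with
    | zero => rw [pow_zero, ap_one]; exact hx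
    | succ n ih => rw [pow_succ', ap_mul, ap_X]; exact h _ ih

theorem cy_inv (T : Module.End K V) (v : V) : Invt T (cy T v) := by
  rintro x ⟨g, rfl⟩
  exact ⟨X * g, by
    change aeval T (X * g) v = T (aeval T g v)
    rw [ap_mul, ap_X]⟩

theorem cy_le {T : Module.End K V} {U : Submodule K V} (h : Invt T U) {v : V} (hv : v ∈ U) : cy T v ≤ U := by
  rintro x ⟨g, rfl⟩
  exact ap_mem h g hv

def Ann (T : Module.End K V) (v : V) (Q : K[X]) : Prop := ∀ g, aeval T g v = 0 ↔ Q ∣ g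

theorem cy_eq_span {T : Module.End K V} {v : V} {Q : K[X]} (hQ : Q.Monic) (h0 : aeval T Q v = 0) :
    cy T v = Submodule.span K (Set.range fun i : Fin Q.natDegree => (T ^ (i : ℕ)) v) := by
  apply le_antisymm
  · rintro x ⟨g, rfl⟩
    change aeval T g v ∈ _
    have h1 : aeval T g v = aeval T (g %ₘ Q) v := by
      conv_lhs => rw [← modByMonic_add_div g Q]
      rw [ap_add, mul_comm, ap_mul, h0, map_zero, add_zero]
    rw [h1]
    by_cases hd : Q.natDegree = 0
    · have : Q = 1 := by
        exact hQ.natDegree_eq_zero.1 hd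
      rw [this, modByMonic_one, map_zero]
      exact Submodule.zero_mem _
    · have hlt : (g %ₘ Q).natDegree < Q.natDegree :=
        natDegree_modByMonic_lt g hQ (by rintro rfl; simp at hd)
      rw [aeval_eq_sum_range' hlt, LinearMap.sum_apply]
      apply Submodule.sum_mem
      intro i hi
      apply Submodule.smul_mem
      exact Submodule.subset_span ⟨⟨i, Finset.mem_range.1 hi⟩, rfl⟩
  · rw [Submodule.span_le]
    rintro _ ⟨i, rfl⟩
    exact ⟨X ^ (i : ℕ), by
      change aeval T (X ^ (i : ℕ)) v = _
      rw [map_pow, aeval_X]⟩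

theorem cy_finrank_le {T : Module.End K V} {v : V} {Q : K[X]} (hQ : Q.Monic) (h0 : aeval T Q v = 0) :
    finrank K (cy T v) ≤ Q.natDegree := by
  rw [cy_eq_span hQ h0]
  refine (finrank_range_le_card _).trans ?_
  simp

theorem cy_finrank {T : Module.End K V} {v : V} {Q : K[X]} (hQ : Q.Monic) (h : Ann T v Q) :
    finrank K (cy T v) = Q.natDegree := by
  rw [cy_eq_span hQ ((h Q).2 dvd_rfl), finrank_span_eq_card, Fintype.card_fin]
  rw [Fintype.linearIndependent_iff]
  intro g hg
  set G : K[X] := ∑ i : Fin Q.natDegree, C (g i) * X ^ (i : ℕ) with hG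
  have h1 : aeval T G v = 0 := by
    rw [hG, map_sum, LinearMap.sum_apply, ← hg]
    apply Finset.sum_congr rfl
    intro i _
    rw [ap_mul, ap_C, map_pow, aeval_X]
  have hdeg : G.degree < Q.degree := by
    rw [degree_eq_natDegree hQ.ne_zero]
    apply (degree_sum_le _ _).trans_lt
    rw [Finset.sup_lt_iff (by exact WithBot.bot_lt_coe _)]
    intro i _
    apply (degree_C_mul_X_pow_le _ _).trans_lt
    exact_mod_cast i.2
  have hG0 : G = 0 := eq_zero_of_dvd_of_degree_lt ((h G).1 h1) hdeg
  intro i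
  have := congrArg (fun p => coeff p (i : ℕ)) hG0
  simp only [hG, finsetSum_coeff, coeff_C_mul_X_pow, coeff_zero] at this
  rw [Finset.sum_eq_single i] at this
  · simpa using this
  · intro j _ hj
    rw [if_neg]
    intro h; exact hj (Fin.ext h.symm)
  · simp

theorem ann_of_finrank {T : Module.End K V} {v : V} {Q : K[X]} (hQ : Q.Monic) (h0 : aeval T Q v = 0)
    (hd : finrank K (cy T v) = Q.natDegree) : Ann T v Q := by
  classical
  intro g
  constructor
  · intro hg
    set G := EuclideanDomain.gcd Q g with hG
    have hG0 : aeval T G v = 0 := by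
      rw [hG, EuclideanDomain.gcd_eq_gcd_ab, ap_add, mul_comm, ap_mul, h0, mul_comm g, ap_mul, hg]
      simp
    have hGne : G ≠ 0 := by
      intro h; exact hQ.ne_zero (EuclideanDomain.gcd_eq_zero_iff.1 h).1
    have hGm : (normalize G).Monic := monic_normalize hGne
    have hG1 : aeval T (normalize G) v = 0 := by
      rw [normalize_apply, mul_comm, ap_mul, hG0, map_zero]
    have h2 := cy_finrank_le hGm hG1
    rw [hd] at h2
    have hdv : normalize G ∣ Q := (normalize_dvd_iff).2 (EuclideanDomain.gcd_dvd_left Q g)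
    have : normalize G = Q := by
      exact (eq_of_monic_of_dvd_of_natDegree_le hGm hQ hdv h2).symm
    rw [← this]
    exact (normalize_dvd_iff).2 (EuclideanDomain.gcd_dvd_right Q g)
  · rintro ⟨h, rfl⟩
    rw [mul_comm, ap_mul, h0, map_zero]

theorem ker_cy {T : Module.End K V} {v : V} {p Q' : K[X]} {e : ℕ} (hp : Irreducible p) (hpm : p.Monic)
    (hQ' : ¬ p ∣ Q') (h : Ann T v (p ^ e * Q')) (h0 : Q' ≠ 0) (k : ℕ) :
    finrank K (LinearMap.ker (aeval T p ^ k) ⊓ cy T v : Submodule K V) = min k e * p.natDegree := by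
  set m := min k e with hm
  have hpp : Prime p := hp.prime
  set w := aeval T (p ^ (e - m) * Q') v with hw
  have hA : Ann T w (p ^ m) := by
    intro g
    rw [hw, ← ap_mul, h, show p ^ e * Q' = p ^ m * (p ^ (e - m) * Q') by
      rw [← mul_assoc, ← pow_add]; congr 2; omega]
    exact mul_dvd_mul_iff_right (mul_ne_zero (pow_ne_zero _ hp.ne_zero) h0)
  have hE : LinearMap.ker (aeval T p ^ k) ⊓ cy T v = cy T w := by
    ext x
    constructor
    · rintro ⟨hx, g, rfl⟩
      change (aeval T p ^ k) (aeval T g v) = 0 at hx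
      rw [← map_pow, ← ap_mul, h] at hx
      have hd : p ^ (e - m) * Q' ∣ g := by
        rcases le_total k e with hke | hke
        · have hmk : m = k := by omega
          rw [show p ^ e * Q' = p ^ k * (p ^ (e - m) * Q') by
            rw [← mul_assoc, ← pow_add]; congr 2; omega] at hx
          exact (mul_dvd_mul_iff_left (pow_ne_zero _ hp.ne_zero)).1 hx
        · have hme : m = e := by omega
          rw [hme, Nat.sub_self, pow_zero, one_mul]
          have hc : IsCoprime Q' (p ^ k) := ((hp.coprime_iff_not_dvd.2 hQ').symm).pow_right
          exact hc.dvd_of_dvd_mul_left ((Dvd.intro_left _ rfl).trans hx)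
      obtain ⟨g', rfl⟩ := hd
      refine ⟨g', ?_⟩
      change aeval T g' w = aeval T _ v
      rw [mul_comm, ap_mul]
    · rintro ⟨g, rfl⟩
      refine ⟨?_, ?_⟩
      · change (aeval T p ^ k) (aeval T g w) = 0
        rw [← map_pow, ← ap_mul, hA]
        exact (pow_dvd_pow p (min_le_left k e)).mul_right g
      · exact ⟨g * (p ^ (e - m) * Q'), ap_mul ..⟩
  rw [hE, cy_finrank (hpm.pow m) hA, natDegree_pow]

/-- internal multiplicity -/
noncomputable def Mz (T : Module.End K V) (p : K[X]) (U : Submodule K V) (d : ℕ) : ℤ :=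
  2 * (finrank K (LinearMap.ker (aeval T p ^ d) ⊓ U : Submodule K V) : ℤ)
  - finrank K (LinearMap.ker (aeval T p ^ (d + 1)) ⊓ U : Submodule K V)
  - finrank K (LinearMap.ker (aeval T p ^ (d - 1)) ⊓ U : Submodule K V)

theorem Mz_cy {T : Module.End K V} {v : V} {p Q' : K[X]} {e : ℕ} (hp : Irreducible p) (hpm : p.Monic)
    (hQ' : ¬ p ∣ Q') (h : Ann T v (p ^ e * Q')) (h0 : Q' ≠ 0) {d : ℕ} (hd : 1 ≤ d) :
    Mz T p (cy T v) d = if d = e then (p.natDegree : ℤ) else 0 := by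
  unfold Mz
  rw [ker_cy hp hpm hQ' h h0, ker_cy hp hpm hQ' h h0, ker_cy hp hpm hQ' h h0]
  split_ifs with hde
  · subst hde
    rw [min_self, min_eq_right (by omega), min_eq_left (by omega)]
    obtain ⟨d, rfl⟩ : ∃ n, d = n + 1 := ⟨d - 1, by omega⟩
    simp only [Nat.add_sub_cancel]
    push_cast; ring
  · rcases lt_or_gt_of_ne hde with h | h
    · rw [min_eq_left (by omega), min_eq_left (by omega), min_eq_left (by omega)]
      obtain ⟨d, rfl⟩ : ∃ n, d = n + 1 := ⟨d - 1, by omega⟩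
      simp only [Nat.add_sub_cancel]
      push_cast; ring
    · rw [min_eq_right (by omega), min_eq_right (by omega), min_eq_right (by omega)]
      ring

variable [FiniteDimensional K V]
theorem ker_sup {T : Module.End K V} {A B : Submodule K V} (hA : Invt T A) (hB : Invt T B)
    (hd : Disjoint A B) (g : K[X]) :
    finrank K (LinearMap.ker (aeval T g) ⊓ (A ⊔ B) : Submodule K V) =
    finrank K (LinearMap.ker (aeval T g) ⊓ A : Submodule K V) +
    finrank K (LinearMap.ker (aeval T g) ⊓ B : Submodule K V) := by
  rw [← finrank_sup_disj (hd.mono inf_le_right inf_le_right)]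
  suffices hE : LinearMap.ker (aeval T g) ⊓ (A ⊔ B) =
    (LinearMap.ker (aeval T g) ⊓ A) ⊔ (LinearMap.ker (aeval T g) ⊓ B) by rw [hE]
  apply le_antisymm
  · rintro x ⟨hx, hx2⟩
    obtain ⟨a, ha, b, hb, rfl⟩ := Submodule.mem_sup.1 hx2
    have h1 : aeval T g a + aeval T g b = 0 := by rw [← map_add]; exact hx
    have h2 : aeval T g a = 0 := by
      apply Submodule.disjoint_def.1 hd _ (ap_mem hA g ha)
      rw [eq_neg_of_add_eq_zero_left h1]
      exact B.neg_mem (ap_mem hB g hb)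
    rw [h2, zero_add] at h1
    exact Submodule.add_mem_sup ⟨h2, ha⟩ ⟨h1, hb⟩
  · apply sup_le
    · exact inf_le_inf_left _ le_sup_left
    · exact inf_le_inf_left _ le_sup_right

theorem Mz_sup {T : Module.End K V} {A B : Submodule K V} (hA : Invt T A) (hB : Invt T B)
    (hd : Disjoint A B) (p : K[X]) (d : ℕ) : Mz T p (A ⊔ B) d = Mz T p A d + Mz T p B d := by
  unfold Mz
  have hk : ∀ k, aeval T p ^ k = aeval T (p ^ k) := fun k => (map_pow _ _ _).symm
  rw [hk, hk, hk]
  rw [ker_sup hA hB hd, ker_sup hA hB hd, ker_sup hA hB hd]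
  push_cast; ring

theorem Mz_bot (T : Module.End K V) (p : K[X]) (d : ℕ) : Mz T p ⊥ d = 0 := by
  unfold Mz
  have h : ∀ W : Submodule K V, finrank K (W ⊓ ⊥ : Submodule K V) = 0 := fun W => by
    rw [inf_bot_eq]; exact finrank_bot K V
  rw [h, h, h]; rfl

end A5

section A6
variable {K V : Type*} [Field K] [AddCommGroup V] [Module K V]
variable {f : LinearMap.BilinForm K V} {T s : Module.End K V} {S : K[X]}

/-- the abstract operators -/
structure Op (f : LinearMap.BilinForm K V) (T s : Module.End K V) (S : K[X]) : Prop where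
  two : (2 : K) ≠ 0
  sym : ∀ x y, f x y = f y x
  adj : ∀ x y, f (T x) y = f x (T y)
  anti : ∀ x y, f (s x) y = - f x (s y)
  comm : ∀ x, s (T x) = T (s x)
  sq : ∀ x, s (s x) = aeval T S x

theorem Op.adjg (h : Op f T s S) (g : K[X]) (x y : V) : f (aeval T g x) y = f x (aeval T g y) := by
  induction g using Polynomial.induction_on' generalizing x y with
  | add p q hp hq => rw [ap_add, ap_add, map_add, map_add, LinearMap.add_apply, hp, hq]
  | monomial n a =>
    rw [← C_mul_X_pow_eq_monomial]
    rw [ap_mul, ap_mul, ap_C, ap_C, map_smul, map_smul, LinearMap.smul_apply]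
    congr 1
    induction n generalizing x y with
    | zero => rw [pow_zero, ap_one, ap_one]
    | succ n ih => rw [pow_succ, ap_mul, ih, ap_X, h.adj, mul_comm, ap_mul, ap_X]

theorem Op.commg (h : Op f T s S) (g : K[X]) (x : V) : s (aeval T g x) = aeval T g (s x) := by
  induction g using Polynomial.induction_on' generalizing x with
  | add p q hp hq => rw [ap_add, ap_add, map_add, hp, hq]
  | monomial n a =>
    rw [← C_mul_X_pow_eq_monomial]
    rw [ap_mul, ap_mul, ap_C, ap_C, map_smul]
    congr 1
    induction n generalizing x with
    | zero => rw [pow_zero, ap_one, ap_one]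
    | succ n ih => rw [pow_succ, ap_mul, ih, ap_X, h.comm, ap_mul, ap_X]

theorem Op.self_s (h : Op f T s S) (v : V) (g k : K[X]) : f (aeval T g v) (aeval T k (s v)) = 0 := by
  have h1 : f (aeval T g v) (aeval T k (s v)) = - f (aeval T g v) (aeval T k (s v)) := by
    conv_lhs => rw [← h.commg, ← neg_eq_iff_eq_neg.2 (h.anti _ _), h.commg, h.sym, ← h.adjg, ap_comm, h.adjg]
  have h2 : (2 : K) * f (aeval T g v) (aeval T k (s v)) = 0 := by linear_combination h1
  exact (mul_eq_zero.1 h2).resolve_left h.two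

theorem Op.ss (h : Op f T s S) (v w : V) (g k : K[X]) :
    f (aeval T g (s v)) (aeval T k (s w)) = - f (aeval T (g * k * S) v) w := by
  rw [← h.commg, h.anti, h.commg, h.sq, ← h.adjg, ← h.adjg, ← ap_mul, ← ap_mul,
    show S * k * g = g * k * S by ring]

theorem Op.gk (h : Op f T s S) (v w : V) (g k : K[X]) :
    f (aeval T g v) (aeval T k w) = f (aeval T (g * k) v) w := by
  rw [← h.adjg, ← ap_mul, mul_comm]

/-- pairing lemma -/
theorem Op.pair {r : K[X]} (hr : Irreducible r) {D : ℕ} {v w : V}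
    (h0 : aeval T (r ^ D) v = 0) (h1 : D ≠ 0 → ∃ k, f (aeval T (k * r ^ (D - 1)) v) w ≠ 0) {g : K[X]}
    (hg : ¬ r ^ D ∣ g) : ∃ k, f (aeval T (k * g) v) w ≠ 0 := by
  have hD : D ≠ 0 := by rintro rfl; exact hg (by simp)
  obtain ⟨k0, hk0⟩ := h1 hD
  have hg0 : g ≠ 0 := by rintro rfl; exact hg (dvd_zero _)
  obtain ⟨n, g', hg', rfl⟩ : ∃ (n : ℕ) (g' : K[X]), ¬ r ∣ g' ∧ g = r ^ n * g' := by
    obtain ⟨g', h1, h2⟩ := (FiniteMultiplicity.of_not_isUnit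
      hr.not_isUnit hg0).exists_eq_pow_mul_and_not_dvd
    exact ⟨_, g', h2, h1⟩
  have hn : n < D := by
    by_contra hc
    exact hg ((pow_dvd_pow r (not_lt.1 hc)).mul_right _)
  have hc : IsCoprime (r ^ D) g' := (hr.coprime_iff_not_dvd.2 hg').pow_left
  obtain ⟨a, b, hab⟩ := hc
  refine ⟨k0 * r ^ (D - 1 - n) * b, ?_⟩
  have : k0 * r ^ (D - 1 - n) * b * (r ^ n * g') = k0 * r ^ (D - 1) - (k0 * r ^ (D - 1) * a) * r ^ D := by
    rw [show D - 1 = (D - 1 - n) + n by omega, pow_add, show D - 1 - n + n - n = D - 1 - n by omega]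
    linear_combination (k0 * r ^ (D - 1 - n) * r ^ n) * hab
  rw [this, ap_sub, ap_mul T _ (r ^ D), h0, map_zero, sub_zero]
  exact hk0

theorem Op.half (h : Op f T s S) {r : K[X]} (hr : Irreducible r) {D : ℕ} {v : V}
    (h0 : aeval T (r ^ D) v = 0) (h1 : D ≠ 0 → ∃ k, f (aeval T (k * r ^ (D - 1)) v) v ≠ 0) :
    Ann T v (r ^ D) ∧ ND f (cy T v) := by
  constructor
  · intro g
    constructor
    · intro hg
      by_contra hc
      obtain ⟨k, hk⟩ := Op.pair hr h0 h1 hc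
      rw [ap_mul, hg] at hk; simp at hk
    · rintro ⟨g, rfl⟩
      rw [mul_comm, ap_mul, h0, map_zero]
  · rintro x ⟨g, rfl⟩ hx
    change aeval T g v = 0
    by_contra hc
    have : ¬ r ^ D ∣ g := by
      rintro ⟨g, rfl⟩
      rw [mul_comm, ap_mul, h0, map_zero] at hc; exact hc rfl
    obtain ⟨k, hk⟩ := Op.pair hr h0 h1 this
    apply hk
    rw [mul_comm, ← h.gk]
    exact hx _ ⟨k, rfl⟩

/-- plus part, minus part of a block -/
structure Blk (f : LinearMap.BilinForm K V) (T s : Module.End K V) (P M : Submodule K V) : Prop where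
  ndP : ND f P
  ndM : ND f M
  orth : ∀ x ∈ P, ∀ y ∈ M, f x y = 0
  TP : Invt T P
  TM : Invt T M
  sP : ∀ x ∈ P, s x ∈ M
  sM : ∀ x ∈ M, s x ∈ P

theorem Blk.symm (hs : ∀ x y, f x y = f y x) {P M : Submodule K V} (h : Blk f T s P M) : Blk f T s M P :=
  ⟨h.ndM, h.ndP, fun x hx y hy => by rw [hs]; exact h.orth y hy x hx, h.TM, h.TP, h.sM, h.sP⟩

theorem Blk.disj (hs : ∀ x y, f x y = f y x) {P M : Submodule K V} (h : Blk f T s P M) : Disjoint P M := by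
  rw [Submodule.disjoint_def]
  intro x hx hy
  exact h.ndP x hx (fun y hy' => by rw [hs]; exact h.orth y hy' x hy)

theorem Op.blk (h : Op f T s S) {v : V} (h1 : ND f (cy T v)) (h2 : ND f (cy T (s v))) :
    Blk f T s (cy T v) (cy T (s v)) := by
  refine ⟨h1, h2, ?_, cy_inv _ _, cy_inv _ _, ?_, ?_⟩
  · rintro x ⟨g, rfl⟩ y ⟨k, rfl⟩
    exact h.self_s v g k
  · rintro x ⟨g, rfl⟩
    exact ⟨g, (h.commg g v).symm⟩
  · rintro x ⟨g, rfl⟩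
    refine ⟨g * S, ?_⟩
    change aeval T (g * S) v = s (aeval T g (s v))
    rw [h.commg, h.sq, ap_mul]

theorem Op.blkR (h : Op f T s S) {r : K[X]} (hr : Irreducible r) (hS : ¬ r ∣ S) {D : ℕ} {v : V}
    (h0 : aeval T (r ^ D) v = 0) (h1 : D ≠ 0 → ∃ k, f (aeval T (k * r ^ (D - 1)) v) v ≠ 0) :
    Blk f T s (cy T v) (cy T (s v)) ∧ Ann T v (r ^ D) ∧ Ann T (s v) (r ^ D) := by
  have hc : IsCoprime (r ^ D) S := (hr.coprime_iff_not_dvd.2 hS).pow_left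
  obtain ⟨a, b, hab⟩ := hc
  obtain ⟨ha, hn⟩ := h.half hr h0 h1
  have h0' : aeval T (r ^ D) (s v) = 0 := by rw [← h.commg, h0, map_zero]
  obtain ⟨ha', hn'⟩ := h.half hr h0' (fun hD => by
    obtain ⟨k, hk⟩ := h1 hD
    refine ⟨k * b, ?_⟩
    have := h.ss v v (k * b * r ^ (D - 1)) 1
    rw [ap_one] at this
    rw [this, show k * b * r ^ (D - 1) * 1 * S = k * r ^ (D - 1) - (k * r ^ (D - 1) * a) * r ^ D by
      linear_combination (k * r ^ (D - 1)) * hab, ap_sub, ap_mul T _ (r ^ D), h0, map_zero, sub_zero]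
    exact neg_ne_zero.2 hk)
  exact ⟨h.blk hn hn', ha, ha'⟩

/-- type 3 -/
theorem Op.blk3 (h : Op f T s (X * (X + 4))) {e : ℕ} {v : V} (h0 : aeval T (X ^ (e + 1) : K[X]) v = 0)
    (hs0 : aeval T (X ^ e : K[X]) (s v) = 0) (h1 : f (aeval T (X ^ e : K[X]) v) v ≠ 0) :
    Blk f T s (cy T v) (cy T (s v)) ∧ Ann T v (X ^ (e + 1)) ∧ Ann T (s v) (X ^ e) := by
  obtain ⟨ha, hn⟩ := h.half (irreducible_X (R := K)) h0 (fun _ => ⟨1, by simpa using h1⟩)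
  obtain ⟨ha', hn'⟩ := h.half (irreducible_X (R := K)) hs0 (fun hD => by
    refine ⟨1, ?_⟩
    have := h.ss v v (1 * X ^ (e - 1)) 1
    rw [ap_one] at this
    rw [this, show (1 * X ^ (e - 1) * 1 * (X * (X + 4)) : K[X]) = X ^ (e + 1) + C 4 * X ^ e by
      rw [pow_succ, show (X ^ e : K[X]) = X ^ (e - 1) * X by rw [← pow_succ]; congr 1; omega]
      rw [show (C 4 : K[X]) = 4 from rfl]
      ring, ap_add, h0, zero_add, ap_mul, ap_C, map_smul, LinearMap.smul_apply]
    refine neg_ne_zero.2 (mul_ne_zero ?_ h1)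
    rw [show (4 : K) = 2 * 2 by norm_num]; exact mul_ne_zero h.two h.two)
  exact ⟨h.blk hn hn', ha, ha'⟩

end A6

section A7
variable {K V : Type*} [Field K] [AddCommGroup V] [Module K V]
variable {f : LinearMap.BilinForm K V} {T s : Module.End K V} {S : K[X]}

theorem cy_spanX {v : V} {n : ℕ} (h0 : aeval T (X ^ n : K[X]) v = 0) :
    cy T v = Submodule.span K (Set.range fun i : Fin n => (T ^ (i : ℕ)) v) := by
  have := cy_eq_span (monic_X_pow n) h0
  rw [natDegree_X_pow] at this
  exact this

theorem ap_Xp (T : Module.End K V) (n : ℕ) (x : V) : aeval T (X ^ n : K[X]) x = (T ^ n) x := by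
  rw [map_pow, aeval_X]

theorem pow_zero_of_le {v : V} {n m : ℕ} (h0 : (T ^ n) v = 0) (h : n ≤ m) : (T ^ m) v = 0 := by
  obtain ⟨k, rfl⟩ := Nat.exists_eq_add_of_le h
  rw [add_comm, pow_add]
  change (T ^ k) ((T ^ n) v) = 0
  rw [h0, map_zero]

theorem Op.gkp (h : Op f T s S) (v w : V) (i j : ℕ) :
    f ((T ^ i) v) ((T ^ j) w) = f ((T ^ (i + j)) v) w := by
  have := h.gk v w (X ^ i) (X ^ j)
  rwa [← pow_add, ap_Xp, ap_Xp, ap_Xp] at this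

theorem Op.ssp (h : Op f T s (X * (X + 4))) (v w : V) (i j : ℕ) :
    f ((T ^ i) (s v)) ((T ^ j) (s w)) = - f ((T ^ (i + j + 2)) v) w - 4 * f ((T ^ (i + j + 1)) v) w := by
  have := h.ss v w (X ^ i) (X ^ j)
  rw [← pow_add, ap_Xp, ap_Xp, show (X ^ (i + j) * (X * (X + 4)) : K[X]) = X ^ (i + j + 2) + C 4 * X ^ (i + j + 1) by
    rw [show (C 4 : K[X]) = 4 from rfl]; ring, ap_add, ap_mul, ap_C, ap_Xp, ap_Xp, map_add, map_smul,
    LinearMap.add_apply, LinearMap.smul_apply] at this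
  rw [this, smul_eq_mul]; ring

variable [FiniteDimensional K V] [Fintype K] [hK : Fact (Fintype.card K % 4 = 3)]

theorem Op.dqX (h : Op f T s S) {n : ℕ} {v : V} {c : K} (hc : c ≠ 0) (h0 : (T ^ n) v = 0)
    (h1 : n ≠ 0 → f ((T ^ (n - 1)) v) v = c) :
    finrank K (cy T v) = n ∧ dq f (cy T v) = (-1) ^ (n / 2) * qc c ^ n := by
  rw [cy_spanX (T := T) (v := v) (n := n) (by rw [ap_Xp]; exact h0)]
  have := at_lemma f (n := n) (w := fun i : Fin n => (T ^ (i : ℕ)) v) hc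
    (fun i j hij => by
      rw [h.gkp, pow_zero_of_le h0 hij]; simp)
    (fun i j hij => by
      rw [h.gkp, ← h1 (by have := i.2; omega)]; congr 4; omega)
  exact this.2.2

/-- the sign -/
def ep (d : ℕ) : ℤ := if d % 8 = 3 ∨ d % 8 = 5 then -1 else 1

theorem ep_even (e : ℕ) (δ : ℤ) (_ : δ * δ = 1) :
    (-1 : ℤ) ^ (e / 2) * (- δ) ^ e = ep (2 * e + 1) * δ ^ e := by
  rw [neg_pow δ, ← mul_assoc, ← pow_add]
  congr 1
  unfold ep
  obtain ⟨k, hk | hk | hk | hk⟩ : ∃ k, e = 4 * k ∨ e = 4 * k + 1 ∨ e = 4 * k + 2 ∨ e = 4 * k + 3 :=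
    ⟨e / 4, by omega⟩
  · rw [if_neg (by omega), Even.neg_one_pow ⟨3 * k, by omega⟩]
  · rw [if_pos (by omega), Odd.neg_one_pow ⟨3 * k, by omega⟩]
  · rw [if_pos (by omega), Odd.neg_one_pow ⟨3 * k + 1, by omega⟩]
  · rw [if_neg (by omega), Even.neg_one_pow ⟨3 * k + 2, by omega⟩]

theorem ep_odd (e : ℕ) : (-1 : ℤ) ^ ((e + 1) / 2) = ep (2 * e + 1) := by
  unfold ep
  obtain ⟨k, hk | hk | hk | hk⟩ : ∃ k, e = 4 * k ∨ e = 4 * k + 1 ∨ e = 4 * k + 2 ∨ e = 4 * k + 3 :=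
    ⟨e / 4, by omega⟩
  · rw [if_neg (by omega), Even.neg_one_pow ⟨k, by omega⟩]
  · rw [if_pos (by omega), Odd.neg_one_pow ⟨k, by omega⟩]
  · rw [if_pos (by omega), Odd.neg_one_pow ⟨k, by omega⟩]
  · rw [if_neg (by omega), Even.neg_one_pow ⟨k + 1, by omega⟩]

theorem dq_blk (hs : ∀ x y, f x y = f y x) {P M : Submodule K V} (h : Blk f T s P M) :
    dq f (P ⊔ M) = dq f P * dq f M :=
  dq_sup f (h.disj hs) h.orth (fun x hx y hy => by rw [hs]; exact h.orth x hx y hy)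

theorem Op.dq3 (h : Op f T s (X * (X + 4))) {e : ℕ} {v : V} (h0 : (T ^ (e + 1)) v = 0)
    (hs0 : (T ^ e) (s v) = 0) (h1 : f ((T ^ e) v) v ≠ 0) :
    let P := cy T v
    let M := cy T (s v)
    Blk f T s P M ∧ finrank K P = e + 1 ∧ finrank K M = e ∧
    dq f P = ep (2 * e + 1) * dq f (P ⊔ M) ^ (e + 1) ∧ dq f M = ep (2 * e + 1) * dq f (P ⊔ M) ^ e := by
  intro P M
  have hb := (h.blk3 (e := e) (v := v) (by rw [ap_Xp]; exact h0) (by rw [ap_Xp]; exact hs0)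
    (by rw [ap_Xp]; exact h1)).1
  set c := f ((T ^ e) v) v with hc
  obtain ⟨p1, p2⟩ := h.dqX h1 h0 (fun _ => by simp [hc])
  have h4 : -4 * c ≠ 0 := mul_ne_zero (neg_ne_zero.2 (four_ne)) h1
  obtain ⟨m1, m2⟩ := h.dqX h4 hs0 (fun he => by
    have := h.ssp v v (e - 1) 0
    rw [show e - 1 + 0 + 2 = e + 1 by omega, show e - 1 + 0 + 1 = e by omega, h0] at this
    simp only [pow_zero, Module.End.one_apply] at this
    rw [this]; simp [hc])
  have hq : qc (-4 * c) = - qc c := by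
    rw [show -4 * c = -(2 * 2 * c) by ring, qc_neg, qc_mul_sq]
    exact two_ne
  have hcc : qc c * qc c = 1 := qc_sq h1
  have e1 : dq f P = ep (2 * e + 1) * qc c ^ (e + 1) := by
    rw [← ep_odd]; exact p2
  have e2 : dq f M = ep (2 * e + 1) * qc c ^ e := by
    rw [← ep_even _ _ hcc, ← hq]; exact m2
  have he : ep (2 * e + 1) * ep (2 * e + 1) = 1 := by unfold ep; split_ifs <;> norm_num
  have e3 : dq f (P ⊔ M) = qc c := by
    rw [dq_blk h.sym hb, e1, e2]
    have : (qc c ^ e) * (qc c ^ e) = 1 := by rw [← mul_pow, hcc, one_pow]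
    rw [pow_succ]
    linear_combination (qc c * qc c ^ e * qc c ^ e) * he + qc c * this
  refine ⟨hb, p1, m1, ?_, ?_⟩
  · rw [e3]; exact e1
  · rw [e3]; exact e2

theorem Op.half4 (h : Op f T s (X * (X + 4))) {D : ℕ} {v w : V} (hv : (T ^ D) v = 0)
    (hw : (T ^ D) w = 0) (h1 : f ((T ^ (D - 1)) (s v)) w ≠ 0) :
    ND f (cy T v ⊔ cy T (s w)) ∧ finrank K (cy T v ⊔ cy T (s w) : Submodule K V) = 2 * D ∧
    dq f (cy T v ⊔ cy T (s w)) = (-1) ^ D := by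
  have hsw : (T ^ D) (s w) = 0 := by
    have := h.commg (X ^ D) w
    rw [ap_Xp, ap_Xp, hw, map_zero] at this; exact this.symm
  have hs1 : ∀ k, f ((T ^ k) v) (s w) = - f ((T ^ k) (s v)) w := by
    intro k
    have := h.commg (X ^ k) v
    rw [ap_Xp, ap_Xp] at this
    rw [← this, h.anti, neg_neg]
  set u : Fin (2 * D) → V := fun i => if (i : ℕ) % 2 = 0 then (T ^ ((i : ℕ) / 2)) v
    else (T ^ ((i : ℕ) / 2)) (s w) with hu
  have hspan : cy T v ⊔ cy T (s w) = Submodule.span K (Set.range u) := by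
    rw [cy_spanX (n := D) (by rw [ap_Xp]; exact hv), cy_spanX (n := D) (by rw [ap_Xp]; exact hsw)]
    apply le_antisymm
    · apply sup_le
      · rw [Submodule.span_le]
        rintro _ ⟨i, rfl⟩
        apply Submodule.subset_span
        refine ⟨⟨2 * i, by have := i.2; omega⟩, ?_⟩
        simp [hu]
      · rw [Submodule.span_le]
        rintro _ ⟨i, rfl⟩
        apply Submodule.subset_span
        refine ⟨⟨2 * i + 1, by have := i.2; omega⟩, ?_⟩
        simp only [hu]
        rw [if_neg (by omega), show (2 * (i : ℕ) + 1) / 2 = i by omega]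
    · rw [Submodule.span_le]
      rintro _ ⟨i, rfl⟩
      simp only [hu]
      split_ifs
      · exact Submodule.mem_sup_left (Submodule.subset_span ⟨⟨i / 2, by have := i.2; omega⟩, rfl⟩)
      · exact Submodule.mem_sup_right (Submodule.subset_span ⟨⟨i / 2, by have := i.2; omega⟩, rfl⟩)
  have := at_lemma f (n := 2 * D) (w := u) (neg_ne_zero.2 h1)
    (fun i j hij => by
      simp only [hu]
      split_ifs with h1 h2 h2
      · rw [h.gkp, pow_zero_of_le hv (by omega)]; simp
      · rw [h.gkp, pow_zero_of_le hv (by omega)]; simp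
      · rw [h.sym, h.gkp, pow_zero_of_le hv (by omega)]; simp
      · rw [h.ssp, pow_zero_of_le hw (by omega), pow_zero_of_le hw (by omega)]; simp)
    (fun i j hij => by
      simp only [hu]
      split_ifs with h1 h2 h2
      · omega
      · rw [h.gkp, hs1]; congr 5; omega
      · rw [h.sym, h.gkp, hs1]; congr 5; omega
      · omega)
  rw [hspan]
  refine ⟨this.2.1, this.2.2.1, ?_⟩
  rw [this.2.2.2, pow_mul, pow_two, qc_sq (neg_ne_zero.2 h1), one_pow, mul_one]
  congr 1; omega

theorem Op.blk4 (h : Op f T s (X * (X + 4))) {D : ℕ} {v w : V} (hv : (T ^ D) v = 0)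
    (hw : (T ^ D) w = 0) (h1 : f ((T ^ (D - 1)) (s v)) w ≠ 0) (ho : ∀ k, f ((T ^ k) v) w = 0) :
    let P := cy T v ⊔ cy T (s w)
    let M := cy T w ⊔ cy T (s v)
    Blk f T s P M ∧ finrank K P = 2 * D ∧ finrank K M = 2 * D ∧
    dq f P = (-1) ^ D ∧ dq f M = (-1) ^ D := by
  intro P M
  obtain ⟨p1, p2, p3⟩ := h.half4 hv hw h1
  have h2 : f ((T ^ (D - 1)) (s w)) v ≠ 0 := by
    have := h.commg (X ^ (D - 1)) w
    rw [ap_Xp, ap_Xp] at this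
    have h3 := h.adjg (X ^ (D - 1)) w (s v)
    rw [ap_Xp, ap_Xp] at h3
    rw [← this, h.anti, h3, h.sym]
    exact neg_ne_zero.2 h1
  obtain ⟨m1, m2, m3⟩ := h.half4 hw hv h2
  have hog : ∀ g k : K[X], f (aeval T g v) (aeval T k w) = 0 := by
    intro g k
    rw [h.gk]
    generalize g * k = g
    induction g using Polynomial.induction_on' with
    | add p q hp hq => rw [ap_add, map_add, LinearMap.add_apply, hp, hq, add_zero]
    | monomial n a =>
      rw [← C_mul_X_pow_eq_monomial]
      rw [ap_mul, ap_C, map_smul, LinearMap.smul_apply, ap_Xp, ho, smul_zero]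
  refine ⟨⟨p1, m1, ?_, ?_, ?_, ?_, ?_⟩, p2, m2, p3, m3⟩
  · intro x hx y hy
    obtain ⟨_, ⟨a, rfl⟩, _, ⟨b, rfl⟩, rfl⟩ := Submodule.mem_sup.1 hx
    obtain ⟨_, ⟨a', rfl⟩, _, ⟨b', rfl⟩, rfl⟩ := Submodule.mem_sup.1 hy
    change f (aeval T a v + aeval T b (s w)) (aeval T a' w + aeval T b' (s v)) = 0
    have e1 := hog a a'
    have e2 := h.self_s v a b'
    have e3 := h.self_s w a' b
    have e4 := h.ss w v b b'
    have e5 := hog 1 (b * b' * (X * (X + 4)))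
    rw [ap_one, h.sym] at e5
    rw [h.sym] at e3
    rw [e5, neg_zero] at e4
    rw [map_add, map_add, LinearMap.add_apply, LinearMap.add_apply, e1, e2, e3, e4]; simp
  · intro x hx
    obtain ⟨a, ha, b, hb, rfl⟩ := Submodule.mem_sup.1 hx
    rw [map_add]
    exact Submodule.add_mem_sup (cy_inv _ _ _ ha) (cy_inv _ _ _ hb)
  · intro x hx
    obtain ⟨a, ha, b, hb, rfl⟩ := Submodule.mem_sup.1 hx
    rw [map_add]
    exact Submodule.add_mem_sup (cy_inv _ _ _ ha) (cy_inv _ _ _ hb)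
  · intro x hx
    obtain ⟨_, ⟨a, rfl⟩, _, ⟨b, rfl⟩, rfl⟩ := Submodule.mem_sup.1 hx
    change s (aeval T a v + aeval T b (s w)) ∈ _
    rw [map_add, h.commg, h.commg, h.sq, add_comm, ← ap_mul]
    exact Submodule.add_mem_sup ⟨_, rfl⟩ ⟨_, rfl⟩
  · intro x hx
    obtain ⟨_, ⟨a, rfl⟩, _, ⟨b, rfl⟩, rfl⟩ := Submodule.mem_sup.1 hx
    change s (aeval T a w + aeval T b (s v)) ∈ _
    rw [map_add, h.commg, h.commg, h.sq, add_comm, ← ap_mul]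
    exact Submodule.add_mem_sup ⟨_, rfl⟩ ⟨_, rfl⟩

/-- even R block -/
theorem Op.dqR (h : Op f T s S) {r : K[X]} (hr : Irreducible r) (hrm : r.Monic) {c : ℕ} {v : V}
    (ha : Ann T v (r ^ (2 * c))) (hn : ND f (cy T v)) :
    finrank K (cy T v) = 2 * (c * r.natDegree) ∧ dq f (cy T v) = (-1) ^ (c * r.natDegree) := by
  have hf : finrank K (cy T v) = 2 * (c * r.natDegree) := by
    rw [cy_finrank (hrm.pow _) ha, natDegree_pow]; ring
  have ha' : Ann T (aeval T (r ^ c) v) (r ^ c) := by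
    intro g
    rw [← ap_mul, ha, two_mul, pow_add]
    exact mul_dvd_mul_iff_right (pow_ne_zero _ hr.ne_zero)
  have hf' : finrank K (cy T (aeval T (r ^ c) v)) = c * r.natDegree := by
    rw [cy_finrank (hrm.pow _) ha', natDegree_pow]
  refine ⟨hf, ?_⟩
  have := dq_half f h.sym hn (W := cy T (aeval T (r ^ c) v)) ?_ ?_ (by rw [hf, hf'])
  · rw [this, hf']
  · exact cy_le (cy_inv _ _) ⟨_, rfl⟩
  · rintro _ ⟨g, rfl⟩ _ ⟨k, rfl⟩
    change f (aeval T g _) (aeval T k _) = 0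
    rw [← ap_mul, ← ap_mul, h.gk]
    rw [(ha _).2 ⟨g * k, by ring⟩]; simp
end A7

section A8
variable {K V : Type*} [Field K] [AddCommGroup V] [Module K V]

/-- homogenized polynomial -/
noncomputable def Rh (r : K[X]) : K[X] :=
  ∑ i ∈ Finset.range (r.natDegree + 1), C (r.coeff i) * ((X ^ 2 + 1) ^ i * X ^ (r.natDegree - i))

noncomputable def Rh1 (r : K[X]) : K[X] :=
  ∑ i ∈ Finset.range (r.natDegree + 1), C (r.coeff i) * ((i : K[X]) * ((X ^ 2 + 1) ^ (i - 1) * X ^ (r.natDegree - i)))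

theorem Rh_deriv (r : K[X]) :
    X * derivative (Rh r) = (r.natDegree : K[X]) * Rh r + (X ^ 2 - 1) * Rh1 r := by
  unfold Rh Rh1
  rw [derivative_sum, Finset.mul_sum, Finset.mul_sum, Finset.mul_sum, ← Finset.sum_add_distrib]
  apply Finset.sum_congr rfl
  intro i hi
  have hi' : i ≤ r.natDegree := by have := Finset.mem_range.1 hi; omega
  obtain ⟨k, hk⟩ := Nat.exists_eq_add_of_le hi'
  rw [hk, Nat.add_sub_cancel_left]
  rw [derivative_C_mul, derivative_mul, derivative_pow, derivative_X_pow]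
  simp only [derivative_add, derivative_X_pow, derivative_one, add_zero]
  rcases i with _ | i
  · rcases k with _ | k
    · simp
    · simp; ring
  · have h2 : (C 2 : K[X]) = 2 := rfl
    rcases k with _ | k
    · simp [h2]; ring
    · simp [h2]; ring

theorem Rh_natDegree_aux (r : K[X]) (hr : r.Monic) :
    (Rh r).natDegree = 2 * r.natDegree ∧ (Rh r).Monic := by
  set m := r.natDegree with hm
  have hq : (X ^ 2 + 1 : K[X]).Monic := by monicity!
  have hqd : (X ^ 2 + 1 : K[X]).natDegree = 2 := by compute_degree!
  have h1 : Rh r = (X ^ 2 + 1) ^ m + ∑ i ∈ Finset.range m, C (r.coeff i) * ((X ^ 2 + 1) ^ i * X ^ (m - i)) := by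
    unfold Rh
    rw [← hm, Finset.sum_range_succ, hm, hr.coeff_natDegree, C_1]
    simp [add_comm]
  have hP : ((X ^ 2 + 1 : K[X]) ^ m).Monic := hq.pow m
  have hPd : ((X ^ 2 + 1 : K[X]) ^ m).natDegree = 2 * m := by rw [hq.natDegree_pow, hqd, mul_comm]
  have hlt : (∑ i ∈ Finset.range m, C (r.coeff i) * ((X ^ 2 + 1) ^ i * X ^ (m - i)) : K[X]).degree <
      ((X ^ 2 + 1 : K[X]) ^ m).degree := by
    rw [degree_eq_natDegree hP.ne_zero, hPd]
    apply (degree_sum_le _ _).trans_lt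
    rw [Finset.sup_lt_iff (by exact WithBot.bot_lt_coe _)]
    intro i hi
    have := Finset.mem_range.1 hi
    have hM : ((X ^ 2 + 1) ^ i * X ^ (m - i) : K[X]).Monic := (hq.pow i).mul (monic_X_pow _)
    have hMd : ((X ^ 2 + 1) ^ i * X ^ (m - i) : K[X]).natDegree = m + i := by
      rw [(hq.pow i).natDegree_mul (monic_X_pow _), hq.natDegree_pow, hqd, natDegree_X_pow]; omega
    apply (degree_mul_le _ _).trans_lt
    rw [degree_eq_natDegree hM.ne_zero, hMd]
    have h3 : (C (r.coeff i)).degree ≤ 0 := degree_C_le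
    calc _ ≤ 0 + ((m + i : ℕ) : WithBot ℕ) := by gcongr
      _ < _ := by rw [zero_add]; exact_mod_cast (by omega)
  rw [h1]
  refine ⟨?_, hP.add_of_left hlt⟩
  rw [natDegree_add_eq_left_of_degree_lt hlt, hPd]

theorem Rh_eval {L : Type*} [Field L] [Algebra K L] (r : K[X]) {ω : L} (hω : ω ≠ 0) :
    aeval ω (Rh r) = ω ^ r.natDegree * aeval (ω + ω⁻¹) r := by
  unfold Rh
  rw [map_sum, aeval_eq_sum_range, Finset.mul_sum]
  apply Finset.sum_congr rfl
  intro i hi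
  have hi' : i ≤ r.natDegree := by have := Finset.mem_range.1 hi; omega
  obtain ⟨k, hk⟩ := Nat.exists_eq_add_of_le hi'
  rw [hk, Nat.add_sub_cancel_left]
  simp only [map_mul, aeval_C, map_pow, map_add, aeval_X, map_one, Algebra.smul_def]
  have : ω ^ 2 + 1 = ω * (ω + ω⁻¹) := by field_simp
  rw [this, mul_pow]; ring

theorem Rh1_eval {L : Type*} [Field L] [Algebra K L] (r : K[X]) {ω : L} (hω : ω ≠ 0) :
    ω * aeval ω (Rh1 r) = ω ^ r.natDegree * aeval (ω + ω⁻¹) (derivative r) := by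
  unfold Rh1
  rw [map_sum, Finset.mul_sum]
  have hr : derivative r = derivative (∑ i ∈ Finset.range (r.natDegree + 1), C (r.coeff i) * X ^ i) :=
    congrArg _ (as_sum_range_C_mul_X_pow r)
  rw [hr, derivative_sum, map_sum, Finset.mul_sum]
  apply Finset.sum_congr rfl
  intro i hi
  have hi' : i ≤ r.natDegree := by have := Finset.mem_range.1 hi; omega
  obtain ⟨k, hk⟩ := Nat.exists_eq_add_of_le hi'
  rw [hk, Nat.add_sub_cancel_left, derivative_C_mul, derivative_X_pow]
  simp only [map_mul, aeval_C, map_pow, map_add, aeval_X, map_one, map_natCast]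
  have : ω ^ 2 + 1 = ω * (ω + ω⁻¹) := by field_simp
  rw [this]
  rcases i with _ | i
  · simp
  · rw [Nat.add_sub_cancel, mul_pow]; ring

theorem root_dvd {r : K[X]} (hr : Irreducible r) (hS : ¬ r ∣ X ^ 2 - 4) {c : K} (hc : c ^ 2 = 4) :
    eval c r ≠ 0 := by
  intro h0
  have h1 : X - C c ∣ r := dvd_iff_isRoot.2 h0
  have h2 : r ∣ X - C c := (irreducible_X_sub_C c).dvd_symm hr h1
  apply hS
  refine h2.trans ⟨X + C c, ?_⟩
  have : (4 : K[X]) = C c ^ 2 := by rw [← C_pow, hc]; rfl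
  rw [this]; ring

theorem Rh_root {L : Type*} [Field L] [Algebra K L] {r : K[X]} (hr : Irreducible r) (hrm : r.Monic)
    (hS : ¬ r ∣ X ^ 2 - 4) {ω : L} (h : aeval ω (Rh r) = 0) :
    ω ≠ 0 ∧ aeval (ω + ω⁻¹) r = 0 ∧ ω ^ 2 ≠ 1 := by
  have h0 : ω ≠ 0 := by
    rintro rfl
    unfold Rh at h
    rw [map_sum, Finset.sum_range_succ, hrm.coeff_natDegree, Finset.sum_eq_zero] at h
    · simp at h
    · intro i hi
      have := Finset.mem_range.1 hi
      have : r.natDegree - i ≠ 0 := by omega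
      simp [this]
  rw [Rh_eval r h0] at h
  have h1 := (mul_eq_zero.1 h).resolve_left (pow_ne_zero _ h0)
  refine ⟨h0, h1, ?_⟩
  intro h2
  have hinv : ω⁻¹ = ω := by
    rw [pow_two] at h2; exact (eq_inv_of_mul_eq_one_left h2).symm
  rw [hinv] at h1
  have h3 : (ω - 1) * (ω + 1) = 0 := by linear_combination h2
  have hev : ∀ c : K, c ^ 2 = 4 → ω + ω = algebraMap K L c → False := by
    intro c hc hcc
    rw [hcc, aeval_algebraMap_apply] at h1
    rw [FaithfulSMul.algebraMap_eq_zero_iff] at h1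
    exact root_dvd hr hS hc (by rwa [coe_aeval_eq_eval] at h1)
  rcases mul_eq_zero.1 h3 with h3 | h3
  · apply hev 2 (by norm_num)
    rw [sub_eq_zero.1 h3, map_ofNat]; norm_num
  · apply hev (-2) (by norm_num)
    rw [eq_neg_of_add_eq_zero_left h3, map_neg, map_ofNat]; norm_num

theorem Rh_sqfree [Fintype K] {r : K[X]} (hr : Irreducible r) (hrm : r.Monic)
    (hS : ¬ r ∣ X ^ 2 - 4) {p : K[X]} (hp : Irreducible p) : ¬ p ^ 2 ∣ Rh r := by
  intro hd
  have : Fact (Irreducible p) := ⟨hp⟩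
  set ω : AdjoinRoot p := AdjoinRoot.root p
  have hpω : aeval ω p = 0 := by
    rw [AdjoinRoot.aeval_eq, AdjoinRoot.mk_self]
  obtain ⟨g, hg⟩ := hd
  have h1 : aeval ω (Rh r) = 0 := by rw [hg, map_mul, map_pow, hpω]; ring
  have h2 : aeval ω (derivative (Rh r)) = 0 := by
    rw [hg, derivative_mul, derivative_pow, map_add, map_mul, map_mul, map_mul, map_mul, map_pow, map_pow, hpω]
    simp
  obtain ⟨h3, h4, h5⟩ := Rh_root hr hrm hS h1
  have h6 := congrArg (aeval ω) (Rh_deriv r)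
  rw [map_mul, h2, map_add, map_mul, map_mul, h1] at h6
  have h7 : (ω ^ 2 - 1) * aeval ω (Rh1 r) = 0 := by
    simpa using h6.symm
  have h8 := (mul_eq_zero.1 h7).resolve_left (sub_ne_zero.2 h5)
  have h9 := Rh1_eval r h3
  rw [h8, mul_zero] at h9
  have hsep : r.Separable := (PerfectField.separable_of_irreducible hr)
  exact hsep.aeval_derivative_ne_zero h4 ((mul_eq_zero.1 h9.symm).resolve_left (pow_ne_zero _ h3))

theorem Rh_pm {r : K[X]} (hr : Irreducible r) (hrm : r.Monic)
    (hS : ¬ r ∣ X ^ 2 - 4) {η : K} (hη : η ^ 2 = 1) : ¬ (X - C η) ∣ Rh r := by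
  intro hd
  have : aeval η (Rh r) = 0 := by
    rw [coe_aeval_eq_eval]; exact dvd_iff_isRoot.1 hd
  exact (Rh_root hr hrm hS this).2.2 hη
end A8

section A9
variable {K V : Type*} [Field K] [AddCommGroup V] [Module K V]
variable {f : LinearMap.BilinForm K V} {φ φi : Module.End K V}

structure Ctx (f : LinearMap.BilinForm K V) (φ φi : Module.End K V) : Prop where
  two : (2 : K) ≠ 0
  sym : ∀ x y, f x y = f y x
  iso : ∀ x y, f (φ x) (φ y) = f x y
  l : ∀ x, φ (φi x) = x
  r : ∀ x, φi (φ x) = x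

/-- the operator z -/
def zz (φ φi : Module.End K V) (η : K) : Module.End K V := η • (φ + φi) - (2 : K) • 1

theorem zz_apply (η : K) (x : V) : zz φ φi η x = η • (φ x + φi x) - (2 : K) • x := rfl

theorem Ctx.adj (h : Ctx f φ φi) (x y : V) : f (φ x) y = f x (φi y) := by
  rw [← h.iso x (φi y), h.l]

theorem Ctx.adj' (h : Ctx f φ φi) (x y : V) : f (φi x) y = f x (φ y) := by
  rw [← h.iso (φi x) y, h.l]

theorem Ctx.opR (h : Ctx f φ φi) : Op f (φ + φi) (φ - φi) (X ^ 2 - 4) := by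
  refine ⟨h.two, h.sym, ?_, ?_, ?_, ?_⟩
  · intro x y
    simp only [LinearMap.add_apply, map_add]
    rw [h.adj, h.adj']; ring
  · intro x y
    simp only [LinearMap.sub_apply, map_sub]
    rw [h.adj, h.adj']; ring
  · intro x
    simp only [LinearMap.add_apply, LinearMap.sub_apply, map_add, map_sub, h.l, h.r]
    abel
  · intro x
    rw [ap_sub, pow_two, ap_mul, ap_X, ap_X, show (4 : K[X]) = C 4 from rfl, ap_C]
    simp only [LinearMap.add_apply, LinearMap.sub_apply, map_add, map_sub, h.l, h.r]
    module

theorem Ctx.opT (h : Ctx f φ φi) {η : K} (hη : η ^ 2 = 1) : Op f (zz φ φi η) (φ - φi) (X * (X + 4)) := by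
  have hR := h.opR
  refine ⟨h.two, h.sym, ?_, hR.anti, ?_, ?_⟩
  · intro x y
    simp only [zz_apply, map_add, map_sub, map_smul, LinearMap.sub_apply, LinearMap.smul_apply, LinearMap.add_apply]
    rw [h.adj, h.adj']; ring
  · intro x
    simp only [zz_apply, LinearMap.sub_apply, map_add, map_sub, map_smul, h.l, h.r]
    module
  · intro x
    rw [ap_mul, ap_X, ap_add, ap_X, show (4 : K[X]) = C 4 from rfl, ap_C]
    simp only [zz_apply, LinearMap.sub_apply, map_add, map_sub, map_smul, h.l, h.r, smul_add, smul_sub, smul_smul]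
    rw [← pow_two, hη]
    module

theorem Ctx.inv_of (h : Ctx f φ φi) {U : Submodule K V} (h1 : Invt (φ + φi) U) (h2 : ∀ x ∈ U, (φ - φi) x ∈ U) :
    Invt φ U ∧ Invt φi U := by
  constructor
  · intro x hx
    have := U.smul_mem (2 : K)⁻¹ (U.add_mem (h1 x hx) (h2 x hx))
    rw [← LinearMap.add_apply, show (φ + φi + (φ - φi)) = (2 : K) • φ by rw [two_smul]; abel,
      LinearMap.smul_apply, smul_smul, inv_mul_cancel₀ h.two, one_smul] at this
    exact this
  · intro x hx
    have := U.smul_mem (2 : K)⁻¹ (U.sub_mem (h1 x hx) (h2 x hx))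
    rw [← LinearMap.sub_apply, show (φ + φi - (φ - φi)) = (2 : K) • φi by rw [two_smul]; abel,
      LinearMap.smul_apply, smul_smul, inv_mul_cancel₀ h.two, one_smul] at this
    exact this

theorem inv_t {U : Submodule K V} (h1 : Invt φ U) (h2 : Invt φi U) : Invt (φ + φi) U :=
  fun x hx => U.add_mem (h1 x hx) (h2 x hx)
theorem inv_s {U : Submodule K V} (h1 : Invt φ U) (h2 : Invt φi U) : Invt (φ - φi) U :=
  fun x hx => U.sub_mem (h1 x hx) (h2 x hx)
theorem inv_z {U : Submodule K V} (η : K) (h : Invt (φ + φi) U) : Invt (zz φ φi η) U :=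
  fun x hx => U.sub_mem (U.smul_mem _ (h x hx)) (U.smul_mem _ hx)
theorem t_of_z {η : K} (hη : η ^ 2 = 1) (x : V) :
    (φ + φi) x = η • (zz φ φi η x + (2 : K) • x) := by
  rw [zz_apply, sub_add_cancel, smul_smul, ← pow_two, hη, one_smul]; rfl
theorem inv_tz {U : Submodule K V} {η : K} (hη : η ^ 2 = 1) (h : Invt (zz φ φi η) U) : Invt (φ + φi) U :=
  fun x hx => by
    rw [t_of_z hη]
    exact U.smul_mem _ (U.add_mem (h x hx) (U.smul_mem _ hx))

/-- z blocks are t blocks -/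
theorem Blk.toT {P M : Submodule K V} {η : K} (hη : η ^ 2 = 1)
    (h : Blk f (zz φ φi η) (φ - φi) P M) : Blk f (φ + φi) (φ - φi) P M :=
  ⟨h.ndP, h.ndM, h.orth, inv_tz hη h.TP, inv_tz hη h.TM, h.sP, h.sM⟩

theorem Blk.inv (hc : Ctx f φ φi) {P M : Submodule K V} (h : Blk f (φ + φi) (φ - φi) P M) :
    Invt φ (P ⊔ M) ∧ Invt φi (P ⊔ M) := by
  apply hc.inv_of
  · intro x hx
    obtain ⟨a, ha, b, hb, rfl⟩ := Submodule.mem_sup.1 hx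
    rw [map_add]
    exact Submodule.add_mem_sup (h.TP _ ha) (h.TM _ hb)
  · intro x hx
    obtain ⟨a, ha, b, hb, rfl⟩ := Submodule.mem_sup.1 hx
    rw [map_add, add_comm]
    exact Submodule.add_mem_sup (h.sM _ hb) (h.sP _ ha)

section FD
variable [FiniteDimensional K V]

theorem Ctx.inv_i (h : Ctx f φ φi) {U : Submodule K V} (hU : Invt φ U) : Invt φi U := by
  intro x hx
  have hinj : Function.Injective (φ.restrict hU) := by
    intro a b hab
    have : φ a = φ b := congrArg Subtype.val hab
    have h2 := congrArg φi this
    rw [h.r, h.r] at h2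
    exact Subtype.ext h2
  obtain ⟨y, hy⟩ := (LinearMap.injective_iff_surjective.1 hinj) ⟨x, hx⟩
  have h3 : φ y = x := congrArg Subtype.val hy
  rw [← h3, h.r]; exact y.2

omit [FiniteDimensional K V] in
theorem Ctx.inv_perp (h : Ctx f φ φi) {U : Submodule K V} (hU : Invt φi U) : Invt φ (perp f U) := by
  intro x hx u hu
  rw [h.sym, h.adj, h.sym]
  exact hx _ (hU u hu)

theorem Blk.nd (hc : Ctx f φ φi) {P M : Submodule K V} (h : Blk f (φ + φi) (φ - φi) P M) : ND f (P ⊔ M) :=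
  nd_sup f hc.sym h.ndP h.ndM h.orth

/-- cyclic block -/
theorem Ctx.cyc_eq (h : Ctx f φ φi) {v : V} (hb : Blk f (φ + φi) (φ - φi) (cy (φ + φi) v) (cy (φ + φi) ((φ - φi) v))) :
    cy (φ + φi) v ⊔ cy (φ + φi) ((φ - φi) v) = cy φ v := by
  have hi := cy_inv φ v
  have hi' := h.inv_i hi
  apply le_antisymm
  · apply sup_le
    · exact cy_le (inv_t hi hi') (self_mem_cy _ _)
    · exact cy_le (inv_t hi hi') (inv_s hi hi' _ (self_mem_cy _ _))
  · exact cy_le (hb.inv h).1 (Submodule.mem_sup_left (self_mem_cy _ _))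
end FD

theorem cy_z {η : K} (hη : η ^ 2 = 1) (v : V) : cy (zz φ φi η) v = cy (φ + φi) v := by
  apply le_antisymm
  · exact cy_le (inv_z η (cy_inv _ _)) (self_mem_cy _ _)
  · exact cy_le (inv_tz hη (cy_inv _ _)) (self_mem_cy _ _)

/-! killing -/
theorem Ctx.kz (h : Ctx f φ φi) {η : K} (hη : η ^ 2 = 1) (x : V) :
    aeval φ ((X - C η) ^ 2) x = η • φ (zz φ φi η x) := by
  rw [pow_two, ap_mul, ap_sub, ap_sub, ap_X, ap_X, ap_C, ap_C]
  simp only [zz_apply, map_sub, map_smul, map_add, h.l, smul_sub, smul_add, smul_smul]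
  rw [← pow_two, hη]
  module

theorem Ctx.kill (h : Ctx f φ φi) {η : K} (hη : η ^ 2 = 1) (k : ℕ) (x : V) (hx : (zz φ φi η ^ k) x = 0) :
    aeval φ ((X - C η) ^ (2 * k)) x = 0 := by
  induction k generalizing x with
  | zero => simpa using hx
  | succ k ih =>
    rw [mul_add, mul_one, pow_add, ap_mul, h.kz hη, map_smul]
    have h1 := ih (zz φ φi η x) (by rw [pow_succ] at hx; exact hx)
    have h2 := ap_comm φ ((X - C η) ^ (2 * k)) X (zz φ φi η x)
    rw [ap_X, ap_X, h1, map_zero] at h2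
    rw [h2, smul_zero]

theorem Ctx.kill3 (h : Ctx f φ φi) {η : K} (hη : η ^ 2 = 1) (e : ℕ) (v : V) (hx : (zz φ φi η ^ (e + 1)) v = 0)
    (hs : (zz φ φi η ^ e) ((φ - φi) v) = 0) : aeval φ ((X - C η) ^ (2 * e + 1)) v = 0 := by
  rw [pow_succ, ap_mul]
  apply h.kill hη
  rw [ap_sub, ap_X, ap_C]
  have h1 : φ v - η • v = (2 : K)⁻¹ • ((φ - φi) v + η • zz φ φi η v) := by
    rw [eq_inv_smul_iff₀ h.two, zz_apply]
    simp only [smul_sub, smul_add, smul_smul, LinearMap.sub_apply]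
    rw [← pow_two, hη]
    module
  rw [h1, map_smul, map_add, hs, map_smul]
  rw [pow_succ] at hx
  change (zz φ φi η ^ e) (zz φ φi η v) = 0 at hx
  rw [hx]; simp

theorem Ctx.Rh_ap (h : Ctx f φ φi) (r : K[X]) (x : V) :
    aeval φ (Rh r) x = (φ ^ r.natDegree) (aeval (φ + φi) r x) := by
  unfold Rh
  rw [map_sum, LinearMap.sum_apply, aeval_eq_sum_range, LinearMap.sum_apply, map_sum]
  apply Finset.sum_congr rfl
  intro i hi
  have hi' : i ≤ r.natDegree := by have := Finset.mem_range.1 hi; omega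
  obtain ⟨k, hk⟩ := Nat.exists_eq_add_of_le hi'
  rw [hk, Nat.add_sub_cancel_left, ap_mul, ap_C, LinearMap.smul_apply, map_smul]
  congr 1
  rw [add_comm i k, pow_add, mul_comm, ap_mul, ap_Xp]
  change _ = (φ ^ k) ((φ ^ i) _)
  congr 1
  clear hk hi hi'
  induction i generalizing x with
  | zero => simp
  | succ i ih =>
    rw [pow_succ (X ^ 2 + 1 : K[X]) i, ap_mul, ih, pow_succ φ i, pow_succ (φ + φi) i]
    change _ = (φ ^ i) (φ (((φ + φi) ^ i) ((φ + φi) x)))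
    congr 1
    have h2 : aeval φ (X ^ 2 + 1 : K[X]) x = φ ((φ + φi) x) := by
      rw [ap_add, ap_one, ap_Xp, LinearMap.add_apply, map_add, h.l, pow_two]; rfl
    rw [h2]
    have hc : Commute ((φ + φi) ^ i) φ := by
      apply Commute.pow_left
      apply Commute.add_left (Commute.refl _)
      ext y
      change φi (φ y) = φ (φi y)
      rw [h.l, h.r]
    exact LinearMap.congr_fun hc _

theorem Ctx.killR (h : Ctx f φ φi) (r : K[X]) (k : ℕ) (x : V) (hx : aeval (φ + φi) (r ^ k) x = 0) :
    aeval φ (Rh r ^ k) x = 0 := by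
  induction k generalizing x with
  | zero => simpa using hx
  | succ k ih =>
    rw [pow_succ, ap_mul, h.Rh_ap, ← ap_Xp, ap_comm]
    rw [ih _ (by rw [← ap_mul, ← pow_succ]; exact hx), map_zero]
end A9

section A10
variable {K V : Type*} [Field K] [AddCommGroup V] [Module K V]
variable {f : LinearMap.BilinForm K V} {φ φi : Module.End K V}

theorem Mz_pow {T : Module.End K V} {v : V} {p Q : K[X]} {D : ℕ} (hp : Irreducible p) (hpm : p.Monic)
    (hQ : Q.Monic) (h : Ann T v (Q ^ D)) : ∃ a, p ^ a ∣ Q ∧ (p ∣ Q → a ≠ 0) ∧ ∀ d, 1 ≤ d →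
      Mz T p (cy T v) d = if d = a * D then (p.natDegree : ℤ) else 0 := by
  obtain ⟨Q', h1, h2⟩ := (FiniteMultiplicity.of_not_isUnit hp.not_isUnit hQ.ne_zero).exists_eq_pow_mul_and_not_dvd
  set a := multiplicity p Q
  have hQ' : Q' ≠ 0 := by rintro rfl; exact h2 (dvd_zero _)
  refine ⟨a, ⟨Q', h1⟩, ?_, fun d hd => ?_⟩
  · intro hd ha
    rw [ha, pow_zero, one_mul] at h1
    exact h2 (h1 ▸ hd)
  · rw [h1, mul_pow, ← pow_mul] at h
    exact Mz_cy hp hpm (fun hh => h2 (hp.prime.dvd_of_dvd_pow hh)) h (pow_ne_zero _ hQ') hd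

/-- kinds of blocks -/
inductive Kd (f : LinearMap.BilinForm K V) (φ φi : Module.End K V) : Submodule K V → Submodule K V → Prop
  | R (r : K[X]) (D : ℕ) (v : V) (hr : Irreducible r) (hm : r.Monic) (hS : ¬ r ∣ X ^ 2 - 4) (hD : 1 ≤ D)
    (h0 : aeval (φ + φi) (r ^ D) v = 0) (h1 : f (aeval (φ + φi) (r ^ (D - 1)) v) v ≠ 0) :
    Kd f φ φi (cy (φ + φi) v) (cy (φ + φi) ((φ - φi) v))
  | T3 (η : K) (hη : η ^ 2 = 1) (e : ℕ) (v : V) (h0 : (zz φ φi η ^ (e + 1)) v = 0)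
    (h0' : (zz φ φi η ^ e) ((φ - φi) v) = 0) (h1 : f ((zz φ φi η ^ e) v) v ≠ 0) :
    Kd f φ φi (cy (zz φ φi η) v) (cy (zz φ φi η) ((φ - φi) v))
  | T4 (η : K) (hη : η ^ 2 = 1) (D : ℕ) (v w : V) (hD : 1 ≤ D) (hv : (zz φ φi η ^ D) v = 0) (hw : (zz φ φi η ^ D) w = 0)
    (h1 : f ((zz φ φi η ^ (D - 1)) ((φ - φi) v)) w ≠ 0) (ho : ∀ k, f ((zz φ φi η ^ k) v) w = 0) :
    Kd f φ φi (cy (zz φ φi η) v ⊔ cy (zz φ φi η) ((φ - φi) w)) (cy (zz φ φi η) w ⊔ cy (zz φ φi η) ((φ - φi) v))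

theorem ir_lin (c : K) : Irreducible (X - C c) ∧ (X - C c).Monic ∧ (X - C c).natDegree = 1 :=
  ⟨irreducible_X_sub_C c, monic_X_sub_C c, natDegree_X_sub_C c⟩

/-- generalized part away from plus minus one -/
noncomputable def bz (φ : Module.End K V) (U : Submodule K V) : ℤ :=
  finrank K U - finrank K (LinearMap.ker (aeval φ ((X ^ 2 - 1) ^ finrank K V : K[X])) ⊓ U : Submodule K V)

variable [FiniteDimensional K V]

theorem bz_sup {A B : Submodule K V} (hA : Invt φ A) (hB : Invt φ B) (hd : Disjoint A B) :
    bz φ (A ⊔ B) = bz φ A + bz φ B := by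
  unfold bz
  rw [ker_sup hA hB hd, finrank_sup_disj hd]; push_cast; ring

theorem bz_bot : bz φ ⊥ = 0 := by
  unfold bz
  rw [inf_bot_eq, sub_self]

theorem bz_cop {v : V} {Q : K[X]} (h : Ann φ v Q) (hc : IsCoprime Q (X ^ 2 - 1)) :
    bz φ (cy φ v) = finrank K (cy φ v) := by
  have : LinearMap.ker (aeval φ ((X ^ 2 - 1) ^ finrank K V : K[X])) ⊓ cy φ v = ⊥ := by
    rw [eq_bot_iff]
    rintro x ⟨h1, g, rfl⟩
    change aeval φ _ (aeval φ g v) = 0 at h1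
    change aeval φ g v = 0
    rw [← ap_mul, h] at h1
    rw [h]
    exact hc.pow_right.dvd_of_dvd_mul_left h1
  unfold bz
  rw [this, finrank_bot]; simp

theorem bz_kill {A : Submodule K V} {η : K} (hη : η ^ 2 = 1) (k : ℕ) (hk : k ≤ finrank K V)
    (h : ∀ x ∈ A, aeval φ ((X - C η) ^ k) x = 0) : bz φ A = 0 := by
  have : LinearMap.ker (aeval φ ((X ^ 2 - 1) ^ finrank K V : K[X])) ⊓ A = A := by
    rw [inf_eq_right]
    intro x hx
    have hd : (X - C η) ^ k ∣ ((X ^ 2 - 1) ^ finrank K V : K[X]) := by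
      refine (pow_dvd_pow_of_dvd ?_ k).trans (pow_dvd_pow _ hk)
      rw [dvd_iff_isRoot]
      simp [hη]
    obtain ⟨c, hc⟩ := hd
    rw [LinearMap.mem_ker, hc, mul_comm, ap_mul, h x hx, map_zero]
  unfold bz
  rw [this, sub_self]

theorem cy_kill {v : V} {g : K[X]} (h : aeval φ g v = 0) : ∀ x ∈ cy φ v, aeval φ g x = 0 := by
  rintro x ⟨k, rfl⟩
  change aeval φ g (aeval φ k v) = 0
  rw [ap_comm, h, map_zero]

/-- description as phi-modules -/
inductive Ds (f : LinearMap.BilinForm K V) (φ : Module.End K V) : Submodule K V → Prop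
  | R (r : K[X]) (D : ℕ) (v : V) (hr : Irreducible r) (hm : r.Monic) (hS : ¬ r ∣ X ^ 2 - 4) (hD : 1 ≤ D)
    (h : Ann φ v (Rh r ^ D)) : Ds f φ (cy φ v)
  | T3 (η : K) (hη : η ^ 2 = 1) (e : ℕ) (v : V) (h : Ann φ v ((X - C η) ^ (2 * e + 1))) : Ds f φ (cy φ v)
  | T4 (η : K) (hη : η ^ 2 = 1) (D : ℕ) (v w : V) (hD : 1 ≤ D) (h : Ann φ v ((X - C η) ^ (2 * D)))
    (h' : Ann φ w ((X - C η) ^ (2 * D))) (hd : Disjoint (cy φ v) (cy φ w)) : Ds f φ (cy φ v ⊔ cy φ w)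

variable [Fintype K] [hK : Fact (Fintype.card K % 4 = 3)]

theorem Ctx.R_ann (h : Ctx f φ φi) {r : K[X]} {D : ℕ} {v : V} (hr : Irreducible r) (hm : r.Monic) (hS : ¬ r ∣ X ^ 2 - 4)
    (h0 : aeval (φ + φi) (r ^ D) v = 0) (h1 : D ≠ 0 → ∃ k, f (aeval (φ + φi) (k * r ^ (D - 1)) v) v ≠ 0) :
    Blk f (φ + φi) (φ - φi) (cy (φ + φi) v) (cy (φ + φi) ((φ - φi) v)) ∧
    cy (φ + φi) v ⊔ cy (φ + φi) ((φ - φi) v) = cy φ v ∧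
    finrank K (cy (φ + φi) v) = D * r.natDegree ∧ finrank K (cy (φ + φi) ((φ - φi) v)) = D * r.natDegree ∧
    Ann φ v (Rh r ^ D) ∧ Ann (φ + φi) v (r ^ D) ∧ Ann (φ + φi) ((φ - φi) v) (r ^ D) := by
  obtain ⟨hb, a1, a2⟩ := h.opR.blkR hr hS h0 h1
  have f1 := cy_finrank (hm.pow D) a1
  have f2 := cy_finrank (hm.pow D) a2
  rw [natDegree_pow] at f1 f2
  have he := h.cyc_eq hb
  obtain ⟨d1, d2⟩ := Rh_natDegree_aux r hm
  refine ⟨hb, he, f1, f2, ann_of_finrank (d2.pow D) (h.killR r D v h0) ?_, a1, a2⟩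
  rw [← he, finrank_sup_disj (hb.disj h.sym), f1, f2, natDegree_pow, d1]; ring

theorem Ctx.T4_ann (h : Ctx f φ φi) {η : K} (hη : η ^ 2 = 1) {D : ℕ} {v w : V} (hv : (zz φ φi η ^ D) v = 0)
    (hw : (zz φ φi η ^ D) w = 0) (h1 : f ((zz φ φi η ^ (D - 1)) ((φ - φi) v)) w ≠ 0)
    (ho : ∀ k, f ((zz φ φi η ^ k) v) w = 0) :
    Blk f (φ + φi) (φ - φi) (cy (zz φ φi η) v ⊔ cy (zz φ φi η) ((φ - φi) w)) (cy (zz φ φi η) w ⊔ cy (zz φ φi η) ((φ - φi) v)) ∧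
    cy (zz φ φi η) v ⊔ cy (zz φ φi η) ((φ - φi) w) ⊔ (cy (zz φ φi η) w ⊔ cy (zz φ φi η) ((φ - φi) v)) = cy φ v ⊔ cy φ w ∧
    Ann φ v ((X - C η) ^ (2 * D)) ∧ Ann φ w ((X - C η) ^ (2 * D)) ∧ Disjoint (cy φ v) (cy φ w) := by
  obtain ⟨hb, f1, f2, _, _⟩ := (h.opT hη).blk4 hv hw h1 ho
  have hb' := hb.toT hη
  rw [cy_z hη, cy_z hη] at f1 f2
  simp only [cy_z hη] at hb' ⊢
  have he : cy (φ + φi) v ⊔ cy (φ + φi) ((φ - φi) w) ⊔ (cy (φ + φi) w ⊔ cy (φ + φi) ((φ - φi) v)) =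
      cy φ v ⊔ cy φ w := by
    apply le_antisymm
    · have hi := cy_inv φ v
      have hi' := h.inv_i hi
      have hj := cy_inv φ w
      have hj' := h.inv_i hj
      refine sup_le (sup_le ?_ ?_) (sup_le ?_ ?_)
      · exact (cy_le (inv_t hi hi') (self_mem_cy _ _)).trans le_sup_left
      · exact (cy_le (inv_t hj hj') (inv_s hj hj' _ (self_mem_cy _ _))).trans le_sup_right
      · exact (cy_le (inv_t hj hj') (self_mem_cy _ _)).trans le_sup_right
      · exact (cy_le (inv_t hi hi') (inv_s hi hi' _ (self_mem_cy _ _))).trans le_sup_left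
    · refine sup_le (cy_le (hb'.inv h).1 ?_) (cy_le (hb'.inv h).1 ?_)
      · exact Submodule.mem_sup_left (Submodule.mem_sup_left (self_mem_cy _ _))
      · exact Submodule.mem_sup_right (Submodule.mem_sup_left (self_mem_cy _ _))
  refine ⟨hb', he, ?_⟩
  have hf : finrank K (cy φ v ⊔ cy φ w : Submodule K V) = 4 * D := by
    rw [← he, finrank_sup_disj (hb'.disj h.sym), f1, f2]; ring
  have hmo := (ir_lin η).2.1.pow (2 * D)
  have hnd : ((X - C η) ^ (2 * D)).natDegree = 2 * D := by rw [natDegree_pow, (ir_lin η).2.2, mul_one]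
  have l1 := cy_finrank_le hmo (h.kill hη D v hv)
  have l2 := cy_finrank_le hmo (h.kill hη D w hw)
  have l3 := Submodule.finrank_sup_add_finrank_inf_eq (cy φ v) (cy φ w)
  rw [hnd] at l1 l2
  refine ⟨ann_of_finrank hmo (h.kill hη D v hv) (by omega),
    ann_of_finrank hmo (h.kill hη D w hw) (by omega), ?_⟩
  rw [disjoint_iff, ← Submodule.finrank_eq_zero (R := K)]
  omega

theorem Ctx.T3_ann (h : Ctx f φ φi) {η : K} (hη : η ^ 2 = 1) {e : ℕ} {v : V} (h0 : (zz φ φi η ^ (e + 1)) v = 0)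
    (h0' : (zz φ φi η ^ e) ((φ - φi) v) = 0) (h1 : f ((zz φ φi η ^ e) v) v ≠ 0) :
    Blk f (φ + φi) (φ - φi) (cy (zz φ φi η) v) (cy (zz φ φi η) ((φ - φi) v)) ∧
    cy (zz φ φi η) v ⊔ cy (zz φ φi η) ((φ - φi) v) = cy φ v ∧ Ann φ v ((X - C η) ^ (2 * e + 1)) := by
  obtain ⟨hb, f1, f2, _, _⟩ := (h.opT hη).dq3 h0 h0' h1
  have hb' := hb.toT hη
  rw [cy_z hη, cy_z hη] at *
  have he := h.cyc_eq hb'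
  refine ⟨hb', he, ann_of_finrank ((ir_lin η).2.1.pow _) (h.kill3 hη e v h0 h0') ?_⟩
  rw [← he, finrank_sup_disj (hb'.disj h.sym), f1, f2, natDegree_pow, (ir_lin η).2.2]; ring

theorem Kd.ds (h : Ctx f φ φi) {P M : Submodule K V} (k : Kd f φ φi P M) :
    Blk f (φ + φi) (φ - φi) P M ∧ Ds f φ (P ⊔ M) := by
  cases k with
  | R r D v hr hm hS hD h0 h1 =>
    obtain ⟨hb, he, _, _, ha, _, _⟩ := h.R_ann hr hm hS h0 (fun _ => ⟨1, by rw [one_mul]; exact h1⟩)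
    exact ⟨hb, he ▸ Ds.R r D v hr hm hS hD ha⟩
  | T3 η hη e v h0 h0' h1 =>
    obtain ⟨hb, he, ha⟩ := h.T3_ann hη h0 h0' h1
    exact ⟨hb, he ▸ Ds.T3 η hη e v ha⟩
  | T4 η hη D v w hD hv hw h1 ho =>
    obtain ⟨hb, he, a1, a2, hd⟩ := h.T4_ann hη hv hw h1 ho
    exact ⟨hb, he ▸ Ds.T4 η hη D v w hD a1 a2 hd⟩

theorem Ds.mult {A : Submodule K V} (k : Ds f φ A) {p : K[X]} (hp : Irreducible p) (hpm : p.Monic) {d : ℕ} (hd : 1 ≤ d) :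
    ∃ k : ℕ, Mz φ p A d = k * p.natDegree := by
  have key : ∀ {v : V} {Q : K[X]} {D : ℕ}, Q.Monic → Ann φ v (Q ^ D) → ∃ k : ℕ, Mz φ p (cy φ v) d = k * p.natDegree := by
    intro v Q D hQ ha
    obtain ⟨a, _, _, h⟩ := Mz_pow hp hpm hQ ha
    rw [h d hd]
    split_ifs
    · exact ⟨1, by simp⟩
    · exact ⟨0, by simp⟩
  cases k with
  | R r D v hr hm hS hD h => exact key (Rh_natDegree_aux r hm).2 h
  | T3 η hη e v h => exact key (ir_lin η).2.1 h
  | T4 η hη D v w hD h h' hdj =>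
    obtain ⟨a, ha⟩ := key (ir_lin η).2.1 h
    obtain ⟨b, hb⟩ := key (ir_lin η).2.1 h'
    exact ⟨a + b, by rw [Mz_sup (cy_inv _ _) (cy_inv _ _) hdj, ha, hb]; push_cast; ring⟩

open Classical in
theorem Mz_lin {η μ : K} {n : ℕ} {v : V} (h : Ann φ v ((X - C η) ^ n)) {d : ℕ} (hd : 1 ≤ d) :
    Mz φ (X - C μ) (cy φ v) d = if μ = η ∧ d = n then 1 else 0 := by
  obtain ⟨i1, i2, i3⟩ := ir_lin μ
  by_cases hm : μ = η
  · subst hm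
    rw [Mz_cy (e := n) (Q' := 1) i1 i2 (fun hh => i1.not_isUnit (isUnit_of_dvd_one hh)) (by rwa [mul_one])
      one_ne_zero hd, i3]
    simp
  · rw [Mz_cy (e := 0) (Q' := (X - C η) ^ n) i1 i2 ?_ (by rwa [pow_zero, one_mul])
      (((ir_lin η).2.1.pow n).ne_zero) hd, i3, if_neg (by omega), if_neg (by tauto)]
    intro hh
    have := i1.prime.dvd_of_dvd_pow hh
    rw [dvd_iff_isRoot] at this
    simp [sub_eq_zero] at this
    exact hm this

theorem Mz_linR {r : K[X]} {D : ℕ} {μ : K} {v : V} (hμ : μ ^ 2 = 1) (hr : Irreducible r) (hm : r.Monic)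
    (hS : ¬ r ∣ X ^ 2 - 4) (h : Ann φ v (Rh r ^ D)) {d : ℕ} (hd : 1 ≤ d) : Mz φ (X - C μ) (cy φ v) d = 0 := by
  obtain ⟨i1, i2, i3⟩ := ir_lin μ
  rw [Mz_cy (e := 0) (Q' := Rh r ^ D) i1 i2 ?_ (by rwa [pow_zero, one_mul])
      (((Rh_natDegree_aux r hm).2.pow D).ne_zero) hd, if_neg (by omega)]
  intro hh
  exact Rh_pm hr hm hS hμ (i1.prime.dvd_of_dvd_pow hh)

/-- odd R block gives elementary divisor -/
theorem R_odd {r : K[X]} {D : ℕ} {v : V} (hr : Irreducible r) (hm : r.Monic)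
    (hS : ¬ r ∣ X ^ 2 - 4) (h : Ann φ v (Rh r ^ D)) (hD : 1 ≤ D) : ∃ p : K[X], Irreducible p ∧ p.Monic ∧
      p ≠ X - C 1 ∧ p ≠ X - C (-1) ∧ Mz φ p (cy φ v) D = p.natDegree := by
  obtain ⟨d1, d2⟩ := Rh_natDegree_aux r hm
  have hnu : ¬ IsUnit (Rh r) := by
    intro hu
    have h1 := natDegree_eq_zero_of_isUnit hu
    have h2 := hr.natDegree_pos
    omega
  obtain ⟨p, p2, p1, p3⟩ := exists_monic_irreducible_factor (Rh r) hnu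
  refine ⟨p, p1, p2, ?_, ?_, ?_⟩
  · rintro rfl
    exact Rh_pm hr hm hS (η := 1) (by ring) p3
  · rintro rfl
    exact Rh_pm hr hm hS (η := -1) (by ring) p3
  · obtain ⟨a, a1, a2, a3⟩ := Mz_pow p1 p2 d2 h
    have h1 := a2 p3
    have h2 : a < 2 := by
      by_contra hlt
      exact Rh_sqfree hr hm hS p1 ((pow_dvd_pow p (by omega)).trans a1)
    rw [a3 D hD, if_pos]
    rw [show a = 1 by omega, one_mul]

/-- even R blocks and T blocks give no such divisor -/
theorem Mz_even {Q : K[X]} {D d : ℕ} {v : V} (hQ : Q.Monic) (h : Ann φ v (Q ^ D)) (hD : Even D) (hd : Odd d)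
    {p : K[X]} (hp : Irreducible p) (hpm : p.Monic) : Mz φ p (cy φ v) d = 0 := by
  obtain ⟨a, _, _, h⟩ := Mz_pow hp hpm hQ h
  rw [h d hd.pos, if_neg]
  rintro rfl
  exact (Nat.not_odd_iff_even.2 (hD.mul_left a)) hd

theorem Kd.not1 (h : Ctx f φ φi) {P M : Submodule K V} (k : Kd f φ φi P M) {p : K[X]} (hp : Irreducible p) (hpm : p.Monic)
    (h1 : p ≠ X - C 1) (h2 : p ≠ X - C (-1)) {d : ℕ} (hd : Odd d) (hne : Mz φ p (P ⊔ M) d ≠ 0) :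
    ∃ (r : K[X]) (D : ℕ) (v : V), Irreducible r ∧ r.Monic ∧ ¬ r ∣ X ^ 2 - 4 ∧ Odd D ∧ aeval (φ + φi) (r ^ D) v = 0 ∧
      f (aeval (φ + φi) (r ^ (D - 1)) v) v ≠ 0 ∧ P = cy (φ + φi) v ∧ M = cy (φ + φi) ((φ - φi) v) := by
  have key : ∀ {η : K} (hη : η ^ 2 = 1) {v : V} {n : ℕ}, Ann φ v ((X - C η) ^ n) → Mz φ p (cy φ v) d = 0 := by
    intro η hη v n ha
    obtain ⟨a, a1, _, a3⟩ := Mz_pow hp hpm (ir_lin η).2.1 ha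
    rw [a3 d hd.pos, if_neg]
    rintro rfl
    have ha0 : a ≠ 0 := by rintro rfl; simp at hd
    have : p ∣ X - C η := (dvd_pow_self p ha0).trans a1
    have := eq_of_monic_of_associated hpm (ir_lin η).2.1 (hp.associated_of_dvd (ir_lin η).1 this)
    rcases sq_eq_one_iff.1 hη with rfl | rfl
    · exact h1 this
    · exact h2 this
  cases k with
  | R r D v hr hm hS hD h0 h1 =>
    obtain ⟨hb, he, _, _, ha, _, _⟩ := h.R_ann hr hm hS h0 (fun _ => ⟨1, by rw [one_mul]; exact h1⟩)
    refine ⟨r, D, v, hr, hm, hS, ?_, h0, h1, rfl, rfl⟩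
    by_contra ho
    rw [he] at hne
    exact hne (Mz_even (Rh_natDegree_aux r hm).2 ha (Nat.not_odd_iff_even.1 ho) hd hp hpm)
  | T3 η hη e v h0 h0' h1 =>
    obtain ⟨hb, he, ha⟩ := h.T3_ann hη h0 h0' h1
    rw [he] at hne
    exact absurd (key hη ha) hne
  | T4 η hη D v w hD hv hw h1 ho =>
    obtain ⟨hb, he, a1, a2, hdj⟩ := h.T4_ann hη hv hw h1 ho
    rw [he, Mz_sup (cy_inv _ _) (cy_inv _ _) hdj, key hη a1, key hη a2] at hne
    exact absurd rfl hne

/-- presence of odd blocks -/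
def NoT (φ : Module.End K V) (U : Submodule K V) : Prop := ∀ μ : K, μ ^ 2 = 1 → ∀ d, Odd d → Mz φ (X - C μ) U d = 0

theorem Kd.noT (h : Ctx f φ φi) {P M : Submodule K V} (k : Kd f φ φi P M) :
    (Odd (finrank K (P ⊔ M : Submodule K V)) ∧ ¬ NoT φ (P ⊔ M)) ∨ (NoT φ (P ⊔ M) ∧ finrank K P = finrank K M) := by
  cases k with
  | R r D v hr hm hS hD h0 h1 =>
    obtain ⟨hb, he, f1, f2, ha, _, _⟩ := h.R_ann hr hm hS h0 (fun _ => ⟨1, by rw [one_mul]; exact h1⟩)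
    refine Or.inr ⟨fun μ hμ d hd => ?_, by rw [f1, f2]⟩
    rw [he, Mz_linR hμ hr hm hS ha hd.pos]
  | T3 η hη e v h0 h0' h1 =>
    obtain ⟨hb, he, ha⟩ := h.T3_ann hη h0 h0' h1
    rw [he]
    refine Or.inl ⟨?_, fun hh => ?_⟩
    · rw [cy_finrank ((ir_lin η).2.1.pow _) ha, natDegree_pow, (ir_lin η).2.2, mul_one]; exact ⟨e, rfl⟩
    · have := hh η hη (2 * e + 1) ⟨e, rfl⟩
      rw [Mz_lin ha (by omega)] at this
      simp at this
  | T4 η hη D v w hD hv hw h1 ho =>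
    obtain ⟨hb, he, a1, a2, hdj⟩ := h.T4_ann hη hv hw h1 ho
    obtain ⟨_, f1, f2, _, _⟩ := (h.opT hη).blk4 hv hw h1 ho
    refine Or.inr ⟨fun μ hμ d hd => ?_, by rw [f1, f2]⟩
    rw [he, Mz_sup (cy_inv _ _) (cy_inv _ _) hdj, Mz_lin a1 hd.pos, Mz_lin a2 hd.pos]
    have : d ≠ 2 * D := by rintro rfl; exact (Nat.not_odd_iff_even.2 (even_two_mul D)) hd
    simp [this]
end A10

section A11
variable {K V : Type*} [Field K] [AddCommGroup V] [Module K V]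
variable {f : LinearMap.BilinForm K V} {φ φi : Module.End K V}

theorem polar (h : Ctx f φ φi) (W : Submodule K V) (g : K[X])
    (hx : ∃ x ∈ W, ∃ y ∈ W, f (aeval (φ + φi) g x) y ≠ 0) : ∃ v ∈ W, f (aeval (φ + φi) g v) v ≠ 0 := by
  by_contra hc
  push Not at hc
  obtain ⟨x, hx, y, hy, hne⟩ := hx
  apply hne
  have h1 := hc _ (W.add_mem hx hy)
  rw [map_add, map_add, map_add, LinearMap.add_apply, LinearMap.add_apply, hc x hx, hc y hy,
    h.opR.adjg g y x, h.sym y] at h1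
  have : (2 : K) * f (aeval (φ + φi) g x) y = 0 := by linear_combination h1
  exact (mul_eq_zero.1 this).resolve_left h.two

theorem ap_restrict {T : Module.End K V} {U : Submodule K V} (hU : Invt T U) (g : K[X]) (x : U) :
    ((aeval (T.restrict hU) g x : U) : V) = aeval T g x := by
  induction g using Polynomial.induction_on' generalizing x with
  | add p q hp hq => rw [ap_add, ap_add, Submodule.coe_add, hp, hq]
  | monomial n a =>
    rw [← C_mul_X_pow_eq_monomial, ap_mul, ap_mul, ap_C, ap_C, Submodule.coe_smul, ap_Xp, ap_Xp]
    congr 1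
    induction n generalizing x with
    | zero => rfl
    | succ n ih => rw [pow_succ, pow_succ]; exact ih (T.restrict hU x)

theorem lin_pow {c η : K} (hη : η ^ 2 = 1) (hc : c = 2 * η) (k : ℕ) (x : V) :
    aeval (φ + φi) ((X - C c) ^ k) x = η ^ k • (zz φ φi η ^ k) x := by
  induction k generalizing x with
  | zero => simp
  | succ k ih =>
    rw [pow_succ, ap_mul, ih, pow_succ η, mul_smul, pow_succ (zz φ φi η)]
    change _ = η ^ k • η • (zz φ φi η ^ k) (zz φ φi η x)
    have : aeval (φ + φi) (X - C c) x = η • zz φ φi η x := by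
      rw [ap_sub, ap_X, ap_C, zz_apply, hc, smul_sub, smul_smul, smul_smul, ← pow_two, hη, one_smul, mul_comm]
      rfl
    rw [this, map_smul]

variable [FiniteDimensional K V]

theorem Ctx.select (h : Ctx f φ φi) {U : Submodule K V} (hU : Invt φ U) (hN : ND f U) (hne : U ≠ ⊥) (G : V → Prop)
    (hG : ∀ v (g : K[X]), G v → G (aeval (φ + φi) g v))
    (pick : ∀ g : K[X], (∃ x ∈ U, ∃ y ∈ U, f (aeval (φ + φi) g x) y ≠ 0) → ∃ v ∈ U, G v ∧ f (aeval (φ + φi) g v) v ≠ 0) :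
    (∃ v ∈ U, G v ∧ Kd f φ φi (cy (φ + φi) v) (cy (φ + φi) ((φ - φi) v))) ∨
    ∃ η : K, η ^ 2 = 1 ∧ ∃ D, 1 ≤ D ∧ ∃ x ∈ U, ∃ y ∈ U, (zz φ φi η ^ D) x = 0 ∧ (zz φ φi η ^ D) y = 0 ∧
      f ((zz φ φi η ^ (D - 1)) ((φ - φi) x)) y ≠ 0 := by
  have hUi := h.inv_i hU
  have ht := inv_t hU hUi
  have hsU := inv_s hU hUi
  have hop := h.opR
  set t := φ + φi with htd
  have : Nontrivial U := Submodule.nontrivial_iff_ne_bot.2 hne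
  set μ := minpoly K (t.restrict ht) with hμ
  have hint : IsIntegral K (t.restrict ht) := Algebra.IsIntegral.isIntegral _
  have hμ0 : μ ≠ 0 := minpoly.ne_zero hint
  have k1 : ∀ x ∈ U, aeval t μ x = 0 := by
    intro x hx
    rw [← ap_restrict ht μ ⟨x, hx⟩, minpoly.aeval]; rfl
  have k2 : ∀ g, (∀ x ∈ U, aeval t g x = 0) → μ ∣ g := by
    intro g hg
    apply minpoly.dvd
    ext x
    rw [ap_restrict ht g x, hg x x.2]; rfl
  obtain ⟨r, hrm, hr, hrd⟩ := exists_monic_irreducible_factor μ (minpoly.not_isUnit _ _)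
  obtain ⟨μ', h1, h2⟩ := (FiniteMultiplicity.of_not_isUnit hr.not_isUnit hμ0).exists_eq_pow_mul_and_not_dvd
  set D := multiplicity r μ
  have hD : 1 ≤ D := by
    by_contra hc
    rw [show D = 0 by omega, pow_zero, one_mul] at h1
    exact h2 (h1 ▸ hrd)
  have hnd : ¬ μ ∣ r ^ (D - 1) * (μ' * μ') := by
    intro hc
    have h3 : r ^ D ∣ r ^ (D - 1) * (μ' * μ') := (Dvd.intro _ h1.symm).trans hc
    rw [show D = D - 1 + 1 by omega, pow_succ, Nat.add_sub_cancel] at h3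
    have h4 := (mul_dvd_mul_iff_left (pow_ne_zero _ hr.ne_zero)).1 h3
    rcases hr.prime.dvd_or_dvd h4 with h5 | h5 <;> exact h2 h5
  obtain ⟨v0, hv0, hGv0, hfv0⟩ : ∃ v ∈ U, G v ∧ f (aeval t (r ^ (D - 1) * (μ' * μ')) v) v ≠ 0 := by
    apply pick
    by_contra hc
    push Not at hc
    exact hnd (k2 _ fun x hx => hN _ (ap_mem ht _ hx) (hc x hx))
  set v := aeval t μ' v0 with hv
  have hvU : v ∈ U := ap_mem ht _ hv0
  have e0 : aeval t (r ^ D) v = 0 := by rw [hv, ← ap_mul, ← h1, k1 v0 hv0]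
  have e1 : f (aeval t (r ^ (D - 1)) v) v ≠ 0 := by
    rw [hv, ← hop.adjg, ← ap_mul, ← ap_mul,
      show μ' * r ^ (D - 1) * μ' = r ^ (D - 1) * (μ' * μ') by ring]; exact hfv0
  by_cases hS : r ∣ X ^ 2 - 4
  · obtain ⟨η, hη, rfl⟩ : ∃ η : K, η ^ 2 = 1 ∧ r = X - C (2 * η) := by
      have h4 : (X ^ 2 - 4 : K[X]) = (X - C (2 * 1)) * (X - C (2 * (-1))) := by
        simp only [mul_one, mul_neg, C_neg, show (C 2 : K[X]) = 2 from rfl]; ring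
      rw [h4] at hS
      rcases hr.prime.dvd_or_dvd hS with h5 | h5
      · exact ⟨1, by ring, eq_of_monic_of_associated hrm (ir_lin _).2.1 (hr.associated_of_dvd (ir_lin _).1 h5)⟩
      · exact ⟨-1, by ring, eq_of_monic_of_associated hrm (ir_lin _).2.1 (hr.associated_of_dvd (ir_lin _).1 h5)⟩
    have hη0 : η ≠ 0 := by rintro rfl; simp at hη
    have hzk : ∀ k x, aeval t ((X - C (2 * η)) ^ k) x = η ^ k • (zz φ φi η ^ k) x := lin_pow hη rfl
    have hz0 : ∀ k x, aeval t ((X - C (2 * η)) ^ k) x = 0 ↔ (zz φ φi η ^ k) x = 0 := by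
      intro k x
      rw [hzk, smul_eq_zero, or_iff_right (pow_ne_zero _ hη0)]
    by_cases hT4 : ∃ x ∈ U, ∃ y ∈ U, (zz φ φi η ^ D) x = 0 ∧ (zz φ φi η ^ D) y = 0 ∧
      f ((zz φ φi η ^ (D - 1)) ((φ - φi) x)) y ≠ 0
    · exact Or.inr ⟨η, hη, D, hD, hT4⟩
    · left
      push Not at hT4
      refine ⟨v, hvU, hG _ _ hGv0, ?_⟩
      have hk := Kd.T3 (f := f) (φ := φ) (φi := φi) η hη (D - 1) v (by
        rw [Nat.sub_add_cancel hD]; exact (hz0 D v).1 e0) ?_ ?_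
      · rwa [cy_z hη, cy_z hη] at hk
      · apply hN
        · rw [← ap_Xp]; exact ap_mem (inv_z η ht) _ (hsU _ hvU)
        · intro y hy
          obtain ⟨a, b, hab⟩ : IsCoprime ((X - C (2 * η)) ^ D) μ' := (hr.coprime_iff_not_dvd.2 h2).pow_left
          have hy2 : y = aeval t ((X - C (2 * η)) ^ D) (aeval t a y) + aeval t (μ' * b) y := by
            rw [← ap_mul, ← ap_add, show (X - C (2 * η)) ^ D * a + μ' * b = 1 by rw [← hab]; ring, ap_one]
          have hsv : aeval t ((X - C (2 * η)) ^ D) ((φ - φi) v) = 0 := by rw [← hop.commg, e0, map_zero]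
          rw [hy2, map_add, ← hop.adjg]
          rw [hT4 v hvU (aeval t (μ' * b) y) (ap_mem ht _ hy) ((hz0 _ _).1 e0) ((hz0 _ _).1 (by
            rw [← ap_mul, ← mul_assoc, ← h1, mul_comm, ap_mul, k1 y hy, map_zero]))]
          have : aeval t ((X - C (2 * η)) ^ D) ((zz φ φi η ^ (D - 1)) ((φ - φi) v)) = 0 := by
            have h6 := hzk (D - 1) ((φ - φi) v)
            rw [← inv_smul_eq_iff₀ (pow_ne_zero _ hη0)] at h6
            rw [← h6, map_smul, ap_comm, hsv, map_zero, smul_zero]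
          rw [this]; simp
      · rw [hzk] at e1
        intro hh
        apply e1
        rw [map_smul, LinearMap.smul_apply, hh, smul_zero]
  · left
    exact ⟨v, hvU, hG _ _ hGv0, Kd.R r D v hr hrm hS hD e0 e1⟩

/-- inverting involution -/
structure Rv (f : LinearMap.BilinForm K V) (φ φi : Module.End K V) (σ : V →ₗ[K] V) : Prop where
  inv : IsInv f σ
  rv : ∀ x, σ (φ x) = φi (σ x)

omit [FiniteDimensional K V] in
theorem Rv.rv' {σ : V →ₗ[K] V} (h : Ctx f φ φi) (hσ : Rv f φ φi σ) (x : V) : σ (φi x) = φ (σ x) := by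
  have := hσ.rv (φi x)
  rw [h.l] at this
  rw [this, h.l]
omit [FiniteDimensional K V] in
theorem Rv.t {σ : V →ₗ[K] V} (h : Ctx f φ φi) (hσ : Rv f φ φi σ) :
    Invt (φ + φi) (Fm σ) ∧ Invt (φ + φi) (Bm σ) := by
  constructor
  · intro x hx
    rw [mem_Fm] at *
    rw [LinearMap.add_apply, map_add, hσ.rv, hσ.rv' h, hx, add_comm]
  · intro x hx
    rw [mem_Bm] at *
    rw [LinearMap.add_apply, map_add, hσ.rv, hσ.rv' h, hx, map_neg, map_neg]; abel
omit [FiniteDimensional K V] in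
theorem Rv.s {σ : V →ₗ[K] V} (h : Ctx f φ φi) (hσ : Rv f φ φi σ) :
    (∀ x ∈ Fm σ, (φ - φi) x ∈ Bm σ) ∧ (∀ x ∈ Bm σ, (φ - φi) x ∈ Fm σ) := by
  constructor
  · intro x hx
    rw [mem_Fm] at hx
    rw [mem_Bm, LinearMap.sub_apply, map_sub, hσ.rv, hσ.rv' h, hx]; abel
  · intro x hx
    rw [mem_Bm] at hx
    rw [mem_Fm, LinearMap.sub_apply, map_sub, hσ.rv, hσ.rv' h, hx, map_neg, map_neg]; abel

theorem Ctx.block_s (h : Ctx f φ φi) {σ : V →ₗ[K] V} (hσ : Rv f φ φi σ) {U : Submodule K V} (hU : Invt φ U)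
    (hUσ : Invt σ U) (hN : ND f U) (hne : U ≠ ⊥) :
    ∃ P M, Kd f φ φi P M ∧ P ⊔ M ≤ U ∧ ((P ≤ Fm σ ∧ M ≤ Bm σ) ∨ (P ≤ Bm σ ∧ M ≤ Fm σ)) := by
  have hUi := h.inv_i hU
  obtain ⟨tF, tB⟩ := hσ.t h
  obtain ⟨sF, sB⟩ := hσ.s h
  have FB : ∀ {x y}, x ∈ Fm σ → y ∈ Bm σ → f x y = 0 := fun hx hy => hσ.inv.FB h.two hx hy
  have BF : ∀ {x y}, x ∈ Bm σ → y ∈ Fm σ → f x y = 0 := fun hx hy => by rw [h.sym]; exact FB hy hx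
  have hp : ∀ g : K[X], (∃ x ∈ U, ∃ y ∈ U, f (aeval (φ + φi) g x) y ≠ 0) →
      ∃ v ∈ U, (v ∈ Fm σ ∨ v ∈ Bm σ) ∧ f (aeval (φ + φi) g v) v ≠ 0 := by
    rintro g ⟨x, hx, y, hy, hne⟩
    obtain ⟨a, ha, b, hb, rfl⟩ := hσ.inv.decomp h.two hUσ hx
    obtain ⟨c, hc, d, hd, rfl⟩ := hσ.inv.decomp h.two hUσ hy
    simp only [map_add, LinearMap.add_apply] at hne
    rw [FB (ap_mem tF g ha.2) hd.2, BF (ap_mem tB g hb.2) hc.2, add_zero, zero_add] at hne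
    by_cases hz : f (aeval (φ + φi) g a) c = 0
    · rw [hz, zero_add] at hne
      obtain ⟨v, hv, h'⟩ := polar h (U ⊓ Bm σ) g ⟨b, hb, d, hd, hne⟩
      exact ⟨v, hv.1, Or.inr hv.2, h'⟩
    · obtain ⟨v, hv, h'⟩ := polar h (U ⊓ Fm σ) g ⟨a, ha, c, hc, hz⟩
      exact ⟨v, hv.1, Or.inl hv.2, h'⟩
  rcases h.select hU hN hne (fun v => v ∈ Fm σ ∨ v ∈ Bm σ) (fun v g hv => hv.imp (ap_mem tF g) (ap_mem tB g)) hp with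
    ⟨v, hv, hG, hk⟩ | ⟨η, hη, D, hD, x, hx, y, hy, zx, zy, hne⟩
  · refine ⟨_, _, hk, sup_le (cy_le (inv_t hU hUi) hv) (cy_le (inv_t hU hUi) (inv_s hU hUi _ hv)), ?_⟩
    exact hG.imp (fun hv => ⟨cy_le tF hv, cy_le tB (sF _ hv)⟩) (fun hv => ⟨cy_le tB hv, cy_le tF (sB _ hv)⟩)
  · have zF := inv_z η tF
    have zB := inv_z η tB
    have zU := inv_z η (inv_t hU hUi)
    have hop := h.opT hη
    obtain ⟨v, hv, w, hw, e1, e2, e3⟩ : ∃ v ∈ U ⊓ Fm σ, ∃ w ∈ U ⊓ Bm σ, (zz φ φi η ^ D) v = 0 ∧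
        (zz φ φi η ^ D) w = 0 ∧ f ((zz φ φi η ^ (D - 1)) ((φ - φi) v)) w ≠ 0 := by
      obtain ⟨a, ha, b, hb, rfl⟩ := hσ.inv.decomp h.two hUσ hx
      obtain ⟨c, hc, d, hd, rfl⟩ := hσ.inv.decomp h.two hUσ hy
      have sep : ∀ {a b : V}, a ∈ Fm σ → b ∈ Bm σ → (zz φ φi η ^ D) (a + b) = 0 →
          (zz φ φi η ^ D) a = 0 ∧ (zz φ φi η ^ D) b = 0 := by
        intro a b ha hb hab
        rw [map_add] at hab
        have m1 := ap_mem zF (X ^ D) ha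
        have m2 := ap_mem zB (X ^ D) hb
        rw [ap_Xp] at m1 m2
        have e1 := eq_neg_of_add_eq_zero_left hab
        have := Submodule.disjoint_def.1 (FB_disj h.two σ) _ m1 (e1 ▸ (Bm σ).neg_mem m2)
        exact ⟨this, by rw [this, zero_add] at hab; exact hab⟩
      obtain ⟨za, zb⟩ := sep ha.2 hb.2 zx
      obtain ⟨zc, zd⟩ := sep hc.2 hd.2 zy
      have ma := ap_mem zB (X ^ (D - 1)) (sF _ ha.2)
      have mb := ap_mem zF (X ^ (D - 1)) (sB _ hb.2)
      rw [ap_Xp] at ma mb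
      simp only [map_add, LinearMap.add_apply] at hne
      rw [BF ma hc.2, FB mb hd.2, zero_add, add_zero] at hne
      by_cases hz : f ((zz φ φi η ^ (D - 1)) ((φ - φi) a)) d = 0
      · rw [hz, add_zero] at hne
        refine ⟨c, hc, b, hb, zc, zb, ?_⟩
        rw [← ap_Xp, hop.adjg, hop.anti, h.sym, hop.commg, neg_ne_zero, ap_Xp]
        exact hne
      · exact ⟨a, ha, d, hd, za, zd, hz⟩
    have hk := Kd.T4 (f := f) (φ := φ) (φi := φi) η hη D v w hD e1 e2 e3 (fun k => by
      rw [← ap_Xp]; exact FB (ap_mem zF _ hv.2) hw.2)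
    refine ⟨_, _, hk, ?_, Or.inl ⟨?_, ?_⟩⟩
    · exact sup_le (sup_le (cy_le zU hv.1) (cy_le zU (inv_s hU hUi _ hw.1)))
        (sup_le (cy_le zU hw.1) (cy_le zU (inv_s hU hUi _ hv.1)))
    · exact sup_le (cy_le zF hv.2) (cy_le zF (sB _ hw.2))
    · exact sup_le (cy_le zB hw.2) (cy_le zB (sF _ hv.2))

theorem Ctx.block_w (h : Ctx f φ φi) {U : Submodule K V} (hU : Invt φ U) (hN : ND f U) (hne : U ≠ ⊥) :
    ∃ P M, Kd f φ φi P M ∧ P ⊔ M ≤ U := by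
  have hUi := h.inv_i hU
  rcases h.select hU hN hne (fun v => True) (fun v g hv => trivial) (fun g hx => by
      obtain ⟨v, hv, h'⟩ := polar h U g hx
      exact ⟨v, hv, trivial, h'⟩) with
    ⟨v, hv, hG, hk⟩ | ⟨η, hη, D, hD, v, hv, w, hw, zv, zw, hne⟩
  · exact ⟨_, _, hk, sup_le (cy_le (inv_t hU hUi) hv) (cy_le (inv_t hU hUi) (inv_s hU hUi _ hv))⟩
  · have zU := inv_z η (inv_t hU hUi)
    have hop := h.opT hη
    have hsv : (zz φ φi η ^ D) ((φ - φi) v) = 0 := by rw [← ap_Xp, ← hop.commg, ap_Xp, zv, map_zero]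
    set c := f ((zz φ φi η ^ (D - 1)) ((φ - φi) v)) w with hc
    have key : ∀ j ≤ D, ∃ g : K[X], ∀ k, D ≤ k + j →
        f ((zz φ φi η ^ k) (v + aeval (zz φ φi η) g ((φ - φi) v))) w = 0 := by
      intro j hj
      induction j with
      | zero =>
        refine ⟨0, fun k hk => ?_⟩
        rw [map_zero, LinearMap.zero_apply, add_zero, pow_zero_of_le zv (by omega)]; simp
      | succ j ih =>
        obtain ⟨g, hg⟩ := ih (by omega)
        set b := f ((zz φ φi η ^ (D - 1 - j)) (v + aeval (zz φ φi η) g ((φ - φi) v))) w with hb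
        refine ⟨g + C (-b / c) * X ^ j, fun k hk => ?_⟩
        rw [ap_add, ap_mul, ap_C, ap_Xp, ← add_assoc, map_add, map_add, LinearMap.add_apply, map_smul, map_smul,
          LinearMap.smul_apply]
        rw [show (zz φ φi η ^ k) ((zz φ φi η ^ j) ((φ - φi) v)) = (zz φ φi η ^ (k + j)) ((φ - φi) v) by
          rw [pow_add]; rfl]
        by_cases hkj : D ≤ k + j
        · rw [hg k hkj, pow_zero_of_le hsv hkj]; simp
        · rw [show k = D - 1 - j by omega, ← hb, show D - 1 - j + j = D - 1 by omega, ← hc, smul_eq_mul]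
          field_simp; ring
    obtain ⟨g, hg⟩ := key D le_rfl
    have hk := Kd.T4 (f := f) (φ := φ) (φi := φi) η hη D (v + aeval (zz φ φi η) g ((φ - φi) v)) w hD ?_ zw ?_
      (fun k => hg k (by omega))
    · have hv' := U.add_mem hv (ap_mem zU g (inv_s hU hUi _ hv))
      exact ⟨_, _, hk, sup_le (sup_le (cy_le zU hv') (cy_le zU (inv_s hU hUi _ hw)))
        (sup_le (cy_le zU hw) (cy_le zU (inv_s hU hUi _ hv')))⟩
    · rw [map_add, zv, zero_add, ← ap_Xp, ap_comm, ap_Xp, hsv, map_zero]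
    · rw [map_add, map_add, hop.commg, hop.sq, ← ap_mul, ← ap_Xp (zz φ φi η) (D - 1) (aeval (zz φ φi η) (g * (X * (X + 4))) v), ← ap_mul,
        show (X ^ (D - 1) * (g * (X * (X + 4))) : K[X]) = (g * (X + 4)) * X ^ (D - 1 + 1) by ring,
        Nat.sub_add_cancel hD, ap_mul, ap_Xp, zv, map_zero, add_zero]
      exact hne
end A11

section A12
variable {K V : Type*} [Field K] [AddCommGroup V] [Module K V]
variable {f : LinearMap.BilinForm K V} {φ φi : Module.End K V}

theorem Kd.ne {P M : Submodule K V} (k : Kd f φ φi P M) : P ⊔ M ≠ ⊥ := by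
  intro hb
  have h0 : ∀ x ∈ P, x = 0 := fun x hx => by
    have : x ∈ P ⊔ M := Submodule.mem_sup_left hx
    rw [hb] at this; exact this
  cases k with
  | R r D v hr hm hS hD h0' h1 => exact h1 (by rw [h0 v (self_mem_cy _ _)]; simp)
  | T3 η hη e v h0' h0'' h1 => exact h1 (by rw [h0 v (self_mem_cy _ _)]; simp)
  | T4 η hη D v w hD hv hw h1 ho =>
    exact h1 (by rw [h0 v (Submodule.mem_sup_left (self_mem_cy _ _))]; simp)

theorem inv_sup {T : V →ₗ[K] V} {A B : Submodule K V} (hA : Invt T A) (hB : Invt T B) : Invt T (A ⊔ B) := by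
  intro x hx
  obtain ⟨a, ha, b, hb, rfl⟩ := Submodule.mem_sup.1 hx
  rw [map_add]
  exact Submodule.add_mem_sup (hA _ ha) (hB _ hb)

theorem inv_F {σ : V →ₗ[K] V} {A : Submodule K V} (h : A ≤ Fm σ) : Invt σ A := fun x hx => by
  rw [mem_Fm.1 (h hx)]; exact hx
theorem inv_B {σ : V →ₗ[K] V} {A : Submodule K V} (h : A ≤ Bm σ) : Invt σ A := fun x hx => by
  rw [mem_Bm.1 (h hx)]; exact A.neg_mem hx

theorem IsInv.inv_perp {σ : V →ₗ[K] V} (h : IsInv f σ) {A : Submodule K V} (hA : Invt σ A) : Invt σ (perp f A) := by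
  intro x hx u hu
  rw [← h.1, h.2]
  exact hx _ (hA u hu)

/-- side condition -/
def Sd (σ : V →ₗ[K] V) (P M : Submodule K V) : Prop := (P ≤ Fm σ ∧ M ≤ Bm σ) ∨ (P ≤ Bm σ ∧ M ≤ Fm σ)

theorem Sd.inv {σ : V →ₗ[K] V} {P M : Submodule K V} (h : Sd σ P M) : Invt σ (P ⊔ M) := by
  rcases h with h | h
  · exact inv_sup (inv_F h.1) (inv_B h.2)
  · exact inv_sup (inv_B h.1) (inv_F h.2)

theorem sup_inf_B (h2 : (2 : K) ≠ 0) {σ : V →ₗ[K] V} {P M : Submodule K V} (hP : P ≤ Fm σ) (hM : M ≤ Bm σ) :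
    (P ⊔ M) ⊓ Bm σ = M := by
  apply le_antisymm
  · rintro x ⟨hx, hB⟩
    obtain ⟨a, ha, b, hb, rfl⟩ := Submodule.mem_sup.1 hx
    have : a ∈ Bm σ := by have := (Bm σ).sub_mem hB (hM hb); rwa [add_sub_cancel_right] at this
    have h0 := Submodule.disjoint_def.1 (FB_disj h2 σ) a (hP ha) this
    rwa [h0, zero_add]
  · exact le_inf le_sup_right hM

variable [FiniteDimensional K V] [Fintype K] [hK : Fact (Fintype.card K % 4 = 3)]

theorem Ctx.ind_s (h : Ctx f φ φi) {σ : V →ₗ[K] V} (hσ : Rv f φ φi σ) (Q : Submodule K V → Prop) (h0 : Q ⊥)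
    (hstep : ∀ U P M, Invt φ U → Invt σ U → ND f U → Kd f φ φi P M → P ⊔ M ≤ U → Sd σ P M →
      Q (U ⊓ perp f (P ⊔ M)) → Q U) (U : Submodule K V) (hU : Invt φ U) (hUσ : Invt σ U) (hN : ND f U) : Q U := by
  induction hn : finrank K U using Nat.strong_induction_on generalizing U with
  | _ n ih =>
    by_cases hb : U = ⊥
    · rw [hb]; exact h0
    obtain ⟨P, M, k, hle, hsd⟩ := h.block_s hσ hU hUσ hN hb
    have hbl := (k.ds h).1
    have hA := hbl.nd h
    have hi := hbl.inv h
    refine hstep U P M hU hUσ hN k hle hsd (ih _ ?_ _ ?_ ?_ (nd_compl f h.sym hA hN hle) rfl)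
    · have h1 := finrank_split f h.sym hA hle
      have h2 : finrank K (P ⊔ M : Submodule K V) ≠ 0 := fun hh => k.ne (Submodule.finrank_eq_zero.1 hh)
      omega
    · exact fun x hx => ⟨hU x hx.1, h.inv_perp hi.2 x hx.2⟩
    · exact fun x hx => ⟨hUσ x hx.1, hσ.inv.inv_perp (Sd.inv hsd) x hx.2⟩

theorem Ctx.ind_w (h : Ctx f φ φi) (Q : Submodule K V → Prop) (h0 : Q ⊥)
    (hstep : ∀ U P M, Invt φ U → ND f U → Kd f φ φi P M → P ⊔ M ≤ U →
      Q (U ⊓ perp f (P ⊔ M)) → Q U) (U : Submodule K V) (hU : Invt φ U) (hN : ND f U) : Q U := by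
  induction hn : finrank K U using Nat.strong_induction_on generalizing U with
  | _ n ih =>
    by_cases hb : U = ⊥
    · rw [hb]; exact h0
    obtain ⟨P, M, k, hle⟩ := h.block_w hU hN hb
    have hbl := (k.ds h).1
    have hA := hbl.nd h
    have hi := hbl.inv h
    refine hstep U P M hU hN k hle (ih _ ?_ _ ?_ (nd_compl f h.sym hA hN hle) rfl)
    · have h1 := finrank_split f h.sym hA hle
      have h2 : finrank K (P ⊔ M : Submodule K V) ≠ 0 := fun hh => k.ne (Submodule.finrank_eq_zero.1 hh)
      omega
    · exact fun x hx => ⟨hU x hx.1, h.inv_perp hi.2 x hx.2⟩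

/-- additivity of multiplicities -/
theorem Ctx.Mz_split (h : Ctx f φ φi) {A U : Submodule K V} (hA : Invt φ A) (hU : Invt φ U) (hN : ND f A) (hle : A ≤ U)
    (p : K[X]) (d : ℕ) : Mz φ p U d = Mz φ p A d + Mz φ p (U ⊓ perp f A) d := by
  have hB : Invt φ (U ⊓ perp f A) := fun x hx => ⟨hU x hx.1, h.inv_perp (h.inv_i hA) x hx.2⟩
  have e := nd_sup_perp f h.sym hN hle
  refine Eq.trans (by rw [e]) (Mz_sup hA hB ?_ p d)
  exact ((nd_disj f h.sym hN).mono_right inf_le_right)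

theorem Ctx.bz_split (h : Ctx f φ φi) {A U : Submodule K V} (hA : Invt φ A) (hU : Invt φ U) (hN : ND f A) (hle : A ≤ U) :
    bz φ U = bz φ A + bz φ (U ⊓ perp f A) := by
  have hB : Invt φ (U ⊓ perp f A) := fun x hx => ⟨hU x hx.1, h.inv_perp (h.inv_i hA) x hx.2⟩
  have e := nd_sup_perp f h.sym hN hle
  refine Eq.trans (by rw [e]) (bz_sup hA hB ?_)
  exact ((nd_disj f h.sym hN).mono_right inf_le_right)

theorem Ctx.mult (h : Ctx f φ φi) {U : Submodule K V} (hU : Invt φ U) (hN : ND f U) {p : K[X]} (hp : Irreducible p)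
    (hpm : p.Monic) {d : ℕ} (hd : 1 ≤ d) : ∃ k : ℕ, Mz φ p U d = k * p.natDegree := by
  refine h.ind_w (fun U => ∃ k : ℕ, Mz φ p U d = k * p.natDegree) ⟨0, by rw [Mz_bot]; simp⟩ ?_ U hU hN
  rintro U P M hU hN k hle ⟨b, hb⟩
  obtain ⟨hbl, hds⟩ := k.ds h
  obtain ⟨a, ha⟩ := hds.mult hp hpm hd
  exact ⟨a + b, by rw [h.Mz_split (hbl.inv h).1 hU (hbl.nd h) hle, ha, hb]; push_cast; ring⟩

/-- no odd divisors -/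
def No1 (φ : Module.End K V) : Prop := ∀ p : K[X], Irreducible p → p.Monic → p ≠ X - C 1 → p ≠ X - C (-1) →
  ∀ d, Odd d → Mz φ p ⊤ d = 0

theorem Ctx.r_even (h : Ctx f φ φi) (hN : ND f ⊤) (h1 : No1 φ) {r : K[X]} {D : ℕ} {v : V} (hr : Irreducible r)
    (hm : r.Monic) (hS : ¬ r ∣ X ^ 2 - 4) (hD : 1 ≤ D) (ha : Ann φ v (Rh r ^ D)) (hNv : ND f (cy φ v)) : Even D := by
  by_contra ho
  rw [Nat.not_even_iff_odd] at ho
  obtain ⟨p, p1, p2, p3, p4, p5⟩ := R_odd hr hm hS ha hD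
  have h2 := h1 p p1 p2 p3 p4 D ho
  rw [h.Mz_split (U := ⊤) (cy_inv φ v) (fun _ _ => Submodule.mem_top) hNv le_top, p5] at h2
  obtain ⟨k, hk⟩ := h.mult (U := ⊤ ⊓ perp f (cy φ v)) (fun x hx => ⟨Submodule.mem_top, h.inv_perp (h.inv_i (cy_inv φ v)) x hx.2⟩)
    (nd_compl f h.sym hNv hN le_top) p1 p2 hD
  rw [hk] at h2
  have := p1.natDegree_pos
  have h3 : (0 : ℤ) ≤ k * p.natDegree := by positivity
  omega

noncomputable def nz (φ : Module.End K V) (U : Submodule K V) (j : ℕ) : ℤ :=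
  ∑ d ∈ Finset.range (finrank K V + 1), if d % 8 = j then Mz φ (X - C 1) U d + Mz φ (X - C (-1)) U d else 0

theorem nz_zero {U : Submodule K V} {j : ℕ} (hj : 1 ≤ j) (h : ∀ μ : K, μ ^ 2 = 1 → ∀ d, 1 ≤ d → Mz φ (X - C μ) U d = 0) :
    nz φ U j = 0 := by
  apply Finset.sum_eq_zero
  intro d _
  split_ifs with hd
  · have hd1 : 1 ≤ d := by by_contra hc; rw [show d = 0 by omega] at hd; omega
    rw [h 1 (by ring) d hd1, h (-1) (by ring) d hd1, add_zero]
  · rfl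

theorem nz_lin {η : K} (hη : η ^ 2 = 1) {n : ℕ} {v : V} (h : Ann φ v ((X - C η) ^ n)) {j : ℕ} (hj : 1 ≤ j) :
    nz φ (cy φ v) j = if n % 8 = j then 1 else 0 := by
  classical
  have hn : n ≤ finrank K V := by
    have := cy_finrank ((ir_lin η).2.1.pow n) h
    rw [natDegree_pow, (ir_lin η).2.2, mul_one] at this
    rw [← this]; exact Submodule.finrank_le _
  have h2 : (2 : K) ≠ 0 := two_ne
  have h11 : (1 : K) ≠ -1 := fun hh => h2 (by linear_combination hh)
  have : ∀ d ∈ Finset.range (finrank K V + 1),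
      (if d % 8 = j then Mz φ (X - C 1) (cy φ v) d + Mz φ (X - C (-1)) (cy φ v) d else 0) =
      if d = n then (if n % 8 = j then (1 : ℤ) else 0) else 0 := by
    intro d _
    by_cases hd : d % 8 = j
    · have hd1 : 1 ≤ d := by by_contra hc; rw [show d = 0 by omega] at hd; omega
      rw [if_pos hd, Mz_lin h hd1, Mz_lin h hd1]
      by_cases hdn : d = n
      · subst hdn
        rcases sq_eq_one_iff.1 hη with rfl | rfl
        · simp [h11.symm, hd]
        · simp [h11, hd]
      · simp [hdn]
    · rw [if_neg hd]
      by_cases hdn : d = n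
      · subst hdn; simp [hd]
      · simp [hdn]
  unfold nz
  rw [Finset.sum_congr rfl this, Finset.sum_ite_eq', if_pos (Finset.mem_range.2 (by omega))]

theorem Ctx.nz_split (h : Ctx f φ φi) {A U : Submodule K V} (hA : Invt φ A) (hU : Invt φ U) (hN : ND f A) (hle : A ≤ U)
    (j : ℕ) : nz φ U j = nz φ A j + nz φ (U ⊓ perp f A) j := by
  unfold nz
  rw [← Finset.sum_add_distrib]
  apply Finset.sum_congr rfl
  intro d _
  rw [h.Mz_split hA hU hN hle, h.Mz_split hA hU hN hle]
  split_ifs <;> ring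

theorem nz_sup {A B : Submodule K V} (hA : Invt φ A) (hB : Invt φ B) (hd : Disjoint A B) (j : ℕ) :
    nz φ (A ⊔ B) j = nz φ A j + nz φ B j := by
  unfold nz
  rw [← Finset.sum_add_distrib]
  apply Finset.sum_congr rfl
  intro d _
  rw [Mz_sup hA hB hd, Mz_sup hA hB hd]
  split_ifs <;> ring

def Good (f : LinearMap.BilinForm K V) (φ : Module.End K V) (U B : Submodule K V) (δ : ℤ) : Prop :=
  ∃ c35 c2 c6 c4 : ℕ, nz φ U 3 + nz φ U 5 = c35 ∧ nz φ U 2 = 2 * c2 ∧ nz φ U 6 = 2 * c6 ∧ bz φ U = 4 * c4 ∧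
    dq f B = (-1) ^ (c35 + c2 + c6 + c4) * δ ^ finrank K B

theorem rh_cop {r : K[X]} (hr : Irreducible r) (hm : r.Monic) (hS : ¬ r ∣ X ^ 2 - 4) (D : ℕ) :
    IsCoprime (Rh r ^ D) (X ^ 2 - 1) := by
  apply IsCoprime.pow_left
  rw [show (X ^ 2 - 1 : K[X]) = (X - C 1) * (X - C (-1)) by simp; ring]
  apply IsCoprime.mul_right
  · exact ((ir_lin _).1.coprime_iff_not_dvd.2 (Rh_pm hr hm hS (by ring))).symm
  · exact ((ir_lin _).1.coprime_iff_not_dvd.2 (Rh_pm hr hm hS (by ring))).symm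

theorem Kd.good (h : Ctx f φ φi) (hN : ND f ⊤) (h1 : No1 φ) {P M : Submodule K V} (k : Kd f φ φi P M) {δ : ℤ}
    (hδ : δ * δ = 1) (hA : Odd (finrank K (P ⊔ M : Submodule K V)) → dq f (P ⊔ M) = δ) :
    Good f φ (P ⊔ M) P δ ∧ Good f φ (P ⊔ M) M δ := by
  have hev : ∀ n, δ ^ (2 * n) = 1 := fun n => by rw [pow_mul, pow_two, hδ, one_pow]
  cases k with
  | R r D v hr hm hS hD h0 hf =>
    obtain ⟨hb, he, f1, f2, ha, a1, a2⟩ := h.R_ann hr hm hS h0 (fun _ => ⟨1, by rw [one_mul]; exact hf⟩)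
    have hNv := hb.nd h
    rw [he] at hNv
    obtain ⟨c, hc⟩ := h.r_even hN h1 hr hm hS hD ha hNv
    rw [← two_mul] at hc
    subst hc
    rw [he]
    obtain ⟨g1, g2⟩ := h.opR.dqR hr hm a1 hb.ndP
    obtain ⟨g3, g4⟩ := h.opR.dqR hr hm a2 hb.ndM
    have hz : ∀ j, 1 ≤ j → nz φ (cy φ v) j = 0 := fun j hj => nz_zero hj (fun μ hμ d hd => Mz_linR hμ hr hm hS ha hd)
    have hbz : bz φ (cy φ v) = 4 * (c * r.natDegree : ℕ) := by
      rw [bz_cop ha (rh_cop hr hm hS _), cy_finrank ((Rh_natDegree_aux r hm).2.pow _) ha, natDegree_pow,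
        (Rh_natDegree_aux r hm).1]; push_cast; ring
    constructor
    · refine ⟨0, 0, 0, c * r.natDegree, by simp [hz], by simp [hz], by simp [hz], hbz, ?_⟩
      rw [g1, g2, hev]; simp
    · refine ⟨0, 0, 0, c * r.natDegree, by simp [hz], by simp [hz], by simp [hz], hbz, ?_⟩
      rw [g3, g4, hev]; simp
  | T3 η hη e v h0 h0' hf =>
    obtain ⟨hb, f1, f2, g1, g2⟩ := (h.opT hη).dq3 h0 h0' hf
    have hb' := hb.toT hη
    rw [cy_z hη, cy_z hη] at *
    have he := h.cyc_eq hb'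
    have hfr : finrank K (cy φ v) = 2 * e + 1 := by
      rw [← he, finrank_sup_disj (hb'.disj h.sym), f1, f2]; ring
    have ha : Ann φ v ((X - C η) ^ (2 * e + 1)) := ann_of_finrank ((ir_lin η).2.1.pow _) (h.kill3 hη e v h0 h0') (by
      rw [hfr, natDegree_pow, (ir_lin η).2.2]; ring)
    rw [he] at g1 g2 hA ⊢
    rw [hA (by rw [hfr]; exact ⟨e, rfl⟩)] at g1 g2
    have hbz : bz φ (cy φ v) = 0 := bz_kill hη (2 * e + 1) (by rw [← hfr]; exact Submodule.finrank_le _)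
      (cy_kill ((ha _).2 dvd_rfl))
    have hep : ep (2 * e + 1) = (-1) ^ ((if (2 * e + 1) % 8 = 3 then 1 else 0) + (if (2 * e + 1) % 8 = 5 then 1 else 0)) := by
      unfold ep
      split_ifs <;> first | omega | simp
    have n3 := nz_lin hη ha (j := 3) (by norm_num)
    have n5 := nz_lin hη ha (j := 5) (by norm_num)
    have n2 := nz_lin hη ha (j := 2) (by norm_num)
    have n6 := nz_lin hη ha (j := 6) (by norm_num)
    rw [if_neg (by omega)] at n2 n6
    constructor
    · refine ⟨(if (2 * e + 1) % 8 = 3 then 1 else 0) + (if (2 * e + 1) % 8 = 5 then 1 else 0), 0, 0, 0, ?_, by simp [n2], by simp [n6], by simp [hbz], ?_⟩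
      rotate_left
      · rw [g1, hep, f1]; rfl
      · rw [n3, n5]; push_cast; rfl
    · refine ⟨(if (2 * e + 1) % 8 = 3 then 1 else 0) + (if (2 * e + 1) % 8 = 5 then 1 else 0), 0, 0, 0, ?_, by simp [n2], by simp [n6], by simp [hbz], ?_⟩
      rotate_left
      · rw [g2, hep, f2]; rfl
      · rw [n3, n5]; push_cast; rfl
  | T4 η hη D v w hD hv hw hf ho =>
    obtain ⟨hb, f1, f2, g1, g2⟩ := (h.opT hη).blk4 hv hw hf ho
    obtain ⟨_, he, a1, a2, hd⟩ := h.T4_ann hη hv hw hf ho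
    rw [he]
    have hj : ∀ j, 1 ≤ j → nz φ (cy φ v ⊔ cy φ w) j = 2 * (if 2 * D % 8 = j then 1 else 0 : ℕ) := fun j hj => by
      rw [nz_sup (cy_inv _ _) (cy_inv _ _) hd, nz_lin hη a1 hj, nz_lin hη a2 hj]; push_cast; ring
    have hle : 2 * D ≤ finrank K V := by
      have := cy_finrank ((ir_lin η).2.1.pow (2 * D)) a1
      rw [natDegree_pow, (ir_lin η).2.2, mul_one] at this
      rw [← this]; exact Submodule.finrank_le _
    have hbz : bz φ (cy φ v ⊔ cy φ w) = 0 := by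
      rw [bz_sup (cy_inv _ _) (cy_inv _ _) hd, bz_kill hη (2 * D) hle (cy_kill ((a1 _).2 dvd_rfl)),
        bz_kill hη (2 * D) hle (cy_kill ((a2 _).2 dvd_rfl)), add_zero]
    have hep : (-1 : ℤ) ^ D = (-1) ^ (0 + (if 2 * D % 8 = 2 then 1 else 0) + (if 2 * D % 8 = 6 then 1 else 0) + 0) := by
      rcases Nat.even_or_odd D with h' | h'
      · rw [h'.neg_one_pow, if_neg (by rw [Nat.even_iff] at h'; omega), if_neg (by rw [Nat.even_iff] at h'; omega)]; simp
      · rw [h'.neg_one_pow]; rw [Nat.odd_iff] at h'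
        split_ifs <;> first | omega | simp
    have n3 := hj 3 (by norm_num)
    have n5 := hj 5 (by norm_num)
    rw [if_neg (by omega)] at n3 n5
    constructor
    · refine ⟨0, (if 2 * D % 8 = 2 then 1 else 0), (if 2 * D % 8 = 6 then 1 else 0), 0, by simp [n3, n5], hj 2 (by norm_num), hj 6 (by norm_num), by simp [hbz], ?_⟩
      rw [g1, f1, hev, hep, mul_one]
    · refine ⟨0, (if 2 * D % 8 = 2 then 1 else 0), (if 2 * D % 8 = 6 then 1 else 0), 0, by simp [n3, n5], hj 2 (by norm_num), hj 6 (by norm_num), by simp [hbz], ?_⟩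
      rw [g2, f2, hev, hep, mul_one]
end A12

section A13
variable {K V : Type*} [Field K] [AddCommGroup V] [Module K V]
variable {f : LinearMap.BilinForm K V} {φ φi : Module.End K V}

variable [FiniteDimensional K V] [Fintype K] [hK : Fact (Fintype.card K % 4 = 3)]

theorem IsInv.splitB {σ : V →ₗ[K] V} (h : IsInv f σ) (hs : ∀ x y, f x y = f y x) {A U : Submodule K V} (hA : Invt σ A)
    (hN : ND f A) (hle : A ≤ U) :
    finrank K (U ⊓ Bm σ : Submodule K V) = finrank K (A ⊓ Bm σ : Submodule K V) + finrank K (U ⊓ perp f A ⊓ Bm σ : Submodule K V) ∧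
    (ND f U → Invt σ U → dq f (U ⊓ Bm σ) = dq f (A ⊓ Bm σ) * dq f (U ⊓ perp f A ⊓ Bm σ)) := by
  have h2 : (2 : K) ≠ 0 := two_ne
  have hle' : A ⊓ Bm σ ≤ U ⊓ Bm σ := inf_le_inf_right _ hle
  have hNB : ND f (A ⊓ Bm σ) := h.nd_B h2 hA hN hs
  have e : U ⊓ Bm σ ⊓ perp f (A ⊓ Bm σ) = U ⊓ perp f A ⊓ Bm σ := by
    ext x
    constructor
    · rintro ⟨⟨hx, hB⟩, hp⟩
      refine ⟨⟨hx, fun a ha => ?_⟩, hB⟩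
      obtain ⟨a1, h1, a2, h3, rfl⟩ := h.decomp h2 hA ha
      rw [map_add, LinearMap.add_apply, h.FB h2 h1.2 hB, hp _ h3, add_zero]
    · rintro ⟨⟨hx, hp⟩, hB⟩
      exact ⟨⟨hx, hB⟩, fun a ha => hp a ha.1⟩
  rw [← e]
  exact ⟨finrank_split f hs hNB hle', fun hU hUi => dq_split f hs hNB hle'⟩

theorem Good.add (h : Ctx f φ φi) {σ : V →ₗ[K] V} (hσ : Rv f φ φi σ) {A U : Submodule K V} {δ : ℤ}
    (hA : Invt φ A) (hAσ : Invt σ A) (hN : ND f A) (hU : Invt φ U) (hUσ : Invt σ U) (hNU : ND f U) (hle : A ≤ U)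
    (g1 : Good f φ A (A ⊓ Bm σ) δ) (g2 : Good f φ (U ⊓ perp f A) (U ⊓ perp f A ⊓ Bm σ) δ) :
    Good f φ U (U ⊓ Bm σ) δ := by
  obtain ⟨a, b, c, d, h1, h2, h3, h4, h5⟩ := g1
  obtain ⟨a', b', c', d', h1', h2', h3', h4', h5'⟩ := g2
  obtain ⟨s1, s2⟩ := hσ.inv.splitB h.sym hAσ hN hle
  have hz := h.nz_split hA hU hN hle
  refine ⟨a + a', b + b', c + c', d + d', ?_, ?_, ?_, ?_, ?_⟩
  · rw [hz, hz]; push_cast; linarith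
  · rw [hz]; push_cast; linarith
  · rw [hz]; push_cast; linarith
  · rw [h.bz_split hA hU hN hle]; push_cast; linarith
  · rw [s2 hNU hUσ, h5, h5', s1]; ring

theorem Ctx.goodU (h : Ctx f φ φi) (hN : ND f ⊤) (h1 : No1 φ) {σ : V →ₗ[K] V} (hσ : Rv f φ φi σ) {δ : ℤ} (hδ : δ * δ = 1)
    {U : Submodule K V} (hU : Invt φ U) (hUσ : Invt σ U) (hNU : ND f U)
    (hC : ∀ C ≤ U, Invt φ C → Invt σ C → ND f C → Odd (finrank K C) → dq f C = δ) : Good f φ U (U ⊓ Bm σ) δ := by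
  refine h.ind_s hσ (fun U => (∀ C ≤ U, Invt φ C → Invt σ C → ND f C → Odd (finrank K C) → dq f C = δ) →
    Good f φ U (U ⊓ Bm σ) δ) ?_ ?_ U hU hUσ hNU hC
  · intro _
    have hz : ∀ j, nz φ (⊥ : Submodule K V) j = 0 := fun j => by simp [nz, Mz_bot]
    exact ⟨0, 0, 0, 0, by simp [hz], by simp [hz], by simp [hz], by simp [bz_bot], by rw [bot_inf_eq, dq_bot, finrank_bot]; simp⟩
  · intro U P M hU hUσ hNU k hle hsd ih hC
    have hb := (k.ds h).1
    have hi := hb.inv h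
    have hn := hb.nd h
    refine Good.add h hσ hi.1 hsd.inv hn hU hUσ hNU hle ?_ (ih fun C hCU => hC C (hCU.trans inf_le_left))
    obtain ⟨g1, g2⟩ := k.good h hN h1 hδ (hC _ hle hi.1 hsd.inv hn)
    rcases hsd with hsd | hsd
    · rwa [sup_inf_B two_ne hsd.1 hsd.2]
    · have := sup_inf_B two_ne hsd.2 hsd.1
      rw [sup_comm] at this
      rwa [this]

theorem inv_top (T : Module.End K V) : Invt T ⊤ := fun _ _ => Submodule.mem_top

theorem Ctx.inv_cpl (h : Ctx f φ φi) {A U : Submodule K V} (hA : Invt φ A) (hU : Invt φ U) : Invt φ (U ⊓ perp f A) :=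
  fun x hx => ⟨hU x hx.1, h.inv_perp (h.inv_i hA) x hx.2⟩

theorem Ctx.thmF (h : Ctx f φ φi) (hN : ND f ⊤) (h1 : No1 φ)
    (h2 : ∀ U, Invt φ U → ND f U → Even (finrank K U) → dq f U = 1)
    {σ : V →ₗ[K] V} (hσ : Rv f φ φi σ) (hB : Even (finrank K (Bm σ))) : Good f φ ⊤ (Bm σ) 1 := by
  suffices hh : ∃ δ : ℤ, δ * δ = 1 ∧ Good f φ ⊤ (⊤ ⊓ Bm σ) δ by
    obtain ⟨δ, hδ, a, b, c, d, e1, e2, e3, e4, e5⟩ := hh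
    rw [top_inf_eq] at e5
    obtain ⟨m, hm⟩ := hB
    refine ⟨a, b, c, d, e1, e2, e3, e4, ?_⟩
    rw [e5, hm, ← two_mul, pow_mul, pow_two, hδ, one_pow, one_pow]
  have sub : ∀ {C U : Submodule K V}, C ≤ U → Invt φ C → Invt φ U → ND f C → ND f U → Odd (finrank K C) →
      Odd (finrank K U) → dq f C = dq f U := by
    intro C U hle hC hU nC nU oC oU
    rw [dq_split f h.sym nC hle, h2 _ (h.inv_cpl hC hU) (nd_compl f h.sym nC nU hle) ?_, mul_one]
    have := finrank_split f h.sym nC hle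
    rw [this] at oU
    rcases Nat.even_or_odd (finrank K (U ⊓ perp f C : Submodule K V)) with e | o
    · exact e
    · exact absurd oU (Nat.not_odd_iff_even.2 (oC.add_odd o))
  have sq : ∀ {C : Submodule K V}, ND f C → dq f C * dq f C = 1 := fun hC => dq_nd_sq f hC
  by_cases hex : ∃ C, Invt φ C ∧ Invt σ C ∧ ND f C ∧ Odd (finrank K C)
  · obtain ⟨C, hC, hCσ, nC, oC⟩ := hex
    have g1 := h.goodU hN h1 hσ (sq nC) hC hCσ nC (fun D hD d1 _ d3 d4 => sub hD d1 hC d3 nC d4 oC)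
    rcases Nat.even_or_odd (finrank K (⊤ : Submodule K V)) with e | o
    · refine ⟨dq f C, sq nC, Good.add h hσ hC hCσ nC (inv_top _) (inv_top _) hN le_top g1 ?_⟩
      have nD := nd_compl f h.sym nC hN le_top
      have hD := h.inv_cpl hC (inv_top φ)
      have oD : Odd (finrank K (⊤ ⊓ perp f C : Submodule K V)) := by
        have := finrank_split f h.sym nC (le_top : C ≤ ⊤)
        rcases Nat.even_or_odd (finrank K (⊤ ⊓ perp f C : Submodule K V)) with e' | o
        · rw [this] at e; exact absurd e (Nat.not_even_iff_odd.2 (oC.add_even e'))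
        · exact o
      have hdd := dq_split f h.sym nC (le_top : C ≤ ⊤)
      rw [h2 _ (inv_top _) hN e] at hdd
      have s1 := sq nC
      have hde : dq f (⊤ ⊓ perp f C) = dq f C := by
        linear_combination (-dq f (⊤ ⊓ perp f C)) * s1 - dq f C * hdd
      refine h.goodU hN h1 hσ s1 hD (fun x hx => ⟨Submodule.mem_top, hσ.inv.inv_perp hCσ x hx.2⟩) nD ?_
      intro E hE e1 _ e3 e4
      rw [← hde]
      exact sub hE e1 hD e3 nD e4 oD
    · exact ⟨dq f ⊤, sq hN, h.goodU hN h1 hσ (sq hN) (inv_top _) (inv_top _) hN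
        (fun D hD d1 _ d3 d4 => sub hD d1 (inv_top _) d3 hN d4 o)⟩
  · refine ⟨1, by norm_num, h.goodU hN h1 hσ (by norm_num) (inv_top _) (inv_top _) hN ?_⟩
    intro C _ c1 c2 c3 c4
    exact absurd ⟨C, c1, c2, c3, c4⟩ hex
end A13

section A14
variable {K V : Type*} [Field K] [AddCommGroup V] [Module K V]
variable {f : LinearMap.BilinForm K V} {φ φi : Module.End K V}
variable [FiniteDimensional K V]

theorem ext_perp (hs : ∀ x y, f x y = f y x) {A : Submodule K V} (hN : ND f A) {σ τ : V →ₗ[K] V}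
    (h1 : ∀ x ∈ A, σ x = τ x) (h2 : ∀ x ∈ perp f A, σ x = τ x) (x : V) : σ x = τ x := by
  obtain ⟨u, hu, hx⟩ := nd_proj f hs hN x
  rw [← add_sub_cancel u x, map_add, map_add, h1 u hu, h2 _ hx]

theorem exists_rho (hs : ∀ x y, f x y = f y x) {M : Submodule K V} (hM : ND f M) :
    ∃ ρ : V →ₗ[K] V, IsInv f ρ ∧ (∀ x ∈ M, ρ x = -x) ∧ ∀ x ∈ perp f M, ρ x = x := by
  have hc : IsCompl M (perp f M) := ⟨nd_disj f hs hM, by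
    rw [codisjoint_iff]
    have := nd_sup_perp f hs hM (le_top : M ≤ ⊤)
    rwa [top_inf_eq] at this⟩
  obtain ⟨π, hπ⟩ : ∃ π : V →ₗ[K] V, ∀ x, π x = x - (2 : K) • (M.projectionOnto _ hc x : V) :=
    ⟨LinearMap.id - (2 : K) • (M.subtype ∘ₗ M.projectionOnto _ hc), fun x => rfl⟩
  have p1 : ∀ x ∈ M, π x = -x := fun x hx => by
    have := Submodule.projectionOnto_apply_left hc ⟨x, hx⟩
    simp only at this
    rw [hπ, this, two_smul]; abel
  have p2 : ∀ x ∈ perp f M, π x = x := fun x hx => by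
    rw [hπ, Submodule.projectionOnto_apply_of_mem_right hc hx]; simp
  refine ⟨π, ⟨fun x y => ?_, ?_⟩, p1, p2⟩
  · obtain ⟨u, hu, hx⟩ := nd_proj f hs hM x
    obtain ⟨w, hw, hy⟩ := nd_proj f hs hM y
    rw [← add_sub_cancel u x, ← add_sub_cancel w y]
    have e1 : f u (y - w) = 0 := hy u hu
    have e2 : f (x - u) w = 0 := by rw [hs]; exact hx w hw
    simp only [map_add, LinearMap.add_apply, p1 u hu, p1 w hw, p2 _ hx, p2 _ hy, map_neg, LinearMap.neg_apply, e1, e2]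
    ring
  · refine ext_perp hs hM (σ := π ∘ₗ π) (τ := LinearMap.id) (fun x hx => ?_) (fun x hx => ?_)
    · simp [p1 x hx]
    · simp [p2 x hx]

omit [FiniteDimensional K V] in
theorem IsInv.comp {σ τ : V →ₗ[K] V} (h1 : IsInv f σ) (h2 : IsInv f τ) (hc : ∀ x, σ (τ x) = τ (σ x)) :
    IsInv f (σ ∘ₗ τ) :=
  ⟨fun x y => by rw [LinearMap.comp_apply, LinearMap.comp_apply, h1.1, h2.1],
   fun x => by simp only [LinearMap.comp_apply]; rw [← hc (τ x), h2.2, h1.2]⟩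

/-- local reversing involution -/
structure RvU (f : LinearMap.BilinForm K V) (φ φi : Module.End K V) (U : Submodule K V) (σ : V →ₗ[K] V) : Prop where
  inv : IsInv f σ
  st : Invt σ U
  fx : ∀ x ∈ perp f U, σ x = x
  rv : ∀ x ∈ U, σ (φ x) = φi (σ x)

omit [FiniteDimensional K V] in
theorem eqB {σ τ : V →ₗ[K] V} {A : Submodule K V} (h : ∀ x ∈ A, σ x = τ x) : A ⊓ Bm σ = A ⊓ Bm τ := by
  ext x
  constructor
  · rintro ⟨h1, h2⟩
    exact ⟨h1, by change τ x = -x; rw [← h x h1]; exact h2⟩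
  · rintro ⟨h1, h2⟩
    exact ⟨h1, by change σ x = -x; rw [h x h1]; exact h2⟩

variable [Fintype K] [hK : Fact (Fintype.card K % 4 = 3)]

theorem Ctx.glue (h : Ctx f φ φi) {A U : Submodule K V} {σ τ : V →ₗ[K] V} (hA : Invt φ A) (hU : Invt φ U) (hN : ND f A)
    (hle : A ≤ U) (h1 : RvU f φ φi A σ) (h2 : RvU f φ φi (U ⊓ perp f A) τ) :
    ∃ ρ, RvU f φ φi U ρ ∧ Invt ρ A ∧ A ⊓ Bm ρ = A ⊓ Bm σ ∧ U ⊓ perp f A ⊓ Bm ρ = U ⊓ perp f A ⊓ Bm τ := by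
  have ta : ∀ a ∈ A, τ a = a := fun a ha => h2.fx a (fun b hb => by rw [h.sym]; exact hb.2 a ha)
  have tp : ∀ b ∈ perp f A, τ b ∈ perp f A := fun b hb a ha => by rw [← h2.inv.1, h2.inv.2, ta a ha]; exact hb a ha
  have hc : ∀ x, σ (τ x) = τ (σ x) := ext_perp h.sym hN (σ := σ ∘ₗ τ) (τ := τ ∘ₗ σ)
    (fun a ha => by simp only [LinearMap.comp_apply]; rw [ta a ha, ta _ (h1.st a ha)])
    (fun b hb => by simp only [LinearMap.comp_apply]; rw [h1.fx b hb, h1.fx _ (tp b hb)])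
  have ra : ∀ a ∈ A, (σ ∘ₗ τ) a = σ a := fun a ha => by simp only [LinearMap.comp_apply]; rw [ta a ha]
  have rb : ∀ b ∈ U ⊓ perp f A, (σ ∘ₗ τ) b = τ b := fun b hb => by
    simp only [LinearMap.comp_apply]; rw [h1.fx _ (tp b hb.2)]
  have dec : ∀ x ∈ U, ∃ a ∈ A, ∃ b ∈ U ⊓ perp f A, a + b = x := fun x hx => by
    rw [← nd_sup_perp f h.sym hN hle] at hx
    exact Submodule.mem_sup.1 hx
  have ib := h.inv_cpl hA hU
  refine ⟨σ ∘ₗ τ, ⟨h1.inv.comp h2.inv hc, ?_, ?_, ?_⟩, ?_, eqB ra, eqB rb⟩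
  · intro x hx
    obtain ⟨a, ha, b, hb, rfl⟩ := dec x hx
    rw [map_add, ra a ha, rb b hb]
    exact U.add_mem (hle (h1.st a ha)) (h2.st b hb).1
  · intro x hx
    rw [LinearMap.comp_apply, h2.fx x (fun b hb => hx b hb.1), h1.fx x (fun a ha => hx a (hle ha))]
  · intro x hx
    obtain ⟨a, ha, b, hb, rfl⟩ := dec x hx
    rw [map_add, map_add, map_add, map_add, ra a ha, rb b hb, ra _ (hA a ha), rb _ (ib b hb), h1.rv a ha, h2.rv b hb]
  · intro a ha
    rw [ra a ha]; exact h1.st a ha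

theorem Ctx.negC (h : Ctx f φ φi) {C U : Submodule K V} {σ : V →ₗ[K] V} (hC : Invt φ C) (hU : Invt φ U) (hN : ND f C)
    (hle : C ≤ U) (h1 : RvU f φ φi U σ) (hσ : Invt σ C) :
    ∃ ρ, RvU f φ φi U ρ ∧ Invt ρ C ∧ C ⊓ Bm ρ = C ⊓ Fm σ ∧ U ⊓ perp f C ⊓ Bm ρ = U ⊓ perp f C ⊓ Bm σ := by
  obtain ⟨τ, t1, t2, t3⟩ := exists_rho h.sym hN
  have sp := h1.inv.inv_perp hσ
  have hc : ∀ x, σ (τ x) = τ (σ x) := ext_perp h.sym hN (σ := σ ∘ₗ τ) (τ := τ ∘ₗ σ)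
    (fun a ha => by simp only [LinearMap.comp_apply]; rw [t2 a ha, t2 _ (hσ a ha), map_neg])
    (fun b hb => by simp only [LinearMap.comp_apply]; rw [t3 b hb, t3 _ (sp b hb)])
  have ra : ∀ a ∈ C, (σ ∘ₗ τ) a = -σ a := fun a ha => by simp only [LinearMap.comp_apply]; rw [t2 a ha, map_neg]
  have rb : ∀ b ∈ perp f C, (σ ∘ₗ τ) b = σ b := fun b hb => by simp only [LinearMap.comp_apply]; rw [t3 b hb]
  have dec : ∀ x ∈ U, ∃ a ∈ C, ∃ b ∈ U ⊓ perp f C, a + b = x := fun x hx => by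
    rw [← nd_sup_perp f h.sym hN hle] at hx
    exact Submodule.mem_sup.1 hx
  have ib := h.inv_cpl hC hU
  refine ⟨σ ∘ₗ τ, ⟨h1.inv.comp t1 hc, ?_, ?_, ?_⟩, ?_, ?_, eqB (fun x hx => rb x hx.2)⟩
  · intro x hx
    obtain ⟨a, ha, b, hb, rfl⟩ := dec x hx
    rw [map_add, ra a ha, rb b hb.2]
    exact U.add_mem (U.neg_mem (hle (hσ a ha))) (h1.st b hb.1)
  · intro x hx
    rw [rb x (fun a ha => hx a (hle ha)), h1.fx x hx]
  · intro x hx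
    obtain ⟨a, ha, b, hb, rfl⟩ := dec x hx
    rw [map_add, map_add, map_add, map_add, ra a ha, rb b hb.2, ra _ (hC a ha), rb _ (ib b hb).2, h1.rv a (hle ha),
      h1.rv b hb.1, map_neg]
  · intro a ha
    rw [ra a ha]; exact C.neg_mem (hσ a ha)
  · ext x
    constructor
    · rintro ⟨hx, hb⟩
      refine ⟨hx, ?_⟩
      change (σ ∘ₗ τ) x = -x at hb
      rw [ra x hx] at hb
      exact neg_injective hb
    · rintro ⟨hx, hb⟩
      refine ⟨hx, ?_⟩
      change (σ ∘ₗ τ) x = -x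
      rw [ra x hx, mem_Fm.1 hb]

theorem Ctx.rvBlk (h : Ctx f φ φi) {P M : Submodule K V} (hb : Blk f (φ + φi) (φ - φi) P M) :
    ∃ ρ, RvU f φ φi (P ⊔ M) ρ ∧ P ≤ Fm ρ ∧ M ≤ Bm ρ := by
  obtain ⟨τ, t1, t2, t3⟩ := exists_rho h.sym hb.ndM
  have hP : P ≤ Fm τ := fun x hx => t3 x (fun y hy => by rw [h.sym]; exact hb.orth x hx y hy)
  have hM : M ≤ Bm τ := t2
  refine ⟨τ, ⟨t1, Sd.inv (Or.inl ⟨hP, hM⟩), fun x hx => t3 x (fun y hy => hx y (Submodule.mem_sup_right hy)), ?_⟩, hP, hM⟩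
  intro x hx
  obtain ⟨a, ha, b, hb', rfl⟩ := Submodule.mem_sup.1 hx
  have key : ∀ x, (2 : K) • φ x = (φ + φi) x + (φ - φi) x := fun x => by
    rw [LinearMap.add_apply, LinearMap.sub_apply, two_smul]; abel
  have e1 : (2 : K) • τ (φ a) = (2 : K) • φi (τ a) := by
    rw [mem_Fm.1 (hP ha), ← map_smul, key, map_add, mem_Fm.1 (hP (hb.TP a ha)), mem_Bm.1 (hM (hb.sP a ha)),
      LinearMap.add_apply, LinearMap.sub_apply, two_smul]; abel
  have e2 : (2 : K) • τ (φ b) = (2 : K) • φi (τ b) := by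
    rw [mem_Bm.1 (hM hb'), ← map_smul, key, map_add, mem_Bm.1 (hM (hb.TM b hb')), mem_Fm.1 (hP (hb.sM b hb')),
      LinearMap.add_apply, LinearMap.sub_apply, two_smul, map_neg]; abel
  rw [map_add, map_add, map_add, map_add, smul_right_injective V h.two e1, smul_right_injective V h.two e2]

theorem Ctx.thmW (h : Ctx f φ φi) {U : Submodule K V} (hU : Invt φ U) (hN : ND f U) : ∃ σ, RvU f φ φi U σ := by
  refine h.ind_w (fun U => ∃ σ, RvU f φ φi U σ) ?_ ?_ U hU hN
  · exact ⟨LinearMap.id, ⟨fun _ _ => rfl, fun _ => rfl⟩, fun _ h => h, fun _ _ => rfl, fun x hx => by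
      rw [(Submodule.mem_bot K).1 hx]; simp⟩
  · rintro U P M hU hN k hle ⟨τ, hτ⟩
    have hb := (k.ds h).1
    obtain ⟨ρ, hρ, _⟩ := h.rvBlk hb
    obtain ⟨σ, hσ, _⟩ := h.glue (hb.inv h).1 hU (hb.nd h) hle hρ hτ
    exact ⟨σ, hσ⟩

theorem Ctx.par (h : Ctx f φ φi) {C U : Submodule K V} (hU : Invt φ U) (hN : ND f U) (hC : Invt φ C) (hNC : ND f C)
    (hle : C ≤ U) (ho : Odd (finrank K C)) (n : ℕ) :
    ∃ σ, RvU f φ φi U σ ∧ Even (finrank K (U ⊓ Bm σ : Submodule K V) + n) := by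
  obtain ⟨σ1, s1⟩ := h.thmW hC hNC
  obtain ⟨σ2, s2⟩ := h.thmW (h.inv_cpl hC hU) (nd_compl f h.sym hNC hN hle)
  obtain ⟨σ, hσ, hi, -, -⟩ := h.glue hC hU hNC hle s1 s2
  by_cases he : Even (finrank K (U ⊓ Bm σ : Submodule K V) + n)
  · exact ⟨σ, hσ, he⟩
  · obtain ⟨ρ, hρ, hi', e1, e2⟩ := h.negC hC hU hNC hle hσ hi
    refine ⟨ρ, hρ, ?_⟩
    have a1 := (hσ.inv.splitB h.sym hi hNC hle).1
    have a2 := (hρ.inv.splitB h.sym hi' hNC hle).1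
    rw [e1, e2] at a2
    have a3 := hσ.inv.finrank_FB h.two hi
    rw [Nat.even_iff] at he ⊢
    rw [Nat.odd_iff] at ho
    omega
end A14

section A15
variable {K V : Type*} [Field K] [AddCommGroup V] [Module K V]
variable {f : LinearMap.BilinForm K V} {φ φi : Module.End K V}
variable [FiniteDimensional K V] [Fintype K] [hK : Fact (Fintype.card K % 4 = 3)]

theorem Ctx.odd_or (h : Ctx f φ φi) {U : Submodule K V} (hU : Invt φ U) (hN : ND f U) :
    NoT φ U ∨ ∃ C ≤ U, Invt φ C ∧ ND f C ∧ Odd (finrank K C) := by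
  refine h.ind_w (fun U => NoT φ U ∨ ∃ C ≤ U, Invt φ C ∧ ND f C ∧ Odd (finrank K C)) ?_ ?_ U hU hN
  · exact Or.inl fun μ _ d _ => Mz_bot _ _ _
  · rintro U P M hU hN k hle ih
    have hb := (k.ds h).1
    rcases k.noT h with h1 | h1
    · exact Or.inr ⟨_, hle, (hb.inv h).1, hb.nd h, h1.1⟩
    · rcases ih with h2 | ⟨C, hC, h3⟩
      · left
        intro μ hμ d hd
        rw [h.Mz_split (hb.inv h).1 hU (hb.nd h) hle, h1.1 μ hμ d hd, h2 μ hμ d hd, add_zero]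
      · exact Or.inr ⟨C, hC.trans inf_le_left, h3⟩

theorem Ctx.noT_half (h : Ctx f φ φi) (hN : ND f ⊤) {σ : V →ₗ[K] V} (hσ : Rv f φ φi σ) (hT : NoT φ (⊤ : Submodule K V)) :
    2 * finrank K (Bm σ) = finrank K V := by
  have key := h.ind_s hσ (fun U => NoT φ U → 2 * finrank K (U ⊓ Bm σ : Submodule K V) = finrank K U) ?_ ?_ ⊤ (inv_top _)
    (inv_top _) hN hT
  · rwa [top_inf_eq, finrank_top] at key
  · intro _; rw [bot_inf_eq]; simp
  · intro U P M hU hUσ hNU k hle hsd ih hT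
    have hb := (k.ds h).1
    have hi := (hb.inv h).1
    have hn := hb.nd h
    have hT' : NoT φ (P ⊔ M) ∧ NoT φ (U ⊓ perp f (P ⊔ M)) := by
      have : ∀ μ : K, μ ^ 2 = 1 → ∀ d, Odd d → Mz φ (X - C μ) (P ⊔ M) d = 0 ∧ Mz φ (X - C μ) (U ⊓ perp f (P ⊔ M)) d = 0 := by
        intro μ hμ d hd
        have e := hT μ hμ d hd
        obtain ⟨i1, i2, i3⟩ := ir_lin μ
        obtain ⟨a, ha⟩ := h.mult hi hn i1 i2 hd.pos
        obtain ⟨b, hb⟩ := h.mult (h.inv_cpl hi hU) (nd_compl f h.sym hn hNU hle) i1 i2 hd.pos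
        rw [h.Mz_split hi hU hn hle, ha, hb] at e
        rw [ha, hb]
        rw [i3] at e ⊢
        omega
      exact ⟨fun μ hμ d hd => (this μ hμ d hd).1, fun μ hμ d hd => (this μ hμ d hd).2⟩
    rcases k.noT h with h1 | h1
    · exact absurd hT'.1 h1.2
    have e1 := ih hT'.2
    have e2 := (hσ.inv.splitB h.sym hsd.inv hn hle).1
    have e3 := finrank_split f h.sym hn hle
    have e4 := finrank_sup_disj (hb.disj h.sym)
    have e5 : finrank K ((P ⊔ M) ⊓ Bm σ : Submodule K V) = finrank K M := by
      rcases hsd with hsd | hsd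
      · rw [sup_inf_B h.two hsd.1 hsd.2]
      · have := sup_inf_B h.two hsd.2 hsd.1
        rw [sup_comm] at this
        rw [this, h1.2]
    omega

theorem RvU.toRv {σ : V →ₗ[K] V} (h : RvU f φ φi ⊤ σ) : Rv f φ φi σ := ⟨h.inv, fun x => h.rv x Submodule.mem_top⟩
theorem Rv.toU (hN : ND f ⊤) (hs : ∀ x y, f x y = f y x) {σ : V →ₗ[K] V} (h : Rv f φ φi σ) : RvU f φ φi ⊤ σ :=
  ⟨h.inv, inv_top _, fun x hx => by
    rw [hN x Submodule.mem_top (fun y hy => by rw [hs]; exact hx y hy), map_zero], fun x _ => h.rv x⟩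

theorem Ctx.back2 (h : Ctx f φ φi) (hN : ND f ⊤) {σ₀ : V →ₗ[K] V} (h0 : Rv f φ φi σ₀) (he : Even (finrank K (Bm σ₀)))
    {U : Submodule K V} (hU : Invt φ U) (hNU : ND f U) (hev : Even (finrank K U)) (hd : dq f U = -1) :
    ∃ σ, Rv f φ φi σ ∧ Even (finrank K (Bm σ)) ∧ dq f (Bm σ) = 1 := by
  have hU' := h.inv_cpl hU (inv_top φ)
  have hN' := nd_compl f h.sym hNU hN le_top
  have step1 : ∃ σ, RvU f φ φi ⊤ σ ∧ Invt σ U ∧ Even (finrank K (⊤ ⊓ Bm σ : Submodule K V)) := by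
    have gl : ∀ {σ1 σ2}, RvU f φ φi U σ1 → RvU f φ φi (⊤ ⊓ perp f U) σ2 → ∃ σ, RvU f φ φi ⊤ σ ∧ Invt σ U ∧
        finrank K (⊤ ⊓ Bm σ : Submodule K V) = finrank K (U ⊓ Bm σ1 : Submodule K V) +
          finrank K (⊤ ⊓ perp f U ⊓ Bm σ2 : Submodule K V) := by
      intro σ1 σ2 h1 h2
      obtain ⟨σ, s1, s2, s3, s4⟩ := h.glue hU (inv_top φ) hNU le_top h1 h2
      refine ⟨σ, s1, s2, ?_⟩
      rw [← s3, ← s4]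
      exact (s1.inv.splitB h.sym s2 hNU le_top).1
    obtain ⟨σ1, s1⟩ := h.thmW hU hNU
    obtain ⟨σ2, s2⟩ := h.thmW hU' hN'
    rcases h.odd_or hU hNU with o1 | ⟨C, c1, c2, c3, c4⟩
    · rcases h.odd_or hU' hN' with o2 | ⟨C, c1, c2, c3, c4⟩
      · obtain ⟨σ, t1, t2, _⟩ := gl s1 s2
        refine ⟨σ, t1, t2, ?_⟩
        have hT : NoT φ (⊤ : Submodule K V) := fun μ hμ d hd => by
          rw [h.Mz_split hU (inv_top φ) hNU le_top, o1 μ hμ d hd, o2 μ hμ d hd, add_zero]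
        have e1 := h.noT_half hN h0 hT
        have e2 := h.noT_half hN t1.toRv hT
        rw [top_inf_eq, show finrank K (Bm σ) = finrank K (Bm σ₀) by omega]
        exact he
      · obtain ⟨σ2, s2, hh⟩ := h.par hU' hN' c2 c3 c1 c4 (finrank K (U ⊓ Bm σ1 : Submodule K V))
        obtain ⟨σ, t1, t2, t3⟩ := gl s1 s2
        exact ⟨σ, t1, t2, by rwa [t3, add_comm]⟩
    · obtain ⟨σ1, s1, hh⟩ := h.par hU hNU c2 c3 c1 c4 (finrank K (⊤ ⊓ perp f U ⊓ Bm σ2 : Submodule K V))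
      obtain ⟨σ, t1, t2, t3⟩ := gl s1 s2
      exact ⟨σ, t1, t2, by rwa [t3]⟩
  obtain ⟨σ, s1, s2, s3⟩ := step1
  have nB : ND f (⊤ ⊓ Bm σ) := s1.inv.nd_B h.two (inv_top _) hN h.sym
  rcases mul_self_eq_one_iff.1 (dq_nd_sq f nB) with hq | hq
  · rw [top_inf_eq] at s3 hq
    exact ⟨σ, s1.toRv, s3, hq⟩
  · obtain ⟨ρ, r1, r2, r3, r4⟩ := h.negC hU (inv_top φ) hNU le_top s1 s2
    obtain ⟨a1, a2⟩ := s1.inv.splitB h.sym s2 hNU le_top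
    obtain ⟨b1, b2⟩ := r1.inv.splitB h.sym r2 hNU le_top
    have a3 := a2 hN (inv_top _)
    have b3 := b2 hN (inv_top _)
    have c1 := s1.inv.finrank_FB h.two s2
    have c2 : dq f U = dq f (U ⊓ Fm σ) * dq f (U ⊓ Bm σ) := by
      conv_lhs => rw [← s1.inv.sup_FB h.two s2]
      exact dq_sup f ((FB_disj h.two σ).mono inf_le_right inf_le_right)
        (fun x hx y hy => s1.inv.FB h.two hx.2 hy.2) (fun x hx y hy => by rw [h.sym]; exact s1.inv.FB h.two hx.2 hy.2)
    rw [r3, r4] at b1 b3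
    have nUB := dq_nd_sq f (s1.inv.nd_B h.two s2 hNU h.sym)
    refine ⟨ρ, r1.toRv, ?_, ?_⟩
    · rw [top_inf_eq] at b1
      rw [Nat.even_iff] at hev s3 ⊢
      omega
    · rw [top_inf_eq] at b3
      rw [b3]
      rw [hd] at c2
      rw [hq] at a3
      have e1 : dq f (U ⊓ Fm σ) = - dq f (U ⊓ Bm σ) := by
        linear_combination dq f (U ⊓ Bm σ) * (-c2) - dq f (U ⊓ Fm σ) * nUB
      rw [e1]; linear_combination a3

theorem Ctx.switch (h : Ctx f φ φi) (hN : ND f ⊤) {σ : V →ₗ[K] V} (hσ : Rv f φ φi σ) {P M P' M' : Submodule K V}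
    (hb : Blk f (φ + φi) (φ - φi) P M) (hb' : Blk f (φ + φi) (φ - φi) P' M') (he : P' ⊔ M' = P ⊔ M)
    (hP : P ≤ Fm σ) (hM : M ≤ Bm σ) : ∃ ρ, Rv f φ φi ρ ∧
      finrank K (Bm ρ) + finrank K M = finrank K (Bm σ) + finrank K M' ∧ dq f (Bm ρ) * dq f M = dq f (Bm σ) * dq f M' := by
  obtain ⟨τ, t1, t2, t3⟩ := exists_rho h.sym hb.ndM
  have hA := hb.nd h
  have hi := hb.inv h
  have tp : ∀ b ∈ perp f (P ⊔ M), τ b = b := fun b hb => t3 b (fun y hy => hb y (Submodule.mem_sup_right hy))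
  have sA : Invt σ (P ⊔ M) := Sd.inv (Or.inl ⟨hP, hM⟩)
  have sp := hσ.inv.inv_perp sA
  have tP : ∀ x ∈ P, τ x = x := fun x hx => t3 x (fun y hy => by rw [h.sym]; exact hb.orth x hx y hy)
  have ra : ∀ a ∈ P ⊔ M, σ (τ a) = a := fun x hx => by
    obtain ⟨a, ha, b, hb', rfl⟩ := Submodule.mem_sup.1 hx
    rw [map_add, tP a ha, t2 b hb', map_add, map_neg, mem_Fm.1 (hP ha), mem_Bm.1 (hM hb'), neg_neg]
  have rc : ∀ a ∈ P ⊔ M, τ (σ a) = a := fun x hx => by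
    obtain ⟨a, ha, b, hb', rfl⟩ := Submodule.mem_sup.1 hx
    rw [map_add, mem_Fm.1 (hP ha), mem_Bm.1 (hM hb'), map_add, map_neg, tP a ha, t2 b hb', neg_neg]
  have hc : ∀ x, σ (τ x) = τ (σ x) := ext_perp h.sym hA (σ := σ ∘ₗ τ) (τ := τ ∘ₗ σ)
    (fun a ha => by simp only [LinearMap.comp_apply]; rw [ra a ha, rc a ha])
    (fun b hb => by simp only [LinearMap.comp_apply]; rw [tp b hb, tp _ (sp b hb)])
  have hR : RvU f φ φi (⊤ ⊓ perp f (P ⊔ M)) (σ ∘ₗ τ) := by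
    refine ⟨hσ.inv.comp t1 hc, ?_, ?_, ?_⟩
    · intro x hx
      rw [LinearMap.comp_apply, tp x hx.2]
      exact ⟨Submodule.mem_top, sp x hx.2⟩
    · intro x hx
      refine ra x ?_
      obtain ⟨u, hu, hx'⟩ := nd_proj f h.sym hA x
      have : x - u = 0 := nd_compl f h.sym hA hN le_top _ ⟨Submodule.mem_top, hx'⟩ (fun y hy => by
        rw [map_sub, LinearMap.sub_apply, h.sym x y, hx y hy, h.sym u y, h.sym y u, hy.2 u hu, sub_zero])
      rw [sub_eq_zero.1 this]; exact hu
    · intro x hx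
      rw [LinearMap.comp_apply, LinearMap.comp_apply, tp x hx.2, tp _ (h.inv_perp hi.2 x hx.2), hσ.rv]
  obtain ⟨κ, k1, k2, k3⟩ := h.rvBlk hb'
  rw [he] at k1
  obtain ⟨ρ, r1, r2, r3, r4⟩ := h.glue hi.1 (inv_top φ) hA le_top k1 hR
  have e4 : ⊤ ⊓ perp f (P ⊔ M) ⊓ Bm (σ ∘ₗ τ) = ⊤ ⊓ perp f (P ⊔ M) ⊓ Bm σ :=
    eqB (fun x hx => by rw [LinearMap.comp_apply, tp x hx.2])
  have e3 : (P ⊔ M) ⊓ Bm κ = M' := by rw [← he]; exact sup_inf_B h.two k2 k3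
  have e5 : (P ⊔ M) ⊓ Bm σ = M := sup_inf_B h.two hP hM
  obtain ⟨a1, a2⟩ := hσ.inv.splitB h.sym sA hA (le_top : _ ≤ ⊤)
  obtain ⟨b1, b2⟩ := r1.inv.splitB h.sym r2 hA (le_top : _ ≤ ⊤)
  have a3 := a2 hN (inv_top _)
  have b3 := b2 hN (inv_top _)
  rw [r3, r4, e3, e4] at b1 b3
  rw [e5] at a1 a3
  rw [top_inf_eq (Bm _)] at a1 a3 b1 b3
  exact ⟨ρ, r1.toRv, by omega, by rw [a3, b3]; ring⟩
end A15

section A16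
variable {K V : Type*} [Field K] [AddCommGroup V] [Module K V]
variable {f : LinearMap.BilinForm K V} {T s : Module.End K V} {S : K[X]}

theorem ap_sum {ι : Type*} [Fintype ι] (g : ι → K[X]) (x : V) : aeval T (∑ i, g i) x = ∑ i, aeval T (g i) x := by
  rw [map_sum, LinearMap.sum_apply]

/-- test family -/
noncomputable def tw (T : Module.End K V) (r : K[X]) (m : ℕ) (v : V) : Fin r.natDegree → V := fun i => aeval T (r ^ m * X ^ (i : ℕ)) v

theorem Op.tw_gram (h : Op f T s S) (r : K[X]) (m : ℕ) (v : V) (i j : Fin r.natDegree) :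
    gram f (tw T r m v) i j = f (aeval T (r ^ (2 * m) * X ^ (i : ℕ) * X ^ (j : ℕ)) v) v := by
  change f (aeval T _ v) (aeval T _ v) = _
  rw [h.gk]
  congr 3
  ring

theorem sum_coeff {r : K[X]} (hm : r.Monic) (hr : r ≠ 1) (k : K[X]) :
    k %ₘ r = ∑ j : Fin r.natDegree, C ((k %ₘ r).coeff j) * X ^ (j : ℕ) := by
  rw [Fin.sum_univ_eq_sum_range (fun j => C ((k %ₘ r).coeff j) * X ^ j)]
  exact as_sum_range_C_mul_X_pow' _ (natDegree_modByMonic_lt k hm hr)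

theorem Op.tw_det (h : Op f T s S) {r : K[X]} (hr : Irreducible r) (hrm : r.Monic) {m : ℕ} {v : V}
    (ha : Ann T v (r ^ (2 * m + 1))) (hn : ND f (cy T v)) : (gram f (tw T r m v)).det ≠ 0 := by
  intro h0
  obtain ⟨c, hc, hc0⟩ := Matrix.exists_vecMul_eq_zero_iff.2 h0
  set g : K[X] := ∑ i : Fin r.natDegree, C (c i) * X ^ (i : ℕ) with hg
  have hr1 : r ≠ 1 := fun e => hr.not_isUnit (e ▸ isUnit_one)
  have e1 : ∑ i, c i • tw T r m v i = aeval T (r ^ m * g) v := by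
    rw [hg, Finset.mul_sum, ap_sum]
    refine Finset.sum_congr rfl fun i _ => ?_
    rw [mul_left_comm, ap_mul, ap_C]; rfl
  have e2 : ∀ j : Fin r.natDegree, f (aeval T (r ^ (2 * m) * g * X ^ (j : ℕ)) v) v = 0 := by
    intro j
    have := congrFun hc0 j
    rw [gram_vecMul, e1] at this
    change f (aeval T _ v) (aeval T _ v) = 0 at this
    rw [h.gk] at this
    rw [← this]; congr 3; ring
  have e3 : aeval T (r ^ (2 * m) * g) v = 0 := by
    refine hn _ ⟨_, rfl⟩ ?_
    rintro _ ⟨k, rfl⟩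
    change f (aeval T _ v) (aeval T k v) = 0
    rw [h.gk, ← modByMonic_add_div k r, mul_add, ap_add,
      (ha (r ^ (2 * m) * g * (r * (k /ₘ r)))).2 ⟨g * (k /ₘ r), by ring⟩, add_zero, sum_coeff hrm hr1 k, Finset.mul_sum,
      ap_sum, map_sum, LinearMap.sum_apply]
    refine Finset.sum_eq_zero fun j _ => ?_
    rw [mul_left_comm, ap_mul, ap_C, map_smul, LinearMap.smul_apply, e2, smul_zero]
  rw [ha, pow_succ, mul_dvd_mul_iff_left (pow_ne_zero _ hr.ne_zero)] at e3
  have e4 : g = 0 := by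
    by_contra hne
    have : g.degree < r.degree := by
      rw [hg, degree_eq_natDegree hrm.ne_zero]
      refine (degree_sum_le _ _).trans_lt ((Finset.sup_lt_iff (WithBot.bot_lt_coe _)).2 fun i _ => ?_)
      exact (degree_C_mul_X_pow_le _ _).trans_lt (by exact_mod_cast i.2)
    exact hne (eq_zero_of_dvd_of_degree_lt e3 this)
  apply hc
  ext i
  have := congrArg (fun p => p.coeff i) e4
  simp only [hg, finsetSum_coeff, coeff_C_mul_X_pow, coeff_zero] at this
  rw [Finset.sum_eq_single i (fun j _ hj => if_neg fun e => hj (Fin.ext e.symm)) (by simp), if_pos rfl] at this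
  exact this

variable [FiniteDimensional K V] [Fintype K] [hK : Fact (Fintype.card K % 4 = 3)]

theorem Op.dqO (h : Op f T s S) {r : K[X]} (hr : Irreducible r) (hrm : r.Monic) {m : ℕ} {v : V}
    (ha : Ann T v (r ^ (2 * m + 1))) (hn : ND f (cy T v)) :
    dq f (cy T v) = qc (gram f (tw T r m v)).det * (-1) ^ (m * r.natDegree) := by
  have hd := h.tw_det hr hrm ha hn
  have hl := li_of_gram f _ hd
  have hn0 := nd_of_gram f _ hd
  have hle : Submodule.span K (Set.range (tw T r m v)) ≤ cy T v := by
    rw [Submodule.span_le]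
    rintro _ ⟨i, rfl⟩
    exact ⟨_, rfl⟩
  have ha' : Ann T (aeval T (r ^ (m + 1)) v) (r ^ m) := by
    intro g
    rw [← ap_mul, ha, show 2 * m + 1 = m + (m + 1) by ring, pow_add]
    exact mul_dvd_mul_iff_right (pow_ne_zero _ hr.ne_zero)
  have hf' : finrank K (cy T (aeval T (r ^ (m + 1)) v)) = m * r.natDegree := by
    rw [cy_finrank (hrm.pow _) ha', natDegree_pow]
  have hf := finrank_split f h.sym hn0 hle
  rw [cy_finrank (hrm.pow _) ha, natDegree_pow, finrank_span_eq_card hl, Fintype.card_fin] at hf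
  rw [dq_split f h.sym hn0 hle, dq_family f _ hl rfl]
  congr 1
  have := dq_half f h.sym (nd_compl f h.sym hn0 hn hle) (W := cy T (aeval T (r ^ (m + 1)) v)) ?_ ?_
    (by rw [hf']; linarith)
  · rw [this, hf']
  · refine le_inf (cy_le (cy_inv _ _) ⟨_, rfl⟩) ?_
    rintro _ ⟨g, rfl⟩ y hy
    change f y (aeval T g _) = 0
    refine Submodule.span_induction (p := fun y _ => f y (aeval T g (aeval T (r ^ (m + 1)) v)) = 0) ?_ (by simp)
      (fun a b _ _ ha hb => by rw [map_add, LinearMap.add_apply, ha, hb, add_zero])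
      (fun c a _ ha => by rw [map_smul, LinearMap.smul_apply, ha, smul_zero]) hy
    rintro _ ⟨i, rfl⟩
    change f (aeval T _ v) _ = 0
    rw [← ap_mul, h.gk, (ha _).2 ⟨X ^ (i : ℕ) * g, by ring⟩]; simp
  · rintro _ ⟨g, rfl⟩ _ ⟨k, rfl⟩
    change f (aeval T g _) (aeval T k _) = 0
    rw [← ap_mul, ← ap_mul, h.gk]
    rw [(ha _).2 ⟨g * k * r, by ring⟩]; simp

theorem Op.tw_norm (h : Op f T s S) {r : K[X]} (hrm : r.Monic) {m : ℕ} {v v' : V}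
    (h0 : aeval T (r ^ (2 * m + 1)) v = 0) {N : K[X]} (hN : ∀ g, f (aeval T g v') v' = f (aeval T (g * N) v) v) :
    (gram f (tw T r m v')).det = Algebra.norm K (AdjoinRoot.mk r N) * (gram f (tw T r m v)).det := by
  have hb : ∀ i : Fin r.natDegree, (AdjoinRoot.powerBasis' hrm).basis i = AdjoinRoot.mk r (X ^ (i : ℕ)) := by
    intro i
    rw [map_pow, AdjoinRoot.mk_X]
    exact (AdjoinRoot.powerBasis' hrm).basis_eq_pow i
  set L : Matrix (Fin r.natDegree) (Fin r.natDegree) K :=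
    Algebra.leftMulMatrix (AdjoinRoot.powerBasis' hrm).basis (AdjoinRoot.mk r N) with hL
  have hn : Algebra.norm K (AdjoinRoot.mk r N) = L.det :=
    Algebra.norm_eq_matrix_det (AdjoinRoot.powerBasis' hrm).basis _
  have hdv : ∀ i : Fin r.natDegree, r ∣ N * X ^ (i : ℕ) - ∑ k : Fin r.natDegree, C (L k i) * X ^ (k : ℕ) := by
    intro i
    rw [← AdjoinRoot.mk_eq_mk, map_mul, ← hb, map_sum]
    have := (AdjoinRoot.powerBasis' hrm).basis.sum_repr (AdjoinRoot.mk r N * (AdjoinRoot.powerBasis' hrm).basis i)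
    rw [← this]
    refine Finset.sum_congr rfl fun k _ => ?_
    have e : L k i = (AdjoinRoot.powerBasis' hrm).basis.repr (AdjoinRoot.mk r N * (AdjoinRoot.powerBasis' hrm).basis i) k :=
      Algebra.leftMulMatrix_eq_repr_mul _ _ _ _
    rw [← e, map_mul, AdjoinRoot.mk_C, Algebra.smul_def]
    congr 1
    exact hb k
  have : gram f (tw T r m v') = L.transpose * gram f (tw T r m v) := by
    ext i j
    rw [h.tw_gram, hN, Matrix.mul_apply]
    obtain ⟨q, hq⟩ := hdv i
    rw [sub_eq_iff_eq_add] at hq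
    rw [show r ^ (2 * m) * X ^ (i : ℕ) * X ^ (j : ℕ) * N =
      q * X ^ (j : ℕ) * r ^ (2 * m + 1) + (∑ k : Fin r.natDegree, C (L k i) * X ^ (k : ℕ)) * (r ^ (2 * m) * X ^ (j : ℕ)) by
        linear_combination (r ^ (2 * m) * X ^ (j : ℕ)) * hq, ap_add, ap_mul T _ (r ^ (2 * m + 1)), h0, map_zero, zero_add,
      Finset.sum_mul, ap_sum, map_sum, LinearMap.sum_apply]
    refine Finset.sum_congr rfl fun k _ => ?_
    rw [h.tw_gram, mul_assoc, ap_mul, ap_C, map_smul, LinearMap.smul_apply, Matrix.transpose_apply, smul_eq_mul]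
    congr 4
    ring
  rw [this, Matrix.det_mul, Matrix.det_transpose, hn]

omit [FiniteDimensional K V] [Fintype K] hK in
theorem Op.newv (h : Op f T s S) (v : V) (a b g : K[X]) :
    f (aeval T g (aeval T a v + aeval T b (s v))) (aeval T a v + aeval T b (s v)) =
      f (aeval T (g * (a ^ 2 - b ^ 2 * S)) v) v := by
  have e1 := h.self_s v (g * a) b
  have e2 := h.self_s v a (g * b)
  have e3 := h.ss v v (g * b) b
  have e4 := h.gk v v (g * a) a
  simp only [map_add (aeval T g), map_add f, map_add (f _), ← ap_mul, LinearMap.add_apply]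
  rw [h.sym] at e2
  rw [e1, e2, e3, e4, show g * (a ^ 2 - b ^ 2 * S) = g * a * a - g * b * b * S by ring, ap_sub]
  simp; ring

theorem exists_norm {r : K[X]} (hr : Irreducible r) (hrm : r.Monic) (hS : ¬ r ∣ S) :
    ∃ a b : K[X], Algebra.norm K (AdjoinRoot.mk r (a ^ 2 - b ^ 2 * S)) = -1 := by
  have : Fact (Irreducible r) := ⟨hr⟩
  have : FiniteDimensional K (AdjoinRoot r) := (AdjoinRoot.powerBasis' hrm).finite
  have : Finite (AdjoinRoot r) := Module.finite_of_finite K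
  have := Fintype.ofFinite (AdjoinRoot r)
  obtain ⟨γ, hγ⟩ := FiniteField.norm_surjective K (AdjoinRoot r) (-1)
  have hc : Fintype.card (AdjoinRoot r) % 2 = 1 := by
    rw [Module.card_eq_pow_finrank (K := K) (V := AdjoinRoot r)]
    have : Odd (Fintype.card K) := Nat.odd_iff.2 (by have := hK.out; omega)
    exact Nat.odd_iff.1 this.pow
  obtain ⟨a, b, hab⟩ := sum_quad hc (one_ne_zero) (neg_ne_zero.2 (mt AdjoinRoot.mk_eq_zero.1 hS)) γ
  obtain ⟨a, rfl⟩ := AdjoinRoot.mk_surjective a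
  obtain ⟨b, rfl⟩ := AdjoinRoot.mk_surjective b
  refine ⟨a, b, ?_⟩
  rw [← hγ, ← hab]
  congr 1
  simp only [map_sub, map_mul, map_pow]; ring

variable {φ φi : Module.End K V}

theorem Ctx.flip (h : Ctx f φ φi) {r : K[X]} {D : ℕ} {v : V} (hr : Irreducible r) (hm : r.Monic) (hS : ¬ r ∣ X ^ 2 - 4)
    (hD : Odd D) (h0 : aeval (φ + φi) (r ^ D) v = 0) (h1 : f (aeval (φ + φi) (r ^ (D - 1)) v) v ≠ 0) :
    ∃ P' M', Blk f (φ + φi) (φ - φi) P' M' ∧ P' ⊔ M' = cy (φ + φi) v ⊔ cy (φ + φi) ((φ - φi) v) ∧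
      finrank K P' = finrank K (cy (φ + φi) v) ∧ finrank K M' = finrank K (cy (φ + φi) ((φ - φi) v)) ∧
      dq f P' = - dq f (cy (φ + φi) v) ∧ dq f M' = - dq f (cy (φ + φi) ((φ - φi) v)) := by
  obtain ⟨m, rfl⟩ := hD
  obtain ⟨a, b, hab⟩ := exists_norm (S := X ^ 2 - 4) hr hm hS
  set N := a ^ 2 - b ^ 2 * (X ^ 2 - 4) with hNd
  set v' := aeval (φ + φi) a v + aeval (φ + φi) b ((φ - φi) v) with hv'
  have hN : ∀ g, f (aeval (φ + φi) g v') v' = f (aeval (φ + φi) (g * N) v) v := h.opR.newv v a b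
  obtain ⟨hb, hc, f1, f2, -, a1, -⟩ := h.R_ann hr hm hS h0 (fun _ => ⟨1, by rw [one_mul]; exact h1⟩)
  have hs0 : aeval (φ + φi) (r ^ (2 * m + 1)) ((φ - φi) v) = 0 := by rw [← h.opR.commg, h0, map_zero]
  have h0' : aeval (φ + φi) (r ^ (2 * m + 1)) v' = 0 := by
    rw [hv', map_add, ap_comm, h0, map_zero, ap_comm, hs0, map_zero, add_zero]
  have hrN : ¬ r ∣ N := by
    intro hd
    rw [AdjoinRoot.mk_eq_zero.2 hd] at hab
    have : Fact (Irreducible r) := ⟨hr⟩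
    have : FiniteDimensional K (AdjoinRoot r) := (AdjoinRoot.powerBasis' hm).finite
    rw [Algebra.norm_zero] at hab
    exact neg_ne_zero.2 one_ne_zero hab.symm
  obtain ⟨x, k, hxk⟩ := hr.coprime_iff_not_dvd.2 hrN
  obtain ⟨hb', hc', f1', f2', -, a1', -⟩ := h.R_ann hr hm hS h0' (fun _ => ⟨k, by
    rw [hN, show k * r ^ (2 * m + 1 - 1) * N = r ^ (2 * m + 1 - 1) - x * r ^ (2 * m + 1) by
      rw [Nat.add_sub_cancel]; linear_combination r ^ (2 * m) * hxk, ap_sub, ap_mul, h0, map_zero, sub_zero]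
    exact h1⟩)
  have hle : cy (φ + φi) v' ⊔ cy (φ + φi) ((φ - φi) v') = cy (φ + φi) v ⊔ cy (φ + φi) ((φ - φi) v) := by
    refine Submodule.eq_of_le_of_finrank_eq ?_ ?_
    · rw [hc', ]
      refine cy_le (hb.inv h).1 ?_
      exact Submodule.add_mem_sup ⟨a, rfl⟩ ⟨b, rfl⟩
    · rw [finrank_sup_disj (hb.disj h.sym), finrank_sup_disj (hb'.disj h.sym), f1, f2, f1', f2']
  have d1 : dq f (cy (φ + φi) v') = - dq f (cy (φ + φi) v) := by
    rw [h.opR.dqO hr hm a1 hb.ndP, h.opR.dqO hr hm a1' hb'.ndP, h.opR.tw_norm hm h0 hN, hab, qc_mul, qc_neg_one]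
    ring
  refine ⟨_, _, hb', hle, by rw [f1, f1'], by rw [f2, f2'], d1, ?_⟩
  have e := dq_blk h.sym hb'
  rw [hle, dq_blk h.sym hb, d1] at e
  have := dq_nd_sq f hb.ndP
  linear_combination dq f (cy (φ + φi) v) * e - (dq f (cy (φ + φi) ((φ - φi) v')) + dq f (cy (φ + φi) ((φ - φi) v))) * this

theorem Ctx.back1 (h : Ctx f φ φi) (hN : ND f ⊤) {σ : V →ₗ[K] V} (hσ : Rv f φ φi σ) (he : Even (finrank K (Bm σ)))
    {p : K[X]} (hp : Irreducible p) (hpm : p.Monic)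
    (h1 : p ≠ X - C 1) (h2 : p ≠ X - C (-1)) {d : ℕ} (hd : Odd d) (hne : Mz φ p ⊤ d ≠ 0) :
    ∃ ρ, Rv f φ φi ρ ∧ Even (finrank K (Bm ρ)) ∧ dq f (Bm ρ) = 1 := by
  by_cases hB : dq f (Bm σ) = 1
  · exact ⟨σ, hσ, he, hB⟩
  have hB' : dq f (Bm σ) = -1 := by
    have := dq_nd_sq f (nd_Bm h.two h.sym hN hσ.inv)
    rcases mul_self_eq_one_iff.1 this with h | h
    · exact absurd h hB
    · exact h
  obtain ⟨P, M, k, hsd, hm⟩ : ∃ P M, Kd f φ φi P M ∧ Sd σ P M ∧ Mz φ p (P ⊔ M) d ≠ 0 := by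
    refine h.ind_s hσ (fun U => Mz φ p U d ≠ 0 → ∃ P M, Kd f φ φi P M ∧ Sd σ P M ∧ Mz φ p (P ⊔ M) d ≠ 0)
      (fun hh => absurd (Mz_bot _ _ _) hh) ?_ ⊤ (inv_top _) (inv_top _) hN hne
    intro U P M hU _ _ k hle hsd ih hh
    by_cases hz : Mz φ p (P ⊔ M) d = 0
    · refine ih fun hz' => hh ?_
      have hbl := (k.ds h).1
      rw [h.Mz_split (hbl.inv h).1 hU (hbl.nd h) hle, hz, hz', add_zero]
    · exact ⟨P, M, k, hsd, hz⟩
  have hb := (k.ds h).1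
  obtain ⟨r, D, v, hr, hrm, hS, hD, h0, hv, rfl, rfl⟩ := k.not1 h hp hpm h1 h2 hd hm
  obtain ⟨P', M', hb', hle, f1, f2, d1, d2⟩ := h.flip hr hrm hS hD h0 hv
  rcases hsd with ⟨hP, hM⟩ | ⟨hP, hM⟩
  · obtain ⟨ρ, r1, r2, r3⟩ := h.switch hN hσ hb hb' hle hP hM
    refine ⟨ρ, r1, by rwa [show finrank K (Bm ρ) = finrank K (Bm σ) by omega], ?_⟩
    have := dq_nd_sq f hb.ndM
    rw [d2, hB'] at r3
    linear_combination dq f (cy (φ + φi) ((φ - φi) v)) * r3 - (dq f (Bm ρ) - 1) * this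
  · obtain ⟨ρ, r1, r2, r3⟩ := h.switch hN hσ (hb.symm h.sym) (hb'.symm h.sym) (by rw [sup_comm, hle, sup_comm]) hM hP
    refine ⟨ρ, r1, by rwa [show finrank K (Bm ρ) = finrank K (Bm σ) by omega], ?_⟩
    have := dq_nd_sq f hb.ndP
    rw [d1, hB'] at r3
    linear_combination dq f (cy (φ + φi) v) * r3 - (dq f (Bm ρ) - 1) * this
end A16

section A17
variable {K V : Type*} [Field K] [AddCommGroup V] [Module K V] [FiniteDimensional K V]
variable {f : LinearMap.BilinForm K V} {φ φi : Module.End K V}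

theorem bahn_bz : (finrank K (bahnInf (φ ^ 2)) : ℤ) = bz φ ⊤ := by
  unfold bz bahnInf
  have e : aeval φ ((X ^ 2 - 1) ^ finrank K V : K[X]) = (φ ^ 2 - 1) ^ finrank K V := by simp
  have h := LinearMap.isCompl_iSup_ker_pow_iInf_range_pow (φ ^ 2 - 1)
  have e2 : ⨆ n, LinearMap.ker ((φ ^ 2 - 1) ^ n) = LinearMap.ker ((φ ^ 2 - 1) ^ finrank K V) :=
    le_antisymm (iSup_le fun n => Module.End.ker_pow_le_ker_pow_finrank _ n) (le_iSup (fun n => LinearMap.ker ((φ ^ 2 - 1) ^ n)) _)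
  rw [e2] at h
  have := Submodule.finrank_add_eq_of_isCompl h
  rw [e, inf_top_eq, finrank_top]
  omega

theorem Ctx.ed (h : Ctx f φ φi) (hN : ND f ⊤) [Fintype K] [hK : Fact (Fintype.card K % 4 = 3)] {p : K[X]} (hp : Irreducible p)
    (hpm : p.Monic) {d : ℕ} (hd : 1 ≤ d) : Mz φ p ⊤ d = edMult φ p d * p.natDegree := by
  obtain ⟨k, hk⟩ := h.mult (inv_top φ) hN hp hpm hd
  rw [hk]
  unfold Mz at hk
  rw [inf_top_eq, inf_top_eq, inf_top_eq] at hk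
  unfold edMult
  have hk' : 2 * finrank K (LinearMap.ker (aeval φ p ^ d)) - finrank K (LinearMap.ker (aeval φ p ^ (d + 1))) -
    finrank K (LinearMap.ker (aeval φ p ^ (d - 1))) = k * p.natDegree := by
    zify
    generalize ((k * p.natDegree : ℕ) : ℤ) = z at *
    push_cast
    have : (0 : ℤ) ≤ k * p.natDegree := by positivity
    omega
  rw [hk', Nat.mul_div_cancel _ hp.natDegree_pos]

theorem Ctx.nPM_nz (h : Ctx f φ φi) (hN : ND f ⊤) [Fintype K] [hK : Fact (Fintype.card K % 4 = 3)] {j : ℕ} (h1 : 1 ≤ j)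
    (h8 : j < 8) : (nPM φ j : ℤ) = nz φ ⊤ j := by
  unfold nPM nz
  push_cast
  refine Finset.sum_congr rfl fun d _ => ?_
  rw [Nat.mod_eq_of_lt h8]
  split_ifs with hd
  · have e1 := h.ed hN (irreducible_X_sub_C (1 : K)) (monic_X_sub_C 1) (d := d) (by omega)
    have e2 := h.ed hN (irreducible_X_sub_C (-1 : K)) (monic_X_sub_C (-1)) (d := d) (by omega)
    rw [natDegree_X_sub_C] at e1 e2
    rw [e1, e2]
    simp
  · rfl

variable [Fintype K] [hK : Fact (Fintype.card K % 4 = 3)]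

theorem Ctx.par3 (h : Ctx f φ φi) (hN : ND f ⊤) {B : Submodule K V} (hg : Good f φ ⊤ B 1) :
    dq f B = 1 ↔ (nPM φ 3 + nPM φ 5 + nPM φ 2 / 2 + nPM φ 6 / 2) % 2 = (finrank K (bahnInf (φ ^ 2)) / 4) % 2 := by
  obtain ⟨c35, c2, c6, c4, g1, g2, g3, g4, g5⟩ := hg
  rw [← h.nPM_nz hN (by omega) (by omega)] at g2 g3
  rw [← h.nPM_nz hN (by omega) (by omega), ← h.nPM_nz hN (by omega) (by omega)] at g1
  rw [← bahn_bz] at g4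
  rw [one_pow, mul_one] at g5
  rw [g5, neg_one_pow_eq_one_iff_even (by norm_num), Nat.even_iff]
  omega

theorem main (hs : ∀ x y, f x y = f y x) (hN : ND f ⊤) (φ : V ≃ₗ[K] V) (hφ : φ ∈ omegaGroup f) :
    IsBireflectionalIn (omegaGroup f) φ ↔
      (IsBireflectionalIn (specialOrthGroup f) φ ∧
        ((∃ (p : K[X]) (d : ℕ), p.Monic ∧ Irreducible p ∧ p ≠ X - 1 ∧ p ≠ X + 1 ∧
            Odd d ∧ edMult (φ : V →ₗ[K] V) p d ≠ 0) ∨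
          (∃ U : Submodule K V, U ≠ ⊥ ∧ Invt (φ : V →ₗ[K] V) U ∧
            (f.restrict U).Nondegenerate ∧ Even (Module.finrank K U) ∧
            HasDisc (f.restrict U) (-1)) ∨
          ((nPM (φ : V →ₗ[K] V) 3 + nPM (φ : V →ₗ[K] V) 5 +
              nPM (φ : V →ₗ[K] V) 2 / 2 + nPM (φ : V →ₗ[K] V) 6 / 2) % 2 =
            (Module.finrank K (bahnInf ((φ : V →ₗ[K] V) ^ 2)) / 4) % 2))) := by
  have hO : omegaGroup f ≤ orthGroup f := fun g hg => (omega_le_so hg).1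
  have hc : Ctx f (φ : V →ₗ[K] V) (φ.symm : V →ₗ[K] V) :=
    ⟨two_ne, hs, hO hφ, fun x => φ.apply_symm_apply x, fun x => φ.symm_apply_apply x⟩
  have e1 : (X - C 1 : K[X]) = X - 1 := by simp
  have e2 : (X - C (-1) : K[X]) = X + 1 := by simp
  have hF : ∀ σ, Rv f (φ : V →ₗ[K] V) (φ.symm : V →ₗ[K] V) σ → Even (finrank K (Bm σ)) →
      (¬ ∃ (p : K[X]) (d : ℕ), p.Monic ∧ Irreducible p ∧ p ≠ X - 1 ∧ p ≠ X + 1 ∧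
            Odd d ∧ edMult (φ : V →ₗ[K] V) p d ≠ 0) → (¬ ∃ U : Submodule K V, U ≠ ⊥ ∧ Invt (φ : V →ₗ[K] V) U ∧
            (f.restrict U).Nondegenerate ∧ Even (Module.finrank K U) ∧
            HasDisc (f.restrict U) (-1)) → Good f (φ : V →ₗ[K] V) ⊤ (Bm σ) 1 := by
    intro σ hσ he n1 n2
    refine hc.thmF hN ?_ ?_ hσ he
    · intro p hp hpm q1 q2 d hd
      by_contra hne
      refine n1 ⟨p, d, hpm, hp, e1 ▸ q1, e2 ▸ q2, hd, fun h0 => hne ?_⟩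
      rw [hc.ed hN hp hpm hd.pos, h0]; simp
    · intro U hU hNU hev
      by_contra hne
      have hm : dq f U = -1 := (mul_self_eq_one_iff.1 (dq_nd_sq f hNU)).resolve_left hne
      refine n2 ⟨U, ?_, hU, (nd_iff f hs U).2 hNU, hev, (hasDisc_iff f U).2 hm⟩
      rintro rfl
      exact hne (dq_bot f)
  constructor
  · intro hb
    obtain ⟨σ, i1, i2, i3, i4⟩ := (biref_omega_iff hs hN hφ).1 hb
    refine ⟨?_, ?_⟩
    · obtain ⟨a, b, h1, h2, h3, h4, h5⟩ := hb
      exact ⟨a, b, omega_le_so h1, omega_le_so h2, h3, h4, h5⟩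
    · by_contra! hcon
      obtain ⟨n1, n2, n3⟩ := hcon
      exact n3 ((hc.par3 hN (hF σ ⟨i1, i2⟩ i3 (by push Not; exact n1) (by push Not; exact n2))).1 i4)
  · rintro ⟨hb, hh⟩
    obtain ⟨σ, i1, i2, i3⟩ := biref_so_inv hb
    suffices ∃ ρ, Rv f (φ : V →ₗ[K] V) (φ.symm : V →ₗ[K] V) ρ ∧ Even (finrank K (Bm ρ)) ∧ dq f (Bm ρ) = 1 by
      obtain ⟨ρ, r1, r2, r3⟩ := this
      exact (biref_omega_iff hs hN hφ).2 ⟨ρ, r1.inv, r1.rv, r2, r3⟩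
    have b1 : (∃ (p : K[X]) (d : ℕ), p.Monic ∧ Irreducible p ∧ p ≠ X - 1 ∧ p ≠ X + 1 ∧
            Odd d ∧ edMult (φ : V →ₗ[K] V) p d ≠ 0) →
        ∃ ρ, Rv f (φ : V →ₗ[K] V) (φ.symm : V →ₗ[K] V) ρ ∧ Even (finrank K (Bm ρ)) ∧ dq f (Bm ρ) = 1 := by
      rintro ⟨p, d, hpm, hp, q1, q2, hd, hne⟩
      refine hc.back1 hN ⟨i1, i2⟩ i3 hp hpm (e1 ▸ q1) (e2 ▸ q2) hd ?_
      rw [hc.ed hN hp hpm hd.pos]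
      exact mul_ne_zero (by exact_mod_cast hne) (by exact_mod_cast hp.natDegree_pos.ne')
    have b2 : (∃ U : Submodule K V, U ≠ ⊥ ∧ Invt (φ : V →ₗ[K] V) U ∧
            (f.restrict U).Nondegenerate ∧ Even (Module.finrank K U) ∧
            HasDisc (f.restrict U) (-1)) →
        ∃ ρ, Rv f (φ : V →ₗ[K] V) (φ.symm : V →ₗ[K] V) ρ ∧ Even (finrank K (Bm ρ)) ∧ dq f (Bm ρ) = 1 := by
      rintro ⟨U, -, hU, hn, hev, hd⟩
      exact hc.back2 hN ⟨i1, i2⟩ i3 hU ((nd_iff f hs U).1 hn) hev ((hasDisc_iff f U).1 hd)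
    by_cases n1 : (∃ (p : K[X]) (d : ℕ), p.Monic ∧ Irreducible p ∧ p ≠ X - 1 ∧ p ≠ X + 1 ∧
            Odd d ∧ edMult (φ : V →ₗ[K] V) p d ≠ 0)
    · exact b1 n1
    by_cases n2 : (∃ U : Submodule K V, U ≠ ⊥ ∧ Invt (φ : V →ₗ[K] V) U ∧
            (f.restrict U).Nondegenerate ∧ Even (Module.finrank K U) ∧
            HasDisc (f.restrict U) (-1))
    · exact b2 n2
    exact ⟨σ, ⟨i1, i2⟩, i3, (hc.par3 hN (hF σ ⟨i1, i2⟩ i3 n1 n2)).2 ((hh.resolve_left n1).resolve_left n2)⟩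
end A17

/-- For `K = GF(q)`, `q ≡ 3 (mod 4)`, and `φ ∈ Ω(V)`: `φ` is bireflectional
in `Ω(V)` iff `φ` is bireflectional in `SO(V)` and (1) `φ` has an elementary divisor `p^d`
with `p ≠ x ± 1` irreducible and `d` odd, or (2) `φ` has an orthogonal summand of even
dimension and discriminant `-1`, or (3) `n₃ + n₅ + n₂/2 + n₆/2 ≡ dim Bahn^∞(φ²)/4 (mod 2)`. -/
theorem stmt4 [Fintype K] {q : ℕ} (hq : Fintype.card K = q) (h3 : q % 4 = 3)
    [FiniteDimensional K V]
    (f : LinearMap.BilinForm K V) (hsymm : f.IsSymm) (hnd : f.Nondegenerate)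
    (φ : V ≃ₗ[K] V) (hφ : φ ∈ omegaGroup f) :
    IsBireflectionalIn (omegaGroup f) φ ↔
      (IsBireflectionalIn (specialOrthGroup f) φ ∧
        ((∃ (p : K[X]) (d : ℕ), p.Monic ∧ Irreducible p ∧ p ≠ X - 1 ∧ p ≠ X + 1 ∧
            Odd d ∧ edMult (φ : V →ₗ[K] V) p d ≠ 0) ∨
          (∃ U : Submodule K V, U ≠ ⊥ ∧ Invt (φ : V →ₗ[K] V) U ∧
            (f.restrict U).Nondegenerate ∧ Even (Module.finrank K U) ∧
            HasDisc (f.restrict U) (-1)) ∨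
          ((nPM (φ : V →ₗ[K] V) 3 + nPM (φ : V →ₗ[K] V) 5 +
              nPM (φ : V →ₗ[K] V) 2 / 2 + nPM (φ : V →ₗ[K] V) 6 / 2) % 2 =
            (Module.finrank K (bahnInf ((φ : V →ₗ[K] V) ^ 2)) / 4) % 2))) := by
  have : Fact (Fintype.card K % 4 = 3) := ⟨hq ▸ h3⟩
  have hs : ∀ x y, f x y = f y x := fun x y => hsymm.eq x y
  exact main hs (nd_top_of fun x hx => hnd.1 x hx) φ hφ


end Biref
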